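/- arXiv:2402.09905 — 2 statements merged into one kernel-verified Lean document; each statement's English description precedes it below -/
import Mathlib

section
/- Let L be a finite geometric lattice, and let (P_{xy})_{x≤y∈L} be a family of polynomials in ℤ[t] satisfying: (i) P_{xx}(t) = 1 for all x ∈ L; (ii) deg P_{xy} < rk[x,y]/2 for all x < y; and (iii) for all x < z, t^{rk[x,z]}·P_{xz}(1/t) = Σ_{x≤y≤z} χ_{xy}(t)·P_{yz}(t) in ℤ[t]. (These are the Kazhdan–Lusztig polynomials of the intervals of L, i.e. the right Kazhdan–Lusztig–Stanley polynomials of the kernel χ.) Then every coefficient of every polynomial P_{xy} is nonnegative. -/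
/-- A real vector space with a symmetric bilinear form and commuting self-adjoint projections
indexed by a ranked join-semilattice. -/
structure KLSpace (L E : Type*) [SemilatticeSup L] [AddCommGroup E] [Module ℝ E] where
  rk : L → ℤ
  rk_strictMono : StrictMono rk
  B : LinearMap.BilinForm ℝ E
  symm : ∀ u v, B u v = B v u
  P : L → E →ₗ[ℝ] E
  P_sup : ∀ y z v, P (y ⊔ z) v = P y (P z v)
  adj : ∀ y u v, B (P y u) v = B u (P y v)

namespace KLSpace

variable {L E : Type*} [SemilatticeSup L] [AddCommGroup E] [Module ℝ E]

/-- The elements reachable from `x` by joining with members of `A`. -/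
inductive Gen (A : Finset L) (x : L) : L → Prop
  | base : Gen A x x
  | step {y a : L} : Gen A x y → a ∈ A → Gen A x (y ⊔ a)

namespace Gen

variable {A A' : Finset L} {x y z : L}

theorem le (h : Gen A x y) : x ≤ y := by
  induction h with
  | base => exact le_rfl
  | step _ _ ih => exact ih.trans le_sup_left

theorem trans (h : Gen A x y) (h' : Gen A y z) : Gen A x z := by
  induction h' with
  | base => exact h
  | step _ ha ih => exact ih.step ha

theorem mono (hA : A' ⊆ A) (h : Gen A' x y) : Gen A x y := by
  induction h with
  | base => exact .base
  | step _ ha ih => exact ih.step (hA ha)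

theorem sup_left (w : L) (h : Gen A x y) : Gen A (x ⊔ w) (y ⊔ w) := by
  induction h with
  | base => exact .base
  | @step y a _ ha ih =>
    have := ih.step ha
    rwa [sup_right_comm] at this

theorem sup (h : Gen A x y) (h' : Gen A x z) : Gen A x (y ⊔ z) := by
  induction h' with
  | base => rwa [sup_eq_left.2 h.le]
  | @step z a _ ha ih =>
    have := ih.step ha
    rwa [sup_assoc] at this

theorem of_le (h : Gen A x z) (h' : Gen A x y) (hyz : y ≤ z) : Gen A y z := by
  have := h.sup_left y
  rwa [sup_eq_right.2 h'.le, sup_eq_left.2 hyz] at this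

theorem exists_step (h : Gen A y z) (hne : y ≠ z) : ∃ a ∈ A, ¬ a ≤ y ∧ a ≤ z := by
  induction h with
  | base => exact absurd rfl hne
  | @step w a hw ha ih =>
    by_cases hyw : y = w
    · subst hyw
      refine ⟨a, ha, fun h => hne (sup_eq_left.2 h).symm, le_sup_right⟩
    · obtain ⟨b, hb, h1, h2⟩ := ih hyw
      exact ⟨b, hb, h1, h2.trans le_sup_left⟩

theorem of_not_le [DecidableEq L] {e : L} (h : Gen A x y) (he : ¬ e ≤ y) :
    Gen (A.erase e) x y := by
  induction h with
  | base => exact .base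
  | @step y a hy ha ih =>
    refine (ih fun h => he (h.trans le_sup_left)).step (Finset.mem_erase.2 ⟨?_, ha⟩)
    rintro rfl
    exact he le_sup_right

end Gen

/-- The joins of the `Q (y ⊔ a)` over the `a ∈ S` not below `y`. -/
def joinUp (Q : L → Submodule ℝ E) (S : Finset L) (y : L) : Submodule ℝ E :=
  ⨆ a ∈ S, ⨆ _ : ¬ a ≤ y, Q (y ⊔ a)

section joinUp

variable {Q Q' : L → Submodule ℝ E} {S S' : Finset L} {y : L}

theorem le_joinUp {a : L} (ha : a ∈ S) (hay : ¬ a ≤ y) : Q (y ⊔ a) ≤ joinUp Q S y :=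
  le_iSup₂_of_le a ha (le_iSup_of_le hay le_rfl)

theorem mem_joinUp {a : L} (ha : a ∈ S) (hay : ¬ a ≤ y) {v : E} (hv : v ∈ Q (y ⊔ a)) :
    v ∈ joinUp Q S y := le_joinUp ha hay hv

theorem joinUp_le {N : Submodule ℝ E} (h : ∀ a ∈ S, ¬ a ≤ y → Q (y ⊔ a) ≤ N) :
    joinUp Q S y ≤ N :=
  iSup₂_le fun a ha => iSup_le fun hay => h a ha hay

theorem joinUp_mono (h : ∀ a ∈ S, ¬ a ≤ y → Q (y ⊔ a) ≤ Q' (y ⊔ a)) :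
    joinUp Q S y ≤ joinUp Q' S y :=
  joinUp_le fun a ha hay => (h a ha hay).trans (le_joinUp ha hay)

theorem joinUp_subset (h : S ⊆ S') : joinUp Q S y ≤ joinUp Q S' y :=
  joinUp_le fun _ ha hay => le_joinUp (h ha) hay

theorem joinUp_empty : joinUp Q ∅ y = ⊥ := by simp [joinUp]

theorem exists_of_mem_joinUp_insert [DecidableEq L] {a : L} {v : E}
    (hv : v ∈ joinUp Q (insert a S) y) (hay : ¬ a ≤ y) :
    ∃ f ∈ Q (y ⊔ a), ∃ w ∈ joinUp Q S y, f + w = v := by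
  rw [joinUp, Finset.iSup_insert] at hv
  obtain ⟨f, hf, w, hw, h⟩ := Submodule.mem_sup.1 hv
  refine ⟨f, ?_, w, hw, h⟩
  simpa [hay] using hf

theorem joinUp_insert_of_le [DecidableEq L] {a : L} (hay : a ≤ y) :
    joinUp Q (insert a S) y = joinUp Q S y := by
  rw [joinUp, Finset.iSup_insert]
  simp [hay, joinUp]

theorem joinUp_eq_of_mem [DecidableEq L] {a : L} {v : E} (ha : a ∈ S)
    (hv : v ∈ joinUp Q S y) (hay : ¬ a ≤ y) :
    ∃ f ∈ Q (y ⊔ a), ∃ w ∈ joinUp Q (S.erase a) y, f + w = v := by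
  rw [← Finset.insert_erase ha] at hv
  exact exists_of_mem_joinUp_insert hv hay

/-- A property of vectors, additive and valid on each `Q (y ⊔ a)`, holds on the join. -/
@[elab_as_elim]
theorem joinUp_induction {p : E → Prop} {v : E} (hv : v ∈ joinUp Q S y)
    (mem : ∀ a ∈ S, ¬ a ≤ y → ∀ v ∈ Q (y ⊔ a), p v) (zero : p 0)
    (add : ∀ v ∈ joinUp Q S y, ∀ w ∈ joinUp Q S y, p v → p w → p (v + w)) : p v := by
  classical
  induction S using Finset.induction_on generalizing v with
  | empty =>
    rw [joinUp_empty, Submodule.mem_bot] at hv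
    rwa [hv]
  | insert a S _ ih =>
    have hs := joinUp_subset (Q := Q) (y := y) (Finset.subset_insert a S)
    have ih' : ∀ v ∈ joinUp Q S y, p v := fun v hv =>
      ih hv (fun b hb => mem b (Finset.mem_insert_of_mem hb))
        (fun v hv w hw => add v (hs hv) w (hs hw))
    by_cases hay : a ≤ y
    · rw [joinUp_insert_of_le hay] at hv
      exact ih' v hv
    · obtain ⟨f, hf, w, hw, rfl⟩ := exists_of_mem_joinUp_insert hv hay
      exact add f (mem_joinUp (Finset.mem_insert_self a S) hay hf) w (hs hw)
        (mem a (Finset.mem_insert_self a S) hay f hf) (ih' w hw)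

end joinUp

variable (X : KLSpace L E)

theorem P_idem (y : L) (v : E) : X.P y (X.P y v) = X.P y v := by
  rw [← X.P_sup, sup_idem]

theorem P_comm (y z : L) (v : E) : X.P y (X.P z v) = X.P z (X.P y v) := by
  rw [← X.P_sup, ← X.P_sup, sup_comm]

theorem P_of_le {y z : L} (h : y ≤ z) (v : E) : X.P y (X.P z v) = X.P z v := by
  rw [← X.P_sup, sup_eq_right.2 h]

theorem P_of_ge {y z : L} (h : y ≤ z) (v : E) : X.P z (X.P y v) = X.P z v := by
  rw [← X.P_sup, sup_eq_left.2 h]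

theorem P_fix_mono {y z : L} (h : y ≤ z) {v : E} (hv : X.P z v = v) : X.P y v = v := by
  rw [← hv, X.P_of_le h]

theorem P_sup_of_fix {y : L} {v : E} (hv : X.P y v = v) (a : L) : X.P (y ⊔ a) v = X.P a v := by
  rw [sup_comm, X.P_sup, hv]

/-- The form is nondegenerate on `N`. -/
def NDeg (N : Submodule ℝ E) : Prop := ∀ v ∈ N, (∀ w ∈ N, X.B v w = 0) → v = 0

variable {X}

theorem NDeg.represent [FiniteDimensional ℝ E] {N : Submodule ℝ E} (h : X.NDeg N)
    (f : E →ₗ[ℝ] ℝ) : ∃ t ∈ N, ∀ w ∈ N, X.B t w = f w := by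
  let T : N →ₗ[ℝ] Module.Dual ℝ N :=
    { toFun := fun v => (X.B v.1).comp N.subtype
      map_add' := fun u v => by ext; simp
      map_smul' := fun u v => by ext; simp }
  have hinj : Function.Injective T := by
    rw [← LinearMap.ker_eq_bot, LinearMap.ker_eq_bot']
    intro m hm
    have : m.1 = 0 := h m.1 m.2 fun w hw => by
      have := LinearMap.congr_fun hm ⟨w, hw⟩
      simpa [T] using this
    exact Subtype.ext this
  have hsurj := (LinearMap.injective_iff_surjective_of_finrank_eq_finrank
    (Subspace.dual_finrank_eq (K := ℝ) (V := N)).symm).1 hinj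
  obtain ⟨t, ht⟩ := hsurj (f.comp N.subtype)
  refine ⟨t.1, t.2, fun w hw => ?_⟩
  have := LinearMap.congr_fun ht ⟨w, hw⟩
  simpa [T] using this

theorem NDeg.exists_proj [FiniteDimensional ℝ E] {N : Submodule ℝ E} (h : X.NDeg N) (v : E) :
    ∃ g ∈ N, ∀ w ∈ N, X.B (v - g) w = 0 := by
  obtain ⟨g, hg, H⟩ := h.represent (X.B v)
  exact ⟨g, hg, fun w hw => by simp [H w hw]⟩

theorem NDeg.mem_of_perp [FiniteDimensional ℝ E] {N S : Submodule ℝ E} (h : X.NDeg N)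
    {v : E} (hv : v ∈ N)
    (H : ∀ t ∈ N, (∀ s ∈ S, X.B t s = 0) → X.B v t = 0) (hS : S ≤ N) : v ∈ S := by
  by_contra hvS
  obtain ⟨f, hf, hSf⟩ := Submodule.exists_le_ker_of_notMem hvS
  obtain ⟨t, ht, htw⟩ := h.represent f
  refine hf ?_
  rw [← htw v hv, X.symm]
  exact H t ht fun s hs => by rw [htw s (hS hs)]; exact hSf hs

end KLSpace

namespace KLSpace

variable {L E : Type*} [SemilatticeSup L] [AddCommGroup E] [Module ℝ E]

/-- The elements strictly above `x` that are reachable from `x` by joining with members of `A`. -/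
def GenS (A : Finset L) (x y : L) : Prop := Gen A x y ∧ x ≠ y

namespace GenS

variable {A A' : Finset L} {x y z : L}

theorem gen (h : GenS A x y) : Gen A x y := h.1

theorem lt (h : GenS A x y) : x < y := lt_of_le_of_ne h.1.le h.2

theorem step_of_gen {a : L} (h : Gen A x y) (ha : a ∈ A) (hay : ¬ a ≤ y) : GenS A x (y ⊔ a) := by
  refine ⟨h.step ha, fun hx => hay ?_⟩
  have : y ⊔ a ≤ y := hx ▸ h.le
  exact le_sup_right.trans this

theorem step {a : L} (h : GenS A x y) (ha : a ∈ A) : GenS A x (y ⊔ a) :=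
  ⟨h.1.step ha, (h.lt.trans_le le_sup_left).ne⟩

theorem mono (hA : A' ⊆ A) (h : GenS A' x y) : GenS A x y := ⟨h.1.mono hA, h.2⟩

theorem of_gen (h : Gen A x y) (h' : GenS A y z) : GenS A x z :=
  ⟨h.trans h'.1, (h.le.trans_lt h'.lt).ne⟩

end GenS

variable (X : KLSpace L E)

/-- The part of `D` fixed by `P y`. -/
def fix (D : Submodule ℝ E) (y : L) : Submodule ℝ E :=
  D ⊓ LinearMap.ker (X.P y - LinearMap.id)

/-- The part of `D` fixed by `P y` and killed by each `P (y ⊔ a)` with `a ∈ A` not below `y`. -/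
def Strat (D : Submodule ℝ E) (A : Finset L) (y : L) : Submodule ℝ E :=
  X.fix D y ⊓ ⨅ a ∈ A, ⨅ _ : ¬ a ≤ y, LinearMap.ker (X.P (y ⊔ a))

/-- The sections over the elements above `y` of degree at most `i`. -/
def U (D : Submodule ℝ E) (Φ : L → ℤ → Submodule ℝ E) (A : Finset L) (y : L) (i : ℤ) :
    Submodule ℝ E :=
  joinUp (X.fix D) A y ⊓ ⨅ a ∈ A, ⨅ _ : ¬ a ≤ y, (Φ (y ⊔ a) (i + 1)).comap (X.P (y ⊔ a))

/-- The projection of `Φ y i` to the stratum at `y`. -/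
def Gr (D : Submodule ℝ E) (Φ : L → ℤ → Submodule ℝ E) (A : Finset L) (y : L) (i : ℤ) :
    Submodule ℝ E :=
  X.Strat D A y ⊓ (Φ y i ⊔ joinUp (X.fix D) A y)

/-- The sections supported above `y` of degree at most `i`. -/
abbrev K (Φ : L → ℤ → Submodule ℝ E) (A : Finset L) (y : L) (i : ℤ) : Submodule ℝ E :=
  joinUp (fun z => Φ z i) A y

/-- The sign `(-1) ^ i`. -/
noncomputable def sgn (i : ℤ) : ℝ := (-1) ^ i

theorem sgn_add_one (i : ℤ) : sgn (i + 1) = - sgn i := by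
  rw [sgn, sgn, zpow_add_one₀ (by norm_num)]; ring

theorem sgn_add_two_mul (i j : ℤ) : sgn (i + 2 * j) = sgn i := by
  rw [sgn, sgn, zpow_add₀ (by norm_num), zpow_mul]; norm_num

theorem sgn_mul_self (i : ℤ) : sgn i * sgn i = 1 := by
  rw [sgn, ← mul_zpow]; norm_num

theorem sgn_ne_zero (i : ℤ) : sgn i ≠ 0 := fun h => by
  have := sgn_mul_self i; rw [h] at this; norm_num at this

variable {X} {D : Submodule ℝ E} {Φ : L → ℤ → Submodule ℝ E} {c : ℤ} {A S : Finset L}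
  {x y z : L} {i j : ℤ} {u v w : E}

theorem mem_fix : v ∈ X.fix D y ↔ v ∈ D ∧ X.P y v = v := by
  simp [fix, sub_eq_zero]

theorem mem_Strat : v ∈ X.Strat D A y ↔
    (v ∈ D ∧ X.P y v = v) ∧ ∀ a ∈ A, ¬ a ≤ y → X.P (y ⊔ a) v = 0 := by
  simp [Strat, mem_fix, Submodule.mem_iInf]

theorem mem_U : v ∈ X.U D Φ A y i ↔
    v ∈ joinUp (X.fix D) A y ∧ ∀ a ∈ A, ¬ a ≤ y → X.P (y ⊔ a) v ∈ Φ (y ⊔ a) (i + 1) := by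
  simp [U, Submodule.mem_iInf]

theorem mem_Gr : v ∈ X.Gr D Φ A y i ↔
    v ∈ X.Strat D A y ∧ ∃ u ∈ joinUp (X.fix D) A y, v + u ∈ Φ y i := by
  rw [Gr, Submodule.mem_inf, and_congr_right_iff]
  intro _
  rw [Submodule.mem_sup]
  constructor
  · rintro ⟨f, hf, u, hu, rfl⟩
    exact ⟨-u, neg_mem hu, by simpa using hf⟩
  · rintro ⟨u, hu, h⟩
    exact ⟨_, h, -u, neg_mem hu, by simp⟩

theorem fix_le_of_le (h : y ≤ z) : X.fix D z ≤ X.fix D y := fun v hv => by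
  rw [mem_fix] at hv ⊢
  exact ⟨hv.1, X.P_fix_mono h hv.2⟩

theorem Strat_le_fix : X.Strat D A y ≤ X.fix D y := inf_le_left

theorem joinUp_fix_le_fix : joinUp (X.fix D) S y ≤ X.fix D y :=
  joinUp_le fun _ _ _ => fix_le_of_le le_sup_left

theorem Strat_perp_joinUp (hv : v ∈ X.Strat D A y) (hu : u ∈ joinUp (X.fix D) A y) :
    X.B v u = 0 := by
  refine joinUp_induction hu ?_ ?_ ?_
  · intro a ha hay u hu
    rw [← (mem_fix.1 hu).2, ← X.adj, (mem_Strat.1 hv).2 a ha hay]; simp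
  · simp
  · intro u _ w _ hu hw
    simp [hu, hw]

variable (X) in
/-- The axioms on the filtered subspaces `Φ y` of `D` over the elements strictly above `x`. -/
structure Obj (D : Submodule ℝ E) (Φ : L → ℤ → Submodule ℝ E) (c : ℤ) (A : Finset L) (x : L) :
    Prop where
  good : ∀ a ∈ A, ∀ y, ¬ a ≤ y → X.rk (y ⊔ a) = X.rk y + 1
  stable : ∀ {y}, GenS A x y → ∀ {v}, v ∈ D → X.P y v ∈ D
  le_fix : ∀ {y}, GenS A x y → ∀ i, Φ y i ≤ X.fix D y
  mono : ∀ {y}, GenS A x y → ∀ {i j}, i ≤ j → Φ y i ≤ Φ y j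
  bot : ∀ {y}, GenS A x y → ∀ {i}, i < X.rk y → ∀ {v}, v ∈ Φ y i → v = 0
  compat : ∀ {y z}, GenS A x y → GenS A x z → y ≤ z → ∀ i, Φ z i ≤ Φ y i
  fix_mem : ∀ {y z}, GenS A x y → GenS A x z → y ≤ z → ∀ {i v}, v ∈ Φ y i → X.P z v = v →
    v ∈ Φ z i
  dual_zero : ∀ {y}, GenS A x y → ∀ {i j}, i + j ≤ c - 1 + X.rk y → ∀ {u v}, u ∈ Φ y i →
    v ∈ Φ y j → X.B u v = 0
  dual_mem : ∀ {y}, GenS A x y → ∀ {i j}, i + j = c - 1 + X.rk y → ∀ {v}, v ∈ X.fix D y →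
    (∀ u ∈ Φ y i, X.B v u = 0) → v ∈ Φ y j
  cell : ∀ {y}, GenS A x y → ∀ {S}, S ⊆ A → ∀ {i v}, v ∈ Φ y i → v ∈ joinUp (X.fix D) S y →
    v ∈ K Φ S y i
  van : ∀ {y}, GenS A x y → ∀ {i}, 2 * i < c + X.rk y → ∀ {v}, v ∈ Φ y i →
    v ∈ X.Strat D A y → v = 0
  pos : ∀ {y}, GenS A x y → ∀ {i}, 2 * i = c + X.rk y → ∀ {v}, v ∈ Φ y i →
    v ∈ X.Strat D A y → v ≠ 0 → 0 < sgn (c + i) * X.B v v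

variable (X) in
/-- The Hodge–Riemann relations over the elements strictly above `x`. -/
def HR (D : Submodule ℝ E) (Φ : L → ℤ → Submodule ℝ E) (c : ℤ) (A : Finset L) (x : L) : Prop :=
  ∀ i u, 2 * i ≤ c - 1 + X.rk x → u ∈ X.U D Φ A x i → (∀ w ∈ X.U D Φ A x (i - 1), X.B u w = 0) →
    0 ≤ sgn (c - 1 + i) * X.B u u ∧ (X.B u u = 0 → u ∈ K Φ A x i)

namespace Obj

variable (H : X.Obj D Φ c A x)
include H

theorem restrict (hy : Gen A x y) : X.Obj D Φ c A y where
  good := H.good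
  stable hz := H.stable (.of_gen hy hz)
  le_fix hz := H.le_fix (.of_gen hy hz)
  mono hz := H.mono (.of_gen hy hz)
  bot hz := H.bot (.of_gen hy hz)
  compat hz hw := H.compat (.of_gen hy hz) (.of_gen hy hw)
  fix_mem hz hw := H.fix_mem (.of_gen hy hz) (.of_gen hy hw)
  dual_zero hz := H.dual_zero (.of_gen hy hz)
  dual_mem hz := H.dual_mem (.of_gen hy hz)
  cell hz := H.cell (.of_gen hy hz)
  van hz := H.van (.of_gen hy hz)
  pos hz := H.pos (.of_gen hy hz)

theorem sup_eq_sup {a b : L} (ha : a ∈ A) (hb : b ∈ A) (hay : ¬ a ≤ y) (hby : ¬ b ≤ y)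
    (hab : b ≤ y ⊔ a) : y ⊔ b = y ⊔ a := by
  by_contra hne
  have h1 : y ⊔ b < y ⊔ a := lt_of_le_of_ne (sup_le le_sup_left hab) hne
  have := X.rk_strictMono h1
  rw [H.good a ha y hay, H.good b hb y hby] at this
  omega

theorem rk_le (a : L) (ha : a ∈ A) (y : L) : X.rk (y ⊔ a) ≤ X.rk y + 1 := by
  by_cases h : a ≤ y
  · rw [sup_eq_left.2 h]; omega
  · exact (H.good a ha y h).le

theorem proj (hy : GenS A x y) (hz : GenS A x z) (hyz : y ≤ z) (hv : v ∈ Φ y i)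
    (hj : i + X.rk z - X.rk y ≤ j) : X.P z v ∈ Φ z j := by
  refine H.mono hz hj (H.dual_mem hz (i := c - 1 + X.rk y - i) (by omega) ?_ ?_)
  · exact mem_fix.2 ⟨H.stable hz (mem_fix.1 (H.le_fix hy _ hv)).1, X.P_idem _ _⟩
  · intro u hu
    rw [X.adj, (mem_fix.1 (H.le_fix hz _ hu)).2]
    exact H.dual_zero hy (by omega) hv (H.compat hy hz hyz _ hu)

theorem proj_sup (hy : GenS A x y) {a : L} (ha : a ∈ A) (hv : v ∈ Φ y i) :
    X.P (y ⊔ a) v ∈ Φ (y ⊔ a) (i + 1) :=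
  H.proj hy (hy.step ha) le_sup_left hv (by have := H.rk_le a ha y; omega)

theorem ndeg_fix (hy : GenS A x y) : X.NDeg (X.fix D y) := fun v hv h =>
  H.bot hy (i := X.rk y - 1) (by omega) (H.dual_mem hy (i := c) (by omega) hv
    fun u hu => h u (H.le_fix hy _ hu))

omit H in
theorem joinUp_le_D : joinUp (X.fix D) S y ≤ D := joinUp_fix_le_fix.trans inf_le_left

theorem P_mem_fix (hz : GenS A x z) (hv : v ∈ D) : X.P z v ∈ X.fix D z :=
  mem_fix.2 ⟨H.stable hz hv, X.P_idem _ _⟩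

theorem joinUp_fix_stable (hz : GenS A x z) (hv : v ∈ joinUp (X.fix D) S y) :
    X.P z v ∈ joinUp (X.fix D) S y := by
  refine joinUp_induction hv ?_ ?_ ?_
  · intro a ha hay v hv
    refine mem_joinUp ha hay (mem_fix.2 ⟨H.stable hz (mem_fix.1 hv).1, ?_⟩)
    rw [X.P_comm, (mem_fix.1 hv).2]
  · simp
  · intro v _ w _ hv hw
    rw [map_add]; exact add_mem hv hw

theorem joinUp_fix_zero (hy : Gen A x y) (hS : S ⊆ A) (hv : v ∈ joinUp (X.fix D) S y)
    (h : ∀ a ∈ S, ¬ a ≤ y → X.P (y ⊔ a) v = 0) : v = 0 := by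
  classical
  induction S using Finset.induction_on generalizing v with
  | empty => simpa [joinUp_empty] using hv
  | insert b S _ ih =>
    refine ih ((Finset.subset_insert b S).trans hS) ?_
      fun a ha => h a (Finset.mem_insert_of_mem ha)
    by_cases hby : b ≤ y
    · rwa [joinUp_insert_of_le hby] at hv
    · obtain ⟨f, hf, w, hw, rfl⟩ := exists_of_mem_joinUp_insert hv hby
      have := h b (Finset.mem_insert_self b S) hby
      rw [map_add, (mem_fix.1 hf).2] at this
      rw [eq_neg_of_add_eq_zero_left this]
      exact add_mem (neg_mem (H.joinUp_fix_stable
        (.step_of_gen hy (hS (Finset.mem_insert_self b S)) hby) hw)) hw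

theorem P_eq_zero_of_perp (hz : GenS A x z) (hv : v ∈ D) (h : ∀ u ∈ X.fix D z, X.B v u = 0) :
    X.P z v = 0 :=
  H.ndeg_fix hz _ (H.P_mem_fix hz hv) fun w hw => by
    rw [X.adj, (mem_fix.1 hw).2, h w hw]

theorem ndeg_joinUp (hy : Gen A x y) (hS : S ⊆ A) : X.NDeg (joinUp (X.fix D) S y) := fun _ hv h =>
  H.joinUp_fix_zero hy hS hv fun _ ha hay =>
    H.P_eq_zero_of_perp (.step_of_gen hy (hS ha) hay) (joinUp_le_D hv)
      fun u hu => h u (mem_joinUp ha hay hu)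

theorem mem_Strat_of_perp (hy : Gen A x y) (hv : v ∈ X.fix D y)
    (h : ∀ u ∈ joinUp (X.fix D) A y, X.B v u = 0) : v ∈ X.Strat D A y :=
  mem_Strat.2 ⟨mem_fix.1 hv, fun _ ha hay =>
    H.P_eq_zero_of_perp (.step_of_gen hy ha hay) (mem_fix.1 hv).1
      fun u hu => h u (mem_joinUp ha hay hu)⟩

theorem P_joinUp_fix (hy : Gen A x y) {b : L} (hb : b ∈ A) (hby : ¬ b ≤ y)
    (hS : S ⊆ A) (hne : ∀ a ∈ S, ¬ a ≤ y → y ⊔ a ≠ y ⊔ b) (hv : v ∈ joinUp (X.fix D) S y) :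
    X.P (y ⊔ b) v ∈ joinUp (X.fix D) S (y ⊔ b) := by
  refine joinUp_induction hv ?_ ?_ ?_
  · intro a ha hay v hv
    have hab : ¬ a ≤ y ⊔ b := fun h => hne a ha hay (H.sup_eq_sup hb (hS ha) hby hay h)
    refine mem_joinUp ha hab (mem_fix.2 ⟨H.stable (.step_of_gen hy hb hby) (mem_fix.1 hv).1, ?_⟩)
    have e : X.P (y ⊔ b) v = X.P (y ⊔ b ⊔ a) v := by
      conv_lhs => rw [← (mem_fix.1 hv).2, ← X.P_sup, ← sup_sup_distrib_left, ← sup_assoc]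
    rw [e, X.P_idem]
  · simp
  · intro v _ w _ hv hw
    rw [map_add]; exact add_mem hv hw

theorem K_le_joinUp (hy : Gen A x y) (hS : S ⊆ A) : K Φ S y i ≤ joinUp (X.fix D) S y :=
  joinUp_mono fun _ ha hay => H.le_fix (.step_of_gen hy (hS ha) hay) i

theorem K_le_Phi (hy : GenS A x y) (hS : S ⊆ A) : K Φ S y i ≤ Φ y i :=
  joinUp_le fun _ ha _ => H.compat hy (hy.step (hS ha)) le_sup_left i

theorem K_mono (hy : Gen A x y) (hS : S ⊆ A) (hij : i ≤ j) : K Φ S y i ≤ K Φ S y j :=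
  joinUp_mono fun _ ha hay => H.mono (.step_of_gen hy (hS ha) hay) hij

theorem mem_K_of_joinUp (hy : Gen A x y) (hS : S ⊆ A) {b : L} (hb : b ∈ A) (hby : ¬ b ≤ y)
    (hv : v ∈ Φ (y ⊔ b) i) (hv' : v ∈ joinUp (X.fix D) S y) : v ∈ K Φ S y i := by
  have hyb := GenS.step_of_gen hy hb hby
  by_cases hab : ∃ a ∈ S, ¬ a ≤ y ∧ y ⊔ a = y ⊔ b
  · obtain ⟨a, ha, hay, h⟩ := hab
    exact mem_joinUp ha hay (by rwa [h])
  · push Not at hab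
    have h1 := H.P_joinUp_fix hy hb hby hS hab hv'
    rw [(mem_fix.1 (H.le_fix hyb _ hv)).2] at h1
    have h2 := H.cell hyb hS hv h1
    refine joinUp_le (N := K Φ S y i) (fun a ha hay => ?_) h2
    have hay' : ¬ a ≤ y := fun h => hay (h.trans le_sup_left)
    exact (H.compat (.step_of_gen hy (hS ha) hay') (hyb.step (hS ha))
      (sup_le_sup_right le_sup_left a) i).trans
      (le_joinUp (Q := fun z => Φ z i) ha hay')

theorem cell_open (hy : Gen A x y) {S' : Finset L} (hS' : S' ⊆ A) (hS : S ⊆ S')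
    (hv : v ∈ K Φ S' y i) (hv' : v ∈ joinUp (X.fix D) S y) : v ∈ K Φ S y i := by
  classical
  obtain ⟨R, rfl⟩ : ∃ R, S' = R ∪ S := ⟨S', (Finset.union_eq_left.2 hS).symm⟩
  clear hS
  induction R using Finset.induction_on with
  | empty => simpa using hv
  | insert b R _ ih =>
    rw [Finset.insert_union] at hv hS'
    have hRS := (Finset.subset_insert b (R ∪ S)).trans hS'
    refine ih hRS ?_
    by_cases hby : b ≤ y
    · rwa [K, joinUp_insert_of_le hby] at hv
    · obtain ⟨f, hf, w, hw, rfl⟩ := exists_of_mem_joinUp_insert hv hby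
      refine add_mem ?_ hw
      refine H.mem_K_of_joinUp hy hRS (hS' (Finset.mem_insert_self _ _)) hby hf ?_
      have := sub_mem (joinUp_subset Finset.subset_union_right hv')
        (H.K_le_joinUp hy hRS hw)
      simpa using this

theorem K_inf_fix (hy : Gen A x y) (hz : GenS A y z) (hv : v ∈ K Φ A y i) (h : X.P z v = v) :
    v ∈ Φ z i := by
  obtain ⟨a, ha, hay, haz⟩ := hz.1.exists_step hz.2
  have hya := GenS.step_of_gen hy ha hay
  have hle : y ⊔ a ≤ z := sup_le hz.lt.le haz
  have h1 : v ∈ joinUp (X.fix D) {a} y :=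
    mem_joinUp (Finset.mem_singleton_self a) hay
      (mem_fix.2 ⟨joinUp_le_D (H.K_le_joinUp hy subset_rfl hv), X.P_fix_mono hle h⟩)
  have h2 := H.cell_open hy subset_rfl (Finset.singleton_subset_iff.2 ha) hv h1
  refine H.fix_mem hya (.of_gen hy hz) hle ?_ h
  refine joinUp_le (fun b hb _ => ?_) h2
  rw [Finset.mem_singleton.1 hb]

theorem K_le_U (hy : Gen A x y) : K Φ A y i ≤ X.U D Φ A y i := fun v hv => by
  refine mem_U.2 ⟨H.K_le_joinUp hy subset_rfl hv, fun b hb hby => ?_⟩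
  have hyb := GenS.step_of_gen hy hb hby
  refine joinUp_induction hv ?_ ?_ ?_
  · intro a ha hay v hv
    have hya := GenS.step_of_gen hy ha hay
    have h1 := H.proj_sup hya hb hv
    refine H.compat hyb (hya.step hb) (sup_le_sup_right le_sup_left b) _ ?_
    convert h1 using 1
    have := (mem_fix.1 (H.le_fix hya _ hv)).2
    conv_lhs => rw [← this]
    rw [← X.P_sup, ← sup_sup_distrib_left, sup_comm b a, sup_assoc]
  · simp
  · intro v _ w _ hv hw
    rw [map_add]; exact add_mem hv hw

theorem K_perp_U (hy : Gen A x y) (hij : i + j ≤ c - 1 + X.rk y) (hv : v ∈ K Φ A y i)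
    (hu : u ∈ X.U D Φ A y j) : X.B u v = 0 := by
  refine joinUp_induction hv ?_ ?_ ?_
  · intro a ha hay v hv
    have hya := GenS.step_of_gen hy ha hay
    rw [← (mem_fix.1 (H.le_fix hya _ hv)).2, ← X.adj]
    exact H.dual_zero hya (by rw [H.good a ha y hay]; omega) ((mem_U.1 hu).2 a ha hay) hv
  · simp
  · intro v _ w _ hv hw
    rw [map_add, hv, hw, add_zero]

theorem mem_U_of_perp (hy : Gen A x y) (hij : i + j = c - 1 + X.rk y)
    (hv : v ∈ joinUp (X.fix D) A y) (h : ∀ u ∈ K Φ A y i, X.B v u = 0) : v ∈ X.U D Φ A y j := by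
  refine mem_U.2 ⟨hv, fun a ha hay => ?_⟩
  have hya := GenS.step_of_gen hy ha hay
  refine H.dual_mem hya (i := i) (by rw [H.good a ha y hay]; omega)
    (H.P_mem_fix hya (joinUp_le_D hv)) fun u hu => ?_
  rw [X.adj, (mem_fix.1 (H.le_fix hya _ hu)).2]
  exact h u (mem_joinUp (Q := fun z => Φ z i) ha hay hu)

variable [FiniteDimensional ℝ E]

theorem mem_K_of_perp (hy : Gen A x y) (hij : i + j = c - 1 + X.rk y)
    (hv : v ∈ joinUp (X.fix D) A y) (h : ∀ u ∈ X.U D Φ A y i, X.B v u = 0) : v ∈ K Φ A y j :=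
  (H.ndeg_joinUp hy subset_rfl).mem_of_perp hv
    (fun t ht hs => h t (H.mem_U_of_perp hy (by omega) ht hs)) (H.K_le_joinUp hy subset_rfl)

theorem decomp (hy : Gen A x y) (hv : v ∈ X.fix D y) :
    ∃ v₀ ∈ X.Strat D A y, ∃ v₁ ∈ joinUp (X.fix D) A y, v = v₀ + v₁ := by
  obtain ⟨g, hg, h⟩ := (H.ndeg_joinUp hy subset_rfl).exists_proj v
  exact ⟨v - g, H.mem_Strat_of_perp hy (sub_mem hv (joinUp_fix_le_fix hg)) h, g, hg, by simp⟩

theorem ndeg_Strat (hy : GenS A x y) : X.NDeg (X.Strat D A y) := fun v hv h =>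
  H.ndeg_fix hy v (Strat_le_fix hv) fun w hw => by
    obtain ⟨w₀, hw₀, w₁, hw₁, rfl⟩ := H.decomp hy.gen hw
    rw [map_add, h _ hw₀, Strat_perp_joinUp hv hw₁, add_zero]

omit [FiniteDimensional ℝ E] in
theorem mem_U_of_add (hy : GenS A x y) {v₀ v₁ : E} (hv : v₀ + v₁ ∈ Φ y i)
    (hv₀ : v₀ ∈ X.Strat D A y) (hv₁ : v₁ ∈ joinUp (X.fix D) A y) : v₁ ∈ X.U D Φ A y i :=
  mem_U.2 ⟨hv₁, fun a ha hay => by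
    have := H.proj_sup hy ha hv
    rwa [map_add, (mem_Strat.1 hv₀).2 a ha hay, zero_add] at this⟩

theorem decomp_Phi (hy : GenS A x y) (hv : v ∈ Φ y i) :
    ∃ v₀ ∈ X.Gr D Φ A y i, ∃ v₁ ∈ X.U D Φ A y i, v = v₀ + v₁ := by
  obtain ⟨v₀, hv₀, v₁, hv₁, rfl⟩ := H.decomp hy.gen (H.le_fix hy _ hv)
  exact ⟨v₀, mem_Gr.2 ⟨hv₀, v₁, hv₁, hv⟩, v₁, H.mem_U_of_add hy hv hv₀ hv₁, rfl⟩

theorem proj_surj (hy : GenS A x y) (hz : GenS A x z) (hyz : y ≤ z) (hv : v ∈ Φ z j)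
    (hj : j = i + X.rk z - X.rk y) : ∃ u ∈ Φ y i, X.P z u = v := by
  have : v ∈ (Φ y i).map (X.P z) := by
    refine (H.ndeg_fix hz).mem_of_perp (H.le_fix hz _ hv) (fun t ht hs => ?_) ?_
    · have ht' : t ∈ Φ y (c - 1 + X.rk y - i) := by
        refine H.dual_mem hy (i := i) (by omega) (fix_le_of_le hyz ht) fun u hu => ?_
        rw [← (mem_fix.1 ht).2, X.adj]
        exact hs _ (Submodule.mem_map_of_mem hu)
      exact H.dual_zero hz (by omega) hv (H.fix_mem hy hz hyz ht' (mem_fix.1 ht).2)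
    · rintro _ ⟨u, hu, rfl⟩
      exact H.P_mem_fix hz (mem_fix.1 (H.le_fix hy _ hu)).1
  simpa using this

theorem lift (hy : GenS A x y) (hu : u ∈ X.U D Φ A y i) :
    ∃ w ∈ X.Strat D A y, w + u ∈ Φ y i := by
  have : u ∈ Φ y i ⊔ X.Strat D A y := by
    refine (H.ndeg_fix hy).mem_of_perp (joinUp_fix_le_fix (mem_U.1 hu).1) (fun t ht hs => ?_)
      (sup_le (H.le_fix hy _) Strat_le_fix)
    have ht' : t ∈ Φ y (c - 1 + X.rk y - i) :=
      H.dual_mem hy (i := i) (by omega) ht fun w hw => hs w (Submodule.mem_sup_left hw)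
    obtain ⟨t₀, ht₀, t₁, ht₁, rfl⟩ := H.decomp hy.gen ht
    have h0 : t₀ = 0 := H.ndeg_Strat hy t₀ ht₀ fun w hw => by
      have := hs w (Submodule.mem_sup_right hw)
      rwa [map_add, LinearMap.add_apply, X.symm t₁, Strat_perp_joinUp hw ht₁, add_zero] at this
    subst h0
    rw [zero_add] at ht' ⊢
    exact H.K_perp_U hy.gen (by omega) (H.cell hy subset_rfl ht' ht₁) hu
  obtain ⟨f, hf, s, hs, rfl⟩ := Submodule.mem_sup.1 this
  exact ⟨-s, neg_mem hs, by simpa using hf⟩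

/-- A section whose restrictions have lower degree than expected has lower degree up to the
stratum. -/
theorem lower (hy : GenS A x y) (hv : v ∈ Φ y i)
    (h : ∀ a ∈ A, ¬ a ≤ y → X.P (y ⊔ a) v ∈ Φ (y ⊔ a) i) :
    ∃ g ∈ Φ y (i - 1), ∃ j ∈ Φ y i, j ∈ X.Strat D A y ∧ v = g + j := by
  obtain ⟨v₀, hv₀, v₁, hv₁, rfl⟩ := H.decomp hy.gen (H.le_fix hy _ hv)
  have h1 : v₁ ∈ X.U D Φ A y (i - 1) := mem_U.2 ⟨hv₁, fun a ha hay => by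
    have := h a ha hay
    rw [map_add, (mem_Strat.1 hv₀).2 a ha hay, zero_add] at this
    simpa using this⟩
  obtain ⟨w, hw, hw'⟩ := H.lift hy h1
  refine ⟨_, hw', v₀ - w, ?_, sub_mem hv₀ hw, by abel⟩
  have := sub_mem hv (H.mono hy (by omega : i - 1 ≤ i) hw')
  simpa using this

theorem strat_span (hy : GenS A x y) {m k : ℤ} (hmk : m + k = c - 1 + X.rk y) (h1 : m ≤ k)
    (h2 : k ≤ m + 1) (hv : v ∈ X.Strat D A y) :
    ∃ g ∈ X.Gr D Φ A y m, ∃ j ∈ Φ y k, j ∈ X.Strat D A y ∧ v = g + j := by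
  have : v ∈ X.Gr D Φ A y m ⊔ (Φ y k ⊓ X.Strat D A y) := by
    refine (H.ndeg_Strat hy).mem_of_perp hv (fun t ht hs => ?_)
      (sup_le inf_le_left inf_le_right)
    have ht' : t ∈ Φ y k := by
      refine H.dual_mem hy hmk (Strat_le_fix ht) fun f hf => ?_
      obtain ⟨f₀, hf₀, f₁, hf₁, rfl⟩ := H.decomp_Phi hy hf
      rw [map_add, Strat_perp_joinUp ht (mem_U.1 hf₁).1, add_zero]
      exact hs _ (Submodule.mem_sup_left hf₀)
    have h0 : t = 0 := by
      have htt := hs t (Submodule.mem_sup_right ⟨ht', ht⟩)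
      rcases lt_or_eq_of_le (by omega : 2 * k ≤ c + X.rk y) with h | h
      · exact H.van hy h ht' ht
      · by_contra h0
        have := H.pos hy h ht' ht h0
        rw [htt, mul_zero] at this
        exact this.false
    rw [h0, map_zero]
  obtain ⟨g, hg, j, hj, rfl⟩ := Submodule.mem_sup.1 this
  exact ⟨g, hg, j, hj.1, hj.2, rfl⟩

omit [FiniteDimensional ℝ E] in
theorem Gr_mono (hy : GenS A x y) (hij : i ≤ j) : X.Gr D Φ A y i ≤ X.Gr D Φ A y j :=
  inf_le_inf_left _ (sup_le_sup_right (H.mono hy hij) _)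

theorem HRV (hy : GenS A x y) (hR : X.HR D Φ c A y) (hi : 2 * i ≤ c + X.rk y)
    (hv : v ∈ X.Gr D Φ A y i) (hp : ∀ f ∈ Φ y (i - 1), X.B v f = 0) :
    0 ≤ sgn (c + i) * X.B v v ∧ (X.B v v = 0 → v = 0) := by
  obtain ⟨hvs, u, hu, hg⟩ := mem_Gr.1 hv
  rcases eq_or_lt_of_le hi with h | h
  · have hv' : v ∈ Φ y i := H.dual_mem hy (i := i - 1) (by omega) (Strat_le_fix hvs) hp
    by_cases h0 : v = 0
    · simp [h0]
    · have := H.pos hy h hv' hvs h0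
      refine ⟨this.le, fun hz => ?_⟩
      rw [hz, mul_zero] at this
      exact absurd this (lt_irrefl _)
  · have huU := H.mem_U_of_add hy hg hvs hu
    have huv : X.B u v = 0 := by rw [X.symm]; exact Strat_perp_joinUp hvs hu
    have hvu : X.B v u = 0 := Strat_perp_joinUp hvs hu
    have hB : X.B v v = - X.B u u := by
      have := H.dual_zero hy (by omega) hg hg
      simp only [map_add, LinearMap.add_apply, huv, hvu] at this
      linarith
    have hprim : ∀ w ∈ X.U D Φ A y (i - 1), X.B u w = 0 := by
      intro w hw
      obtain ⟨s, hs, hsw⟩ := H.lift hy hw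
      have h1 := H.dual_zero hy (by omega) hg hsw
      have h2 := hp _ hsw
      have h3 := Strat_perp_joinUp hvs (mem_U.1 hw).1
      have h4 : X.B u s = 0 := by rw [X.symm]; exact Strat_perp_joinUp hs hu
      simp only [map_add, LinearMap.add_apply] at h1 h2
      linarith
    obtain ⟨hR1, hR2⟩ := hR i u (by omega) huU hprim
    refine ⟨?_, fun hz => ?_⟩
    · have : sgn (c + i) = - sgn (c - 1 + i) := by rw [← sgn_add_one]; congr 1; ring
      rw [this, hB]
      linarith
    · have huK := H.K_le_Phi hy subset_rfl (hR2 (by linarith))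
      refine H.van hy h ?_ hvs
      simpa using sub_mem hg huK

theorem perp_Phi_of_Gr (hy : GenS A x y) (hv : v ∈ X.Strat D A y)
    (h : ∀ w ∈ X.Gr D Φ A y i, X.B v w = 0) : ∀ f ∈ Φ y i, X.B v f = 0 := by
  intro f hf
  obtain ⟨f₀, hf₀, f₁, hf₁, rfl⟩ := H.decomp_Phi hy hf
  rw [map_add, h _ hf₀, Strat_perp_joinUp hv (mem_U.1 hf₁).1, add_zero]

theorem ndeg_Gr (hy : GenS A x y) (hR : X.HR D Φ c A y) (hi : 2 * i ≤ c + X.rk y) :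
    X.NDeg (X.Gr D Φ A y i) := fun _ hv h =>
  (H.HRV hy hR hi hv (H.perp_Phi_of_Gr hy (mem_Gr.1 hv).1 fun w hw =>
    h w (H.Gr_mono hy (by omega) hw))).2 (h _ hv)

end Obj

end KLSpace

namespace KLSpace

theorem upset_induction {L : Type*} [PartialOrder L] [Fintype L] [DecidableEq L]
    {p : Finset L → Prop} (T : Finset L) (hT : IsUpperSet (T : Set L)) (h0 : p T)
    (step : ∀ (T : Finset L) (y : L), IsUpperSet (T : Set L) → y ∉ T → (∀ w, y < w → w ∈ T) →
      p T → p (insert y T)) : p Finset.univ := by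
  generalize hn : Tᶜ.card = n
  induction n generalizing T with
  | zero =>
    rw [Finset.card_eq_zero, Finset.compl_eq_empty_iff] at hn
    rwa [← hn]
  | succ n ih =>
    have hne : (Tᶜ : Finset L).Nonempty := Finset.card_pos.1 (by omega)
    obtain ⟨y, hy⟩ := Tᶜ.exists_maximal hne
    have hyT : y ∉ T := Finset.mem_compl.1 hy.1
    have habove : ∀ w, y < w → w ∈ T := fun w hw => by
      by_contra hwT
      exact hw.not_ge (hy.2 (Finset.mem_compl.2 hwT) hw.le)
    refine ih (insert y T) ?_ (step T y hT hyT habove h0) ?_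
    · intro a b hab ha
      simp only [Finset.coe_insert, Set.mem_insert_iff, Finset.mem_coe] at ha ⊢
      rcases ha with rfl | ha
      · rcases eq_or_lt_of_le hab with h | h
        · exact Or.inl h.symm
        · exact Or.inr (habove b h)
      · exact Or.inr (hT hab ha)
    · rw [Finset.compl_insert, Finset.card_erase_of_mem (Finset.mem_compl.2 hyT), hn]
      rfl

variable {L E : Type*} [SemilatticeSup L] [AddCommGroup E] [Module ℝ E]

theorem joinUp_split {Q : L → Submodule ℝ E} {R : Bool → L → Submodule ℝ E} {S : Finset L} {y : L}
    (h : ∀ a ∈ S, ¬ a ≤ y → ∀ v ∈ Q (y ⊔ a),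
      ∃ f : Bool → E, (∀ k, f k ∈ R k (y ⊔ a)) ∧ v = f true + f false)
    {v : E} (hv : v ∈ joinUp Q S y) :
    ∃ f : Bool → E, (∀ k, f k ∈ joinUp (R k) S y) ∧ v = f true + f false := by
  refine joinUp_induction hv ?_ ?_ ?_
  · intro a ha hay v hv
    obtain ⟨f, hf, rfl⟩ := h a ha hay v hv
    exact ⟨f, fun k => mem_joinUp ha hay (hf k), rfl⟩
  · exact ⟨0, fun k => zero_mem _, by simp⟩
  · rintro v - w - ⟨f, hf, rfl⟩ ⟨g, hg, rfl⟩
    exact ⟨f + g, fun k => add_mem (hf k) (hg k), by simp only [Pi.add_apply]; abel⟩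

variable (X : KLSpace L E)

/-- An orthogonal pair of stable subspaces splitting the filtrations over `T`. -/
structure IsSplit (D : Submodule ℝ E) (Φ : L → ℤ → Submodule ℝ E) (A : Finset L) (x : L)
    (T : Finset L) (F : Bool → Submodule ℝ E) : Prop where
  le : ∀ k, F k ≤ D
  stable : ∀ k {z}, GenS A x z → ∀ {v}, v ∈ F k → X.P z v ∈ F k
  perp : ∀ k {u v}, u ∈ F k → v ∈ F (!k) → X.B u v = 0
  split : ∀ {y}, GenS A x y → y ∈ T → ∀ {i v}, v ∈ Φ y i →
    ∃ f : Bool → E, (∀ k, f k ∈ Φ y i ∧ f k ∈ F k) ∧ v = f true + f false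

variable {X} {D : Submodule ℝ E} {Φ : L → ℤ → Submodule ℝ E} {c : ℤ} {A S : Finset L}
  {x y z : L} {i j : ℤ} {u v w : E} {T : Finset L} {F : Bool → Submodule ℝ E}

theorem fix_mono_left {D D' : Submodule ℝ E} (h : D ≤ D') : X.fix D y ≤ X.fix D' y :=
  inf_le_inf_right _ h

theorem Strat_mono_left {D D' : Submodule ℝ E} (h : D ≤ D') : X.Strat D A y ≤ X.Strat D' A y :=
  inf_le_inf_right _ (fix_mono_left h)

theorem U_mono_left {D D' : Submodule ℝ E} (h : D ≤ D') :
    X.U D (fun y i => Φ y i ⊓ D) A y i ≤ X.U D' Φ A y i := fun u hu => by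
  rw [mem_U] at hu ⊢
  exact ⟨joinUp_mono (fun a _ _ => fix_mono_left h) hu.1, fun a ha hay => (hu.2 a ha hay).1⟩

theorem Obj.exhaust (H : X.Obj D Φ c A x) (hy : GenS A x y) (hi : c ≤ i) (hv : v ∈ X.fix D y) :
    v ∈ Φ y i :=
  H.dual_mem hy (i := c - 1 + X.rk y - i) (by omega) hv fun u hu => by
    rw [H.bot hy (by omega) hu, map_zero]

theorem P_Strat (hy : Gen A x y) (hz : Gen A x z) (hzy : ¬ z ≤ y)
    (hv : v ∈ X.Strat D A y) : X.P z v = 0 := by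
  have h1 : y ≠ y ⊔ z := fun h => hzy (le_sup_right.trans h.symm.le)
  obtain ⟨a, ha, hay, hle⟩ := ((hy.sup hz).of_le hy le_sup_left).exists_step h1
  rw [mem_Strat] at hv
  rw [← X.P_sup_of_fix hv.1.2, ← X.P_of_ge (sup_le le_sup_left hle), hv.2 a ha hay, map_zero]

namespace IsSplit

variable (I : X.IsSplit D Φ A x T F) (H : X.Obj D Φ c A x)
include I H

theorem fix_split (hy : GenS A x y) (hyT : y ∈ T) (hv : v ∈ X.fix D y) :
    ∃ f : Bool → E, (∀ k, f k ∈ X.fix (F k) y) ∧ v = f true + f false := by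
  obtain ⟨f, hf, h⟩ := I.split hy hyT (H.exhaust hy le_rfl hv)
  exact ⟨f, fun k => mem_fix.2 ⟨(hf k).2, (mem_fix.1 (H.le_fix hy _ (hf k).1)).2⟩, h⟩

theorem disjoint (hy : GenS A x y) (hyT : y ∈ T) (hv : v ∈ X.fix D y) {k : Bool} (h1 : v ∈ F k)
    (h2 : v ∈ F (!k)) : v = 0 :=
  H.ndeg_fix hy v hv fun w hw => by
    obtain ⟨f, hf, rfl⟩ := I.fix_split H hy hyT hw
    have h : ∀ l, X.B v (f l) = 0 := fun l => by
      by_cases hl : l = k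
      · rw [X.symm]; subst hl; exact I.perp l (mem_fix.1 (hf l)).1 h2
      · have : l = !k := by cases l <;> cases k <;> simp_all
        exact I.perp k h1 (this ▸ (mem_fix.1 (hf l)).1)
    rw [map_add, h, h, add_zero]

/-- The components of a split vector lie in any subspace that splits. -/
theorem mem_of_split (hy : GenS A x y) (hyT : y ∈ T) {f g : Bool → E}
    (hf : ∀ k, f k ∈ X.fix D y ∧ f k ∈ F k) (hg : ∀ k, g k ∈ X.fix D y ∧ g k ∈ F k)
    (h : f true + f false = g true + g false) (k : Bool) : f k = g k := by
  have h1 : f k - g k = g (!k) - f (!k) := by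
    rw [sub_eq_sub_iff_add_eq_add]
    cases k
    · simpa [add_comm] using h
    · simpa [add_comm] using h
  rw [← sub_eq_zero]
  refine I.disjoint H hy hyT (sub_mem (hf k).1 (hg k).1) (k := k)
    (sub_mem (hf k).2 (hg k).2) ?_
  rw [h1]
  exact sub_mem (hg _).2 (hf _).2

theorem joinUp_fix_split (hy : Gen A x y) (hT : ∀ w, y < w → w ∈ T) (hSA : S ⊆ A)
    (hv : v ∈ joinUp (X.fix D) S y) :
    ∃ f : Bool → E, (∀ k, f k ∈ joinUp (X.fix (F k)) S y) ∧ v = f true + f false :=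
  joinUp_split (R := fun k => X.fix (F k)) (fun _ ha hay _ hv =>
    have hya := GenS.step_of_gen hy (hSA ha) hay
    I.fix_split H hya (hT _ (left_lt_sup.2 hay)) hv) hv

theorem U_split (hy : Gen A x y) (hT : ∀ w, y < w → w ∈ T) (hu : u ∈ X.U D Φ A y i) :
    ∃ f : Bool → E, (∀ k, f k ∈ X.U (F k) (fun y i => Φ y i ⊓ F k) A y i) ∧
      u = f true + f false := by
  rw [mem_U] at hu
  obtain ⟨f, hf, rfl⟩ := I.joinUp_fix_split H hy hT subset_rfl hu.1
  refine ⟨f, fun k => mem_U.2 ⟨hf k, fun a ha hay => ?_⟩, rfl⟩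
  have hya := GenS.step_of_gen hy ha hay
  obtain ⟨g, hg, h⟩ := I.split hya (hT _ (left_lt_sup.2 hay)) (hu.2 a ha hay)
  have hfF : ∀ k, f k ∈ F k := fun k => Obj.joinUp_le_D (hf k)
  have hD : ∀ k, f k ∈ D := fun k => I.le k (hfF k)
  have := I.mem_of_split H hya (hT _ (left_lt_sup.2 hay)) (f := fun k => X.P (y ⊔ a) (f k))
    (g := g) (fun k => ⟨H.P_mem_fix hya (hD k), I.stable k hya (hfF k)⟩)
    (fun k => ⟨H.le_fix hya _ (hg k).1, (hg k).2⟩) (by rw [← h, map_add]) k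
  exact ⟨this ▸ (hg k).1, this ▸ (hg k).2⟩

end IsSplit

theorem IsSplit.obj [Fintype L] (I : X.IsSplit D Φ A x Finset.univ F) (H : X.Obj D Φ c A x) (k : Bool) :
    X.Obj (F k) (fun y i => Φ y i ⊓ F k) c A x where
  good := H.good
  stable hz := I.stable k hz
  le_fix hy i v hv := mem_fix.2 ⟨hv.2, (mem_fix.1 (H.le_fix hy _ hv.1)).2⟩
  mono hy _ _ hij := inf_le_inf_right _ (H.mono hy hij)
  bot hy _ hi _ hv := H.bot hy hi hv.1
  compat hy hz hyz i := inf_le_inf_right _ (H.compat hy hz hyz i)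
  fix_mem hy hz hyz _ _ hv h := ⟨H.fix_mem hy hz hyz hv.1 h, hv.2⟩
  dual_zero hy _ _ hij _ _ hu hv := H.dual_zero hy hij hu.1 hv.1
  dual_mem := by
    intro y hy i j hij v hv h
    refine ⟨H.dual_mem hy hij (fix_mono_left (I.le k) hv) fun u hu => ?_, (mem_fix.1 hv).1⟩
    obtain ⟨f, hf, rfl⟩ := I.split hy (Finset.mem_univ y) hu
    have h1 := h (f k) (hf k)
    have h2 := I.perp k (mem_fix.1 hv).1 (hf (!k)).2
    rw [map_add]
    cases k
    · simp_all
    · simp_all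
  cell := by
    intro y hy S hS i v hv hv'
    have h1 := H.cell hy hS hv.1 (joinUp_mono (fun a _ _ => fix_mono_left (I.le k)) hv')
    obtain ⟨f, hf, rfl⟩ := joinUp_split (R := fun k y => Φ y i ⊓ F k) (fun a ha hay v hv => by
      obtain ⟨f, hf, h⟩ := I.split (GenS.step_of_gen hy.gen (hS ha) hay) (Finset.mem_univ _) hv
      exact ⟨f, hf, h⟩) h1
    have hfF : ∀ k, f k ∈ F k := fun k => joinUp_le (fun _ _ _ => inf_le_right) (hf k)
    have hfx : ∀ k, f k ∈ X.fix D y := fun k => joinUp_fix_le_fix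
      (H.K_le_joinUp hy.gen hS (joinUp_mono (fun _ _ _ => inf_le_left) (hf k)))
    have h0 : f (!k) = 0 := by
      refine I.disjoint H hy (Finset.mem_univ _) (hfx _) (k := k) ?_ (hfF _)
      have h2 := sub_mem hv.2 (hfF k)
      cases k
      · simpa using h2
      · simpa using h2
    have : f true + f false = f k := by cases k <;> simp_all
    rw [this]
    exact hf k
  van hy _ hi _ hv hs := H.van hy hi hv.1 (Strat_mono_left (I.le k) hs)
  pos hy _ hi _ hv hs := H.pos hy hi hv.1 (Strat_mono_left (I.le k) hs)

theorem IsSplit.HR [Fintype L] (I : X.IsSplit D Φ A x Finset.univ F) (H : X.Obj D Φ c A x)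
    (hR : ∀ k, X.HR (F k) (fun y i => Φ y i ⊓ F k) c A x) : X.HR D Φ c A x := by
  intro i u hi hu hp
  obtain ⟨f, hf, rfl⟩ := I.U_split H .base (fun _ _ => Finset.mem_univ _) hu
  have hfF : ∀ k, f k ∈ F k := fun k => Obj.joinUp_le_D (mem_U.1 (hf k)).1
  have hperp : ∀ w ∈ F true, ∀ w' ∈ F false, X.B w w' = 0 := fun w hw w' hw' => I.perp true hw hw'
  have hperp' : ∀ w ∈ F false, ∀ w' ∈ F true, X.B w w' = 0 :=
    fun w hw w' hw' => I.perp false hw hw'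
  have hk : ∀ k, ∀ w ∈ X.U (F k) (fun y i => Φ y i ⊓ F k) A x (i - 1), X.B (f k) w = 0 := by
    intro k w hw
    have h1 := hp w (U_mono_left (I.le k) hw)
    have hwF : w ∈ F k := Obj.joinUp_le_D (mem_U.1 hw).1
    rw [map_add, LinearMap.add_apply] at h1
    cases k
    · rwa [hperp _ (hfF true) _ hwF, zero_add] at h1
    · rwa [hperp' _ (hfF false) _ hwF, add_zero] at h1
  have h1 := hR true i _ hi (hf true) (hk true)
  have h2 := hR false i _ hi (hf false) (hk false)
  have hB : X.B (f true + f false) (f true + f false)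
      = X.B (f true) (f true) + X.B (f false) (f false) := by
    simp only [map_add, LinearMap.add_apply, hperp _ (hfF true) _ (hfF false),
      hperp' _ (hfF false) _ (hfF true)]
    ring
  rw [hB]
  refine ⟨by linarith [h1.1, h2.1], fun h0 => ?_⟩
  have e1 : sgn (c - 1 + i) * X.B (f true) (f true) = 0 := by
    have : sgn (c - 1 + i) * X.B (f true) (f true) + sgn (c - 1 + i) * X.B (f false) (f false) = 0 :=
      by rw [← mul_add, h0, mul_zero]
    linarith [h1.1, h2.1]
  have e2 : X.B (f true) (f true) = 0 := (mul_eq_zero.1 e1).resolve_left (sgn_ne_zero _)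
  have e3 : X.B (f false) (f false) = 0 := by linarith
  exact add_mem (joinUp_mono (fun _ _ _ => inf_le_left) (h1.2 e2))
    (joinUp_mono (fun _ _ _ => inf_le_left) (h2.2 e3))

/-- The extension of a splitting to the stratum at `y`. -/
def splitStep (X : KLSpace L E) (D : Submodule ℝ E) (Φ : L → ℤ → Submodule ℝ E) (c : ℤ)
    (A : Finset L) (F : Bool → Submodule ℝ E) (m : ℤ) (y : L) (b k : Bool) :
    Submodule ℝ E :=
  F k ⊔ (X.Strat D A y ⊓ (Φ y m ⊔ joinUp (X.fix (F k)) A y)) ⊔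
    (if k = b then Φ y (c - 1 + X.rk y - m) ⊓ X.Strat D A y else ⊥)

theorem exists_of_mem_splitStep {m : ℤ} {b k : Bool} (hv : v ∈ splitStep X D Φ c A F m y b k) :
    ∃ f ∈ F k, ∃ s ∈ X.Strat D A y, ∃ p ∈ X.Strat D A y, v = f + s + p ∧
      (∃ u ∈ joinUp (X.fix (F k)) A y, s + u ∈ Φ y m) ∧
      p ∈ Φ y (c - 1 + X.rk y - m) ∧ (k ≠ b → p = 0) := by
  obtain ⟨q, hq, p, hp, rfl⟩ := Submodule.mem_sup.1 hv
  obtain ⟨f, hf, s, hs, rfl⟩ := Submodule.mem_sup.1 hq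
  obtain ⟨g, hg, t, ht, h⟩ := Submodule.mem_sup.1 hs.2
  have hp' : p ∈ X.Strat D A y ∧ p ∈ Φ y (c - 1 + X.rk y - m) ∧ (k ≠ b → p = 0) := by
    split_ifs at hp with hk
    · exact ⟨hp.2, hp.1, fun h => absurd hk h⟩
    · rw [Submodule.mem_bot] at hp
      subst hp
      exact ⟨zero_mem _, zero_mem _, fun _ => rfl⟩
  refine ⟨f, hf, s, hs.1, p, hp'.1, rfl, ⟨-t, neg_mem ht, ?_⟩, hp'.2⟩
  rw [← h]; simpa using hg

theorem mem_splitStep {m : ℤ} {b k : Bool} (hv : v ∈ X.Strat D A y)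
    (hu : u ∈ joinUp (X.fix (F k)) A y) (h : v + u ∈ Φ y m) :
    v ∈ splitStep X D Φ c A F m y b k :=
  Submodule.mem_sup_left (Submodule.mem_sup_right ⟨hv, by
    have := sub_mem (Submodule.mem_sup_left (T := joinUp (X.fix (F k)) A y) h)
      (Submodule.mem_sup_right hu)
    simpa using this⟩)

theorem le_splitStep {m : ℤ} {b k : Bool} : F k ≤ splitStep X D Φ c A F m y b k :=
  le_sup_left.trans le_sup_left

theorem splitStep_le (I : ∀ k, F k ≤ D) {m : ℤ}
    {b k : Bool} : splitStep X D Φ c A F m y b k ≤ D := fun v hv => by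
  obtain ⟨f, hf, s, hs, p, hp, rfl, -⟩ := exists_of_mem_splitStep hv
  exact add_mem (add_mem (I k hf) (mem_Strat.1 hs).1.1) (mem_Strat.1 hp).1.1

/-- The state of the inductive construction of a splitting. -/
structure SplitState (X : KLSpace L E) (D : Submodule ℝ E) (Φ : L → ℤ → Submodule ℝ E) (c : ℤ)
    (A : Finset L) (x : L) (Cb : L → Bool) (T : Finset L) (F : Bool → Submodule ℝ E) : Prop
    extends X.IsSplit D Φ A x T F where
  orth : ∀ k {u}, u ∈ F k → ∀ {y}, GenS A x y → y ∉ T → ∀ {v}, v ∈ X.Strat D A y → X.B v u = 0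
  mid : ∀ {y}, GenS A x y → y ∈ T → ∀ {k}, k ≠ Cb y → ∀ {i}, 2 * i = c + X.rk y →
    ∀ {v}, v ∈ Φ y i → v ∈ X.Strat D A y → v ∈ F k → v = 0

theorem SplitState.step [FiniteDimensional ℝ E] [DecidableEq L] {Cb : L → Bool}
    (I : SplitState X D Φ c A x Cb T F) (H : X.Obj D Φ c A x) (hy : GenS A x y) (hyT : y ∉ T)
    (hT : ∀ w, y < w → w ∈ T) :
    ∃ F, SplitState X D Φ c A x Cb (insert y T) F := by
  obtain ⟨m, hm⟩ : ∃ m, m = (c - 1 + X.rk y) / 2 := ⟨_, rfl⟩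
  obtain ⟨n, hn⟩ : ∃ n, n = c - 1 + X.rk y := ⟨_, rfl⟩
  set F' := splitStep X D Φ c A F m y (Cb y) with hF'
  have hsplit' : ∀ {f : Bool → E} {v : E}, v = f true + f false → ∀ k, v = f k + f (!k) := by
    intro f v h k
    cases k
    · rw [h, add_comm]; rfl
    · exact h
  have hperp : ∀ k {u v}, u ∈ F' k → v ∈ F' (!k) → X.B u v = 0 := by
    intro k u v hu hv
    obtain ⟨f, hf, s, hs, p, hp, rfl, ⟨t, ht, hst⟩, hpΦ, hp0⟩ := exists_of_mem_splitStep hu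
    obtain ⟨f', hf', s', hs', p', hp', rfl, ⟨t', ht', hst'⟩, hpΦ', hp0'⟩ :=
      exists_of_mem_splitStep hv
    have htt : X.B t t' = 0 := I.perp k (Obj.joinUp_le_D ht) (Obj.joinUp_le_D ht')
    have ht1 := joinUp_mono (fun a _ _ => fix_mono_left (I.le k)) ht
    have ht1' := joinUp_mono (fun a _ _ => fix_mono_left (I.le _)) ht'
    have e1 : X.B s s' = 0 := by
      have := H.dual_zero hy (by omega) hst hst'
      simp only [map_add, LinearMap.add_apply, htt, Strat_perp_joinUp hs ht1', X.symm t s',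
        Strat_perp_joinUp hs' ht1] at this
      linarith
    have e2 : X.B s p' = 0 := by
      have := H.dual_zero hy (by omega) hst hpΦ'
      simp only [map_add, LinearMap.add_apply, X.symm t p', Strat_perp_joinUp hp' ht1] at this
      linarith
    have e3 : X.B p s' = 0 := by
      have := H.dual_zero hy (by omega) hpΦ hst'
      simp only [map_add, Strat_perp_joinUp hp ht1'] at this
      linarith
    have e4 : X.B p p' = 0 := by
      by_cases hk : k = Cb y
      · rw [hp0' (by rw [hk]; simp), map_zero]
      · rw [hp0 hk]; simp
    have e5 := I.orth k hf hy hyT hs'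
    have e6 := I.orth k hf hy hyT hp'
    simp only [map_add, LinearMap.add_apply, e1, e2, e3, e4, X.symm f s', X.symm f p', e5, e6,
      I.perp k hf hf', I.orth _ hf' hy hyT hs, I.orth _ hf' hy hyT hp]
    norm_num
  have hle : ∀ k, F' k ≤ D := fun k => splitStep_le I.le
  have hstab : ∀ k {z}, GenS A x z → ∀ {v}, v ∈ F' k → X.P z v ∈ F' k := by
    intro k z hz v hv
    by_cases hzy : z ≤ y
    · obtain ⟨f, hf, s, hs, p, hp, rfl, -⟩ := exists_of_mem_splitStep hv
      have h1 := sub_mem hv (le_splitStep hf)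
      rw [add_assoc, add_sub_cancel_left] at h1
      rw [add_assoc, map_add]
      refine add_mem (le_splitStep (I.stable k hz hf)) ?_
      rwa [X.P_fix_mono hzy]
      rw [map_add, (mem_Strat.1 hs).1.2, (mem_Strat.1 hp).1.2]
    · obtain ⟨f, hf, s, hs, p, hp, rfl, -⟩ := exists_of_mem_splitStep hv
      rw [map_add, map_add, P_Strat hy.gen hz.gen hzy hs, P_Strat hy.gen hz.gen hzy hp, add_zero,
        add_zero]
      exact le_splitStep (I.stable k hz hf)
  have hlow : ∀ i ≤ m, ∀ v ∈ Φ y i,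
      ∃ f : Bool → E, (∀ k, f k ∈ Φ y i ∧ f k ∈ F' k) ∧ v = f true + f false := by
    intro i hi v hv
    obtain ⟨v₀, hv₀, v₁, hv₁, rfl⟩ := H.decomp_Phi hy hv
    obtain ⟨g, hg, rfl⟩ := I.U_split H hy.gen hT hv₁
    have hl : ∀ k, ∃ s ∈ X.Strat D A y, s + g k ∈ Φ y i :=
      fun k => H.lift hy (U_mono_left (I.le k) (hg k))
    choose s hs hsg using hl
    refine ⟨fun k => s k + g k, fun k => ⟨hsg k, ?_⟩, ?_⟩
    · exact add_mem (mem_splitStep (hs k) (mem_U.1 (hg k)).1 (H.mono hy hi (hsg k)))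
        (le_splitStep (Obj.joinUp_le_D (mem_U.1 (hg k)).1))
    · have h1 := sub_mem hv (add_mem (hsg true) (hsg false))
      have h2 : v₀ + (g true + g false) - (s true + g true + (s false + g false))
        = v₀ - (s true + s false) := by abel
      rw [h2] at h1
      have h3 := H.van hy (by omega) h1 (sub_mem (mem_Gr.1 hv₀).1 (add_mem (hs _) (hs _)))
      rw [sub_eq_zero.1 h3]
      dsimp only
      abel
  have hfix : ∀ v ∈ X.fix D y,
      ∃ f : Bool → E, (∀ k, f k ∈ X.fix D y ∧ f k ∈ F' k) ∧ v = f true + f false := by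
    have hadd : ∀ {v w}, (∃ f : Bool → E, (∀ k, f k ∈ X.fix D y ∧ f k ∈ F' k) ∧
        v = f true + f false) → (∃ f : Bool → E, (∀ k, f k ∈ X.fix D y ∧ f k ∈ F' k) ∧
        w = f true + f false) → (∃ f : Bool → E, (∀ k, f k ∈ X.fix D y ∧ f k ∈ F' k) ∧
        v + w = f true + f false) := by
      rintro v w ⟨f, hf, rfl⟩ ⟨g, hg, rfl⟩
      exact ⟨f + g, fun k => ⟨add_mem (hf k).1 (hg k).1, add_mem (hf k).2 (hg k).2⟩,
        by simp only [Pi.add_apply]; abel⟩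
    have hjoin : ∀ v ∈ joinUp (X.fix D) A y,
        ∃ f : Bool → E, (∀ k, f k ∈ X.fix D y ∧ f k ∈ F' k) ∧ v = f true + f false := by
      intro v hv
      obtain ⟨f, hf, h⟩ := I.joinUp_fix_split H hy.gen hT subset_rfl hv
      exact ⟨f, fun k => ⟨fix_mono_left (I.le k) (joinUp_fix_le_fix (hf k)),
        le_splitStep (Obj.joinUp_le_D (hf k))⟩, h⟩
    intro v hv
    obtain ⟨v₀, hv₀, v₁, hv₁, rfl⟩ := H.decomp hy.gen hv
    obtain ⟨g, hg, j, hj, hjs, rfl⟩ := H.strat_span hy (m := m) (k := c - 1 + X.rk y - m)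
      (by omega) (by omega) (by omega) hv₀
    refine hadd (hadd ?_ ?_) (hjoin v₁ hv₁)
    · obtain ⟨-, t, ht, hgt⟩ := mem_Gr.1 hg
      obtain ⟨f, hf, h⟩ := hlow m le_rfl _ hgt
      have := hadd ⟨f, fun k => ⟨H.le_fix hy _ (hf k).1, (hf k).2⟩, h⟩ (hjoin (-t) (neg_mem ht))
      simpa using this
    · have hjF : j ∈ F' (Cb y) := by
        refine Submodule.mem_sup_right ?_
        rw [if_pos rfl]
        exact ⟨hj, hjs⟩
      refine ⟨fun k => if k = Cb y then j else 0, fun k => ?_, by cases Cb y <;> simp⟩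
      dsimp only
      split_ifs with hk
      · exact ⟨Strat_le_fix hjs, hk ▸ hjF⟩
      · exact ⟨zero_mem _, zero_mem _⟩
  have hall : ∀ i, ∀ v ∈ Φ y i,
      ∃ f : Bool → E, (∀ k, f k ∈ Φ y i ∧ f k ∈ F' k) ∧ v = f true + f false := by
    intro i v hv
    by_cases hi : i ≤ m
    · exact hlow i hi v hv
    · obtain ⟨f, hf, h⟩ := hfix v (H.le_fix hy _ hv)
      refine ⟨f, fun k => ⟨?_, (hf k).2⟩, h⟩
      refine H.dual_mem hy (i := n - i) (by omega) (hf k).1 fun w hw => ?_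
      obtain ⟨g, hg, hwg⟩ := hlow (n - i) (by omega) w hw
      have h1 := hperp k (hf k).2 (hg (!k)).2
      have h2 : X.B (f (!k)) (g k) = 0 := by
        rw [X.symm]
        exact hperp k (hg k).2 (hf (!k)).2
      have h3 := H.dual_zero hy (by omega) hv (hg k).1
      rw [hsplit' h k, map_add, LinearMap.add_apply, h2, add_zero] at h3
      rw [hsplit' hwg k, map_add, h3, h1, add_zero]
  have I' : X.IsSplit D Φ A x (insert y T) F' :=
    { le := hle
      stable := hstab
      perp := hperp
      split := by
        intro z hz hzT i v hv
        rcases Finset.mem_insert.1 hzT with rfl | hzT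
        · exact hall i v hv
        · obtain ⟨f, hf, h⟩ := I.split hz hzT hv
          exact ⟨f, fun k => ⟨(hf k).1, le_splitStep (hf k).2⟩, h⟩ }
  refine ⟨F', I', ?_, ?_⟩
  · intro k u hu z hz hzT v hv
    rw [Finset.mem_insert, not_or] at hzT
    have hyz : ¬ y ≤ z := fun h => by
      rcases eq_or_lt_of_le h with h | h
      · exact hzT.1 h.symm
      · exact hzT.2 (hT z h)
    have h0 : ∀ s ∈ X.Strat D A y, X.B v s = 0 := fun s hs => by
      rw [← (mem_Strat.1 hs).1.2, ← X.adj, P_Strat hz.gen hy.gen hyz hv]; simp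
    obtain ⟨f, hf, s, hs, p, hp, rfl, -⟩ := exists_of_mem_splitStep hu
    rw [map_add, map_add, h0 s hs, h0 p hp, I.orth k hf hz hzT.2 hv]
    norm_num
  · intro z hz hzT k hk i hi v hv hvs hvF
    rcases Finset.mem_insert.1 hzT with rfl | hzT
    · have hiv : i = c - 1 + X.rk z - m ∨ i = m := by omega
      have hv1 : v ∈ Φ z (c - 1 + X.rk z - m) := H.mono hy (by omega) hv
      refine I'.disjoint H hy (Finset.mem_insert_self _ _) (Strat_le_fix hvs) hvF ?_
      have : (!k) = Cb z := by cases k <;> cases h : Cb z <;> simp_all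
      refine Submodule.mem_sup_right ?_
      rw [if_pos this]
      exact ⟨hv1, hvs⟩
    · obtain ⟨f, hf, h⟩ := I.split hz hzT hv
      have h0 : f (!k) = 0 := by
        refine I'.disjoint H hz (Finset.mem_insert_of_mem hzT) (H.le_fix hz _ (hf _).1) (k := k)
          ?_ (le_splitStep (hf _).2)
        have := sub_mem hvF (le_splitStep (hf k).2)
        rw [hsplit' h k] at this
        simpa using this
      have hvk : v = f k := by rw [hsplit' h k, h0, add_zero]
      exact I.mid hz hzT hk hi hv hvs (hvk ▸ (hf k).2)

theorem Obj.exists_split [FiniteDimensional ℝ E] [Fintype L] (H : X.Obj D Φ c A x)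
    (Cb : L → Bool) : ∃ F, SplitState X D Φ c A x Cb Finset.univ F := by
  classical
  refine upset_induction (p := fun T => ∃ F, SplitState X D Φ c A x Cb T F) ∅
    (by simp [isUpperSet_empty]) ⟨fun _ => ⊥, ⟨⟨fun _ => bot_le, ?_, ?_, by simp⟩, ?_, by simp⟩⟩ ?_
  · intro k z _ v hv
    simp_all
  · intro k u v hu _
    simp_all
  · intro k u hu
    simp_all
  · rintro T y hT hyT habove ⟨F, I⟩
    by_cases hy : GenS A x y
    · exact I.step H hy hyT habove
    · have hne : ∀ {z}, GenS A x z → z ∈ insert y T → z ∈ T := fun hz hzT => by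
        rcases Finset.mem_insert.1 hzT with rfl | h
        · exact absurd hz hy
        · exact h
      exact ⟨F, ⟨⟨I.le, I.stable, I.perp, fun hz hzT => I.split hz (hne hz hzT)⟩,
        fun k u hu z hz hzT => I.orth k hu hz fun h => hzT (Finset.mem_insert_of_mem h),
        fun hz hzT => I.mid hz (hne hz hzT)⟩⟩

end KLSpace

namespace KLSpace

variable {L E : Type*} [SemilatticeSup L] [AddCommGroup E] [Module ℝ E]
variable {X : KLSpace L E} {D : Submodule ℝ E} {Φ : L → ℤ → Submodule ℝ E} {c : ℤ}
  {A A' S : Finset L} {x y z : L} {i j : ℤ} {u v w s : E} {e : L}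

theorem Obj.of_subset (H : X.Obj D Φ c A x) (hA : A' ⊆ A)
    (van : ∀ {y}, GenS A' x y → ∀ {i}, 2 * i < c + X.rk y → ∀ {v}, v ∈ Φ y i →
      v ∈ X.Strat D A' y → v = 0)
    (pos : ∀ {y}, GenS A' x y → ∀ {i}, 2 * i = c + X.rk y → ∀ {v}, v ∈ Φ y i →
      v ∈ X.Strat D A' y → v ≠ 0 → 0 < sgn (c + i) * X.B v v) : X.Obj D Φ c A' x where
  good a ha := H.good a (hA ha)
  stable hz := H.stable (hz.mono hA)
  le_fix hz := H.le_fix (hz.mono hA)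
  mono hz := H.mono (hz.mono hA)
  bot hz := H.bot (hz.mono hA)
  compat hz hw := H.compat (hz.mono hA) (hw.mono hA)
  fix_mem hz hw := H.fix_mem (hz.mono hA) (hw.mono hA)
  dual_zero hz := H.dual_zero (hz.mono hA)
  dual_mem hz := H.dual_mem (hz.mono hA)
  cell hz _ hS := H.cell (hz.mono hA) (hS.trans hA)
  van := van
  pos := pos

variable [DecidableEq L]

theorem Obj.HR_of_redundant (H : X.Obj D Φ c A x) (he : e ∈ A) (hex : ¬ e ≤ x) {b : L}
    (hb : b ∈ A.erase e) (hbx : ¬ b ≤ x) (hbe : b ≤ x ⊔ e)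
    (hR : X.Obj D Φ c (A.erase e) x → X.HR D Φ c (A.erase e) x) : X.HR D Φ c A x := by
  have hbA := Finset.mem_of_mem_erase hb
  have hsup : x ⊔ b = x ⊔ e := H.sup_eq_sup he hbA hex hbx hbe
  have hS : ∀ y, x ≤ y → ¬ e ≤ y → ¬ b ≤ y ∧ y ⊔ e = y ⊔ b := by
    intro y hxy hey
    refine ⟨fun h => hey (le_sup_right.trans (hsup ▸ sup_le hxy h)), ?_⟩
    rw [← sup_eq_left.2 hxy, sup_assoc, sup_assoc, hsup]
  have hStrat : ∀ y, x ≤ y → X.Strat D (A.erase e) y ≤ X.Strat D A y := by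
    intro y hxy v hv
    rw [mem_Strat] at hv ⊢
    refine ⟨hv.1, fun a ha hay => ?_⟩
    by_cases hae : a = e
    · subst hae
      rw [(hS y hxy hay).2]
      exact hv.2 b hb (hS y hxy hay).1
    · exact hv.2 a (Finset.mem_erase.2 ⟨hae, ha⟩) hay
  have hj : ∀ Q : L → Submodule ℝ E, joinUp Q A x ≤ joinUp Q (A.erase e) x := by
    intro Q
    refine joinUp_le fun a ha hay => ?_
    by_cases hae : a = e
    · subst hae
      rw [← hsup]
      exact le_joinUp hb hbx
    · exact le_joinUp (Finset.mem_erase.2 ⟨hae, ha⟩) hay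
  have hU : ∀ i, X.U D Φ (A.erase e) x i ≤ X.U D Φ A x i := by
    intro i v hv
    rw [mem_U] at hv ⊢
    refine ⟨joinUp_subset (Finset.erase_subset e A) hv.1, fun a ha hay => ?_⟩
    by_cases hae : a = e
    · subst hae
      rw [← hsup]
      exact hv.2 b hb hbx
    · exact hv.2 a (Finset.mem_erase.2 ⟨hae, ha⟩) hay
  have H' : X.Obj D Φ c (A.erase e) x := H.of_subset (Finset.erase_subset e A)
    (fun hy _ hi _ hv hs => H.van (hy.mono (Finset.erase_subset e A)) hi hv
      (hStrat _ hy.lt.le hs))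
    (fun hy _ hi _ hv hs => H.pos (hy.mono (Finset.erase_subset e A)) hi hv
      (hStrat _ hy.lt.le hs))
  intro i u hi hu hp
  rw [mem_U] at hu
  obtain ⟨h1, h2⟩ := hR H' i u hi
    (mem_U.2 ⟨hj _ hu.1, fun a ha => hu.2 a (Finset.mem_of_mem_erase ha)⟩)
    (fun w hw => hp w (hU _ hw))
  exact ⟨h1, fun h0 => joinUp_subset (Finset.erase_subset e A) (h2 h0)⟩

namespace Obj

variable (H : X.Obj D Φ c A x) (he : e ∈ A) (hy : Gen A x y) (hey : ¬ e ≤ y)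
  (hb : ∀ b ∈ A.erase e, b ≤ y ⊔ e → b ≤ y)

omit [DecidableEq L] in
theorem joinUp_sup_le_joinUp [DecidableEq L] {Q : L → Submodule ℝ E} (hQ : ∀ {y z}, y ≤ z → Q z ≤ Q y) :
    joinUp Q A (y ⊔ e) ≤ joinUp Q (A.erase e) y :=
  joinUp_le fun a ha hay => by
    have hae : a ≠ e := fun h => hay (h ▸ le_sup_right)
    exact (hQ (sup_le_sup_right le_sup_left a)).trans
      (le_joinUp (Finset.mem_erase.2 ⟨hae, ha⟩) fun h => hay (h.trans le_sup_left))

include hb in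
theorem P_Strat_sup {a : L} (ha : a ∈ A.erase e) (hay : ¬ a ≤ y)
    (hs : s ∈ X.Strat D A (y ⊔ e)) : X.P (y ⊔ a) s = 0 := by
  rw [mem_Strat] at hs
  have h1 := hs.2 a (Finset.mem_of_mem_erase ha) fun h => hay (hb a ha h)
  rw [X.P_sup_of_fix hs.1.2] at h1
  rw [X.P_sup, h1, map_zero]

include hb in
theorem Strat_sup_perp (hs : s ∈ X.Strat D A (y ⊔ e))
    (hw : w ∈ joinUp (X.fix D) (A.erase e) y) : X.B s w = 0 := by
  refine joinUp_induction hw ?_ ?_ ?_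
  · intro a ha hay w hw
    rw [← (mem_fix.1 hw).2, ← X.adj, P_Strat_sup hb ha hay hs]; simp
  · simp
  · intro v _ w _ hv hw
    rw [map_add, hv, hw, add_zero]

include H he hy hey

include hb in
theorem P_sup_mem_joinUp (hw : w ∈ joinUp (X.fix D) (A.erase e) y) :
    X.P (y ⊔ e) w ∈ joinUp (X.fix D) A (y ⊔ e) :=
  joinUp_subset (Finset.erase_subset e A) (H.P_joinUp_fix hy he hey (Finset.erase_subset e A)
    (fun a ha hay h => hay (hb a ha (h ▸ le_sup_right))) hw)

variable [FiniteDimensional ℝ E]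

theorem decomp_joinUp (hw : w ∈ joinUp (X.fix D) A y) :
    ∃ s ∈ X.Strat D A (y ⊔ e), ∃ w' ∈ joinUp (X.fix D) (A.erase e) y, w = s + w' := by
  obtain ⟨f, hf, q, hq, rfl⟩ := joinUp_eq_of_mem he hw hey
  obtain ⟨s, hs, r, hr, rfl⟩ := H.decomp (hy.step he) hf
  exact ⟨s, hs, r + q, add_mem (joinUp_sup_le_joinUp (fun h => fix_le_of_le h) hr) hq,
    by rw [add_assoc]⟩

include hb in
theorem lift_sup (hw : w ∈ X.U D Φ (A.erase e) y i) :
    ∃ s ∈ X.Strat D A (y ⊔ e), s + w ∈ X.U D Φ A y i := by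
  have hye := GenS.step_of_gen hy he hey
  rw [mem_U] at hw
  have h1 : X.P (y ⊔ e) w ∈ X.U D Φ A (y ⊔ e) (i + 1) := by
    refine mem_U.2 ⟨H.P_sup_mem_joinUp he hy hey hb hw.1, fun a ha hay => ?_⟩
    have hae : a ∈ A.erase e := Finset.mem_erase.2 ⟨fun h => hay (h ▸ le_sup_right), ha⟩
    have hay' : ¬ a ≤ y := fun h => hay (h.trans le_sup_left)
    have h2 := H.proj_sup (GenS.step_of_gen hy ha hay') he (hw.2 a hae hay')
    rw [← X.P_sup] at h2 ⊢
    rw [sup_right_comm, sup_eq_left.2 (sup_le_sup_right le_sup_left a)] at h2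
    rwa [sup_eq_left.2 le_sup_left]
  obtain ⟨s, hs, hsw⟩ := H.lift hye h1
  refine ⟨s, hs, mem_U.2 ⟨add_mem (mem_joinUp he hey (Strat_le_fix hs))
    (joinUp_subset (Finset.erase_subset e A) hw.1), fun a ha hay => ?_⟩⟩
  by_cases hae : a = e
  · subst hae
    rwa [map_add, (mem_Strat.1 hs).1.2]
  · have hmem := Finset.mem_erase.2 ⟨hae, ha⟩
    rw [map_add, P_Strat_sup hb hmem hay hs, zero_add]
    exact hw.2 a hmem hay

/-- Decomposition of a section along the stratum at `y ⊔ e`, after correction by a section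
supported above `y ⊔ e`. -/
theorem decomp_adjust (hR : X.HR D Φ c A (y ⊔ e)) (hi : 2 * i ≤ c + X.rk (y ⊔ e))
    (hw : w ∈ joinUp (X.fix D) A y) :
    ∃ f ∈ Φ (y ⊔ e) i, ∃ s ∈ X.Strat D A (y ⊔ e), ∃ w' ∈ joinUp (X.fix D) (A.erase e) y,
      w = s + w' + f ∧ ∀ g ∈ Φ (y ⊔ e) i, X.B s g = 0 := by
  have hye := GenS.step_of_gen hy he hey
  obtain ⟨s, hs, w', hw', rfl⟩ := H.decomp_joinUp he hy hey hw
  obtain ⟨g, hg, hp⟩ := (H.ndeg_Gr hye hR hi).exists_proj s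
  obtain ⟨hgs, r, hr, hgr⟩ := mem_Gr.1 hg
  exact ⟨g + r, hgr, s - g, sub_mem hs hgs, w' - r,
    sub_mem hw' (joinUp_sup_le_joinUp (fun h => fix_le_of_le h) hr), by abel,
    H.perp_Phi_of_Gr hye (sub_mem hs hgs) hp⟩

include hb in
theorem HR_of_deletion (hRe : X.HR D Φ c A (y ⊔ e))
    (hR : X.HR D Φ c (A.erase e) y) : X.HR D Φ c A y := by
  have hye := GenS.step_of_gen hy he hey
  have hrk := H.good e he y hey
  intro i u hi hu hp
  obtain ⟨f, hf, s, hs, w, hw, rfl, hsf⟩ := H.decomp_adjust he hy hey hRe (i := i)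
    (by omega) (mem_U.1 hu).1
  have hfK : f ∈ K Φ A y i := mem_joinUp (Q := fun z => Φ z i) he hey hf
  have hu' : s + w ∈ X.U D Φ A y i := by
    simpa using sub_mem hu (H.K_le_U hy hfK)
  have hp' : ∀ t ∈ X.U D Φ A y (i - 1), X.B (s + w) t = 0 := fun t ht => by
    have h1 := hp t ht
    have h2 : X.B f t = 0 := by rw [X.symm]; exact H.K_perp_U hy (by omega) hfK ht
    rwa [map_add, LinearMap.add_apply, h2, add_zero] at h1
  have hBf : X.B (s + w + f) (s + w + f) = X.B (s + w) (s + w) := by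
    have h1 := H.K_perp_U hy (by omega) hfK hu'
    have h2 := H.K_perp_U hy (by omega) hfK (H.K_le_U hy hfK)
    rw [map_add (X.B), LinearMap.add_apply, map_add (X.B (s + w)), map_add (X.B f), h1,
      X.symm f, h1, h2]
    ring
  have hsw : X.B s w = 0 := Strat_sup_perp hb hs hw
  have hB : X.B (s + w) (s + w) = X.B s s + X.B w w := by
    rw [map_add, map_add, LinearMap.add_apply, LinearMap.add_apply, X.symm w s, hsw]
    ring
  have hsG : s ∈ X.Gr D Φ A (y ⊔ e) (i + 1) := by
    refine mem_Gr.2 ⟨hs, _, H.P_sup_mem_joinUp he hy hey hb hw, ?_⟩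
    have := (mem_U.1 hu').2 e he hey
    rwa [map_add, (mem_Strat.1 hs).1.2] at this
  have hsR := H.HRV hye hRe (by omega) hsG (by simpa using hsf)
  have hwU : w ∈ X.U D Φ (A.erase e) y i := by
    refine mem_U.2 ⟨hw, fun a ha hay => ?_⟩
    have := (mem_U.1 hu').2 a (Finset.mem_of_mem_erase ha) hay
    rwa [map_add, P_Strat_sup hb ha hay hs, zero_add] at this
  have hwR := hR i w hi hwU fun t ht => by
    obtain ⟨r, hr, hrt⟩ := H.lift_sup he hy hey hb ht
    have h1 := hp' _ hrt
    have h2 := (mem_U.1 hrt).2 e he hey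
    rw [map_add, (mem_Strat.1 hr).1.2, sub_add_cancel] at h2
    have h3 := hsf _ h2
    have htj := (mem_U.1 ht).1
    rw [map_add, Strat_perp_joinUp hs (H.P_sup_mem_joinUp he hy hey hb htj), add_zero] at h3
    simp only [map_add, LinearMap.add_apply, h3, X.symm w r, Strat_sup_perp hb hr hw,
      Strat_sup_perp hb hs htj] at h1
    linarith
  have hsg : sgn (c + (i + 1)) = sgn (c - 1 + i) := by
    rw [← sgn_add_two_mul (c - 1 + i) 1]; congr 1; ring
  rw [hsg] at hsR
  rw [hBf, hB, mul_add]
  refine ⟨add_nonneg hsR.1 hwR.1, fun h0 => ?_⟩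
  have e1 : sgn (c - 1 + i) * X.B s s = 0 := by
    have : sgn (c - 1 + i) * X.B s s + sgn (c - 1 + i) * X.B w w = 0 := by
      rw [← mul_add, h0, mul_zero]
    linarith [hsR.1, hwR.1]
  have e2 : X.B s s = 0 := (mul_eq_zero.1 e1).resolve_left (sgn_ne_zero _)
  rw [hsR.2 e2, zero_add]
  exact add_mem (joinUp_subset (Finset.erase_subset e A) (hwR.2 (by linarith))) hfK

omit hey [FiniteDimensional ℝ E] [DecidableEq L] in
theorem Strat_erase_decomp [DecidableEq L] (hey : ¬ e ≤ y) (hv : v ∈ X.Strat D (A.erase e) y) :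
    v - X.P (y ⊔ e) v ∈ X.Strat D A y ∧ X.P (y ⊔ e) v ∈ X.Strat D A (y ⊔ e) := by
  have hye := GenS.step_of_gen hy he hey
  rw [mem_Strat] at hv
  refine ⟨mem_Strat.2 ⟨⟨sub_mem hv.1.1 (H.stable hye hv.1.1), ?_⟩, fun a ha hay => ?_⟩,
    mem_Strat.2 ⟨⟨H.stable hye hv.1.1, X.P_idem _ _⟩, fun a ha hay => ?_⟩⟩
  · rw [map_sub, hv.1.2, X.P_of_le le_sup_left]
  · by_cases hae : a = e
    · rw [hae, map_sub, X.P_idem, sub_self]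
    · rw [map_sub, X.P_comm, hv.2 a (Finset.mem_erase.2 ⟨hae, ha⟩) hay, map_zero, sub_zero]
  · have hae : a ∈ A.erase e := Finset.mem_erase.2 ⟨fun h => hay (h ▸ le_sup_right), ha⟩
    rw [X.P_of_ge le_sup_left, ← X.P_of_ge (sup_le_sup_right le_sup_left a : y ⊔ a ≤ y ⊔ e ⊔ a),
      hv.2 a hae fun h => hay (h.trans le_sup_left), map_zero]

omit he hy hey H [FiniteDimensional ℝ E] in
theorem Strat_erase_of_le (hey : e ≤ y) : X.Strat D (A.erase e) y ≤ X.Strat D A y := fun v hv => by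
  rw [mem_Strat] at hv ⊢
  exact ⟨hv.1, fun a ha hay => hv.2 a (Finset.mem_erase.2 ⟨fun h => hay (h ▸ hey), ha⟩) hay⟩

omit hy [FiniteDimensional ℝ E] in
theorem Strat_erase_of_exists (hv : v ∈ X.Strat D (A.erase e) y) {b : L} (hb : b ∈ A.erase e)
    (hby : ¬ b ≤ y) (hbe : b ≤ y ⊔ e) : v ∈ X.Strat D A y := by
  have hsup := H.sup_eq_sup he (Finset.mem_of_mem_erase hb) hey hby hbe
  rw [mem_Strat] at hv ⊢
  refine ⟨hv.1, fun a ha hay => ?_⟩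
  by_cases hae : a = e
  · subst hae
    rw [← hsup]
    exact hv.2 b hb hby
  · exact hv.2 a (Finset.mem_erase.2 ⟨hae, ha⟩) hay

omit hy in
include hb in
theorem pos_of_deletion (hy : GenS A x y) (hRe : X.HR D Φ c A (y ⊔ e))
    (hR : X.HR D Φ c (A.erase e) y) (hi : 2 * i = c + X.rk y) (hu : u ∈ Φ y i)
    (hus : u ∈ X.Strat D (A.erase e) y) (hu0 : u ≠ 0) : 0 < sgn (c + i) * X.B u u := by
  have hye := GenS.step_of_gen hy.gen he hey
  have hrk := H.good e he y hey
  have hA := Finset.erase_subset e A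
  obtain ⟨huy, hue⟩ := H.Strat_erase_decomp he hy.gen hey hus
  obtain ⟨t, ht, j, hj, hjs, htj⟩ := H.strat_span hy (m := i - 1) (k := i) (by omega) (by omega)
    (by omega) huy
  obtain ⟨hts, r, hr, htr⟩ := mem_Gr.1 ht
  obtain ⟨f, hf, s, hs, w, hw, rfl, hsf⟩ := H.decomp_adjust he hy.gen hey hRe (i := i - 1)
    (by omega) hr
  have hz : t + s + w ∈ Φ y (i - 1) := by
    have := sub_mem htr (H.compat hy hye le_sup_left _ hf)
    convert this using 1; abel
  obtain ⟨p, hp⟩ : ∃ p, p = X.P (y ⊔ e) u - s := ⟨_, rfl⟩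
  have hps : p ∈ X.Strat D A (y ⊔ e) := hp ▸ sub_mem hue hs
  have hpj : p ∈ joinUp (X.fix D) A y := mem_joinUp he hey (Strat_le_fix hps)
  have hwj : w ∈ joinUp (X.fix D) A y := joinUp_subset hA hw
  have huz : u = (t + s + w) + (j + p - w) := by
    have : u = (u - X.P (y ⊔ e) u) + X.P (y ⊔ e) u := by abel
    rw [this, htj, hp]; abel
  have hpf : ∀ g ∈ Φ (y ⊔ e) (i - 1), X.B p g = 0 := fun g hg => by
    rw [hp, map_sub, LinearMap.sub_apply, hsf g hg, X.adj, (mem_fix.1 (H.le_fix hye _ hg)).2,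
      H.dual_zero hy (by omega) hu (H.compat hy hye le_sup_left _ hg), sub_zero]
  have hjp : X.B j p = 0 := Strat_perp_joinUp hjs hpj
  have hjw : X.B j w = 0 := Strat_perp_joinUp hjs hwj
  have hpw : X.B p w = 0 := Strat_sup_perp hb hps hw
  have hzperp : ∀ q ∈ Φ y (i - 1), X.B (j + p - w) q = 0 := fun q hq => by
    have h1 := H.dual_zero hy (by omega) hu hq
    have h2 := H.dual_zero hy (by omega) hz hq
    rw [huz, map_add, LinearMap.add_apply, h2, zero_add] at h1
    exact h1
  have hB : X.B u u = X.B j j + X.B p p + X.B w w := by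
    have h1 := hzperp _ hz
    have h2 := H.dual_zero hy (by omega) hz hz
    have h3 : X.B u u = X.B (j + p - w) (j + p - w) := by
      rw [huz, map_add (X.B), LinearMap.add_apply, map_add, map_add (X.B (j + p - w)), h1, h2,
        X.symm (t + s + w), h1]
      ring
    rw [h3]
    simp only [map_add, map_sub, LinearMap.add_apply, LinearMap.sub_apply, hjp, hjw, hpw,
      X.symm p j, X.symm w j, X.symm w p]
    ring
  have hpG : p ∈ X.Gr D Φ A (y ⊔ e) i := by
    obtain ⟨g, hg, q, hq, hqs, rfl⟩ := H.strat_span hye (m := i) (k := i) (by omega) le_rfl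
      (by omega) hps
    rw [H.van hye (by omega) hq hqs, add_zero]
    exact hg
  have hpR := H.HRV hye hRe (by omega) hpG hpf
  have hwU : w ∈ X.U D Φ (A.erase e) y (i - 1) := by
    refine mem_U.2 ⟨hw, fun a ha hay => ?_⟩
    have := H.proj_sup hy (Finset.mem_of_mem_erase ha) hz
    rwa [map_add, map_add, P_Strat_sup hb ha hay hs,
      (mem_Strat.1 hts).2 a (Finset.mem_of_mem_erase ha) hay, zero_add, zero_add] at this
  have hwR := hR (i - 1) w (by omega) hwU fun q hq => by
    obtain ⟨r', hr', hrq⟩ := H.lift_sup he hy.gen hey hb hq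
    have hrqe := (mem_U.1 hrq).2 e he hey
    obtain ⟨l, hl, hlq⟩ := H.lift hy hrq
    have h1 := hzperp _ (H.mono hy (by omega) hlq)
    have h2 : X.B j (l + (r' + q)) = 0 := H.dual_zero hy (by omega) hj hlq
    rw [sub_add_cancel] at hrqe
    have h3 := hpf _ hrqe
    have hqj := (mem_U.1 hq).1
    rw [map_add (X.P _), (mem_Strat.1 hr').1.2, map_add,
      Strat_perp_joinUp hps (H.P_sup_mem_joinUp he hy.gen hey hb hqj), add_zero] at h3
    rw [map_sub, map_add (X.B), LinearMap.sub_apply, LinearMap.add_apply, h2] at h1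
    simp only [map_add, X.symm p l, Strat_perp_joinUp hl hpj, h3, Strat_sup_perp hb hps hqj,
      X.symm w l, Strat_perp_joinUp hl hwj, X.symm w r', Strat_sup_perp hb hr' hw] at h1
    linarith
  rw [show sgn (c - 1 + (i - 1)) = sgn (c + i) by
    rw [← sgn_add_two_mul (c - 1 + (i - 1)) 1]; congr 1; ring] at hwR
  have hjR : 0 ≤ sgn (c + i) * X.B j j ∧ (sgn (c + i) * X.B j j = 0 → j = 0) := by
    by_cases h0 : j = 0
    · simp [h0]
    · have := H.pos hy hi hj hjs h0
      exact ⟨this.le, fun h => absurd h this.ne'⟩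
  rw [hB, mul_add, mul_add]
  refine lt_of_le_of_ne (by linarith [hjR.1, hpR.1, hwR.1]) fun h0 => hu0 ?_
  have hj0 : j = 0 := hjR.2 (by linarith [hjR.1, hpR.1, hwR.1])
  have hp0 : p = 0 := hpR.2 ((mul_eq_zero.1 (by linarith [hjR.1, hpR.1, hwR.1] :
    sgn (c + i) * X.B p p = 0)).resolve_left (sgn_ne_zero _))
  have hwK := hwR.2 ((mul_eq_zero.1 (by linarith [hjR.1, hpR.1, hwR.1] :
    sgn (c + i) * X.B w w = 0)).resolve_left (sgn_ne_zero _))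
  have hts' : t + s ∈ Φ y (i - 1) := by
    have := sub_mem hz (H.K_le_Phi hy subset_rfl (joinUp_subset hA hwK))
    simpa using this
  have hs0 : s = 0 := by
    have := H.proj_sup hy he hts'
    rw [map_add, (mem_Strat.1 hts).2 e he hey, (mem_Strat.1 hs).1.2, zero_add,
      sub_add_cancel] at this
    exact H.van hye (by omega) this hs
  rw [hs0, add_zero] at hts'
  rw [huz, hs0, hj0, hp0, H.van hy (by omega) hts' hts]
  abel

omit hy [FiniteDimensional ℝ E] in
theorem van_of_deletion (hy : GenS A x y)
    (hJ : (∀ b ∈ A.erase e, b ≤ y ⊔ e → b ≤ y) → ∀ {j v}, 2 * j = c + X.rk (y ⊔ e) →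
      v ∈ Φ (y ⊔ e) j → v ∈ X.Strat D A (y ⊔ e) → v = 0)
    (hi : 2 * i < c + X.rk y) (hu : u ∈ Φ y i) (hus : u ∈ X.Strat D (A.erase e) y) : u = 0 := by
  by_cases hb : ∀ b ∈ A.erase e, b ≤ y ⊔ e → b ≤ y
  · have hye := GenS.step_of_gen hy.gen he hey
    have hrk := H.good e he y hey
    obtain ⟨huy, hue⟩ := H.Strat_erase_decomp he hy.gen hey hus
    have hue' := H.proj_sup hy he hu
    have h0 : X.P (y ⊔ e) u = 0 := by
      rcases (by omega : 2 * (i + 1) < c + X.rk (y ⊔ e) ∨ 2 * (i + 1) = c + X.rk (y ⊔ e)) with h | h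
      · exact H.van hye h hue' hue
      · exact hJ hb h hue' hue
    rw [h0, sub_zero] at huy
    exact H.van hy hi hu huy
  · push Not at hb
    obtain ⟨b, hb, hbe, hby⟩ := hb
    exact H.van hy hi hu (H.Strat_erase_of_exists he hey hus hb hby hbe)

end Obj

theorem Obj.deletion [FiniteDimensional ℝ E] [Finite L] (H : X.Obj D Φ c A x) (he : e ∈ A)
    (hJ : ∀ {y}, GenS A x y → ¬ e ≤ y → (∀ b ∈ A.erase e, b ≤ y ⊔ e → b ≤ y) →
      ∀ {j v}, 2 * j = c + X.rk (y ⊔ e) → v ∈ Φ (y ⊔ e) j → v ∈ X.Strat D A (y ⊔ e) → v = 0)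
    (hRA : ∀ {y}, GenS A x y → X.HR D Φ c A y)
    (hR : ∀ {y}, GenS (A.erase e) x y → X.Obj D Φ c (A.erase e) y → X.HR D Φ c (A.erase e) y) :
    X.Obj D Φ c (A.erase e) x := by
  have hA := Finset.erase_subset e A
  have van : ∀ {y}, GenS (A.erase e) x y → ∀ {i}, 2 * i < c + X.rk y → ∀ {v}, v ∈ Φ y i →
      v ∈ X.Strat D (A.erase e) y → v = 0 := fun {y} hy i hi v hv hvs => by
    by_cases hey : e ≤ y
    · exact H.van (hy.mono hA) hi hv (Strat_erase_of_le hey hvs)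
    · exact H.van_of_deletion he hey (hy.mono hA) (hJ (hy.mono hA) hey) hi hv hvs
  refine H.of_subset hA van fun {y} => ?_
  induction y using WellFoundedGT.induction with
  | ind y ih =>
    intro hy i hi v hv hvs hv0
    by_cases hey : e ≤ y
    · exact H.pos (hy.mono hA) hi hv (Strat_erase_of_le hey hvs) hv0
    · by_cases hb : ∀ b ∈ A.erase e, b ≤ y ⊔ e → b ≤ y
      · refine H.pos_of_deletion he hey hb (hy.mono hA)
          (hRA ((hy.mono hA).step he)) (hR hy ?_) hi hv hvs hv0
        refine (H.restrict (hy.mono hA).gen).of_subset hA (fun hz => van (.of_gen hy.gen hz))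
          fun {z} hz => ih z hz.lt (.of_gen hy.gen hz)
      · push Not at hb
        obtain ⟨b, hb, hbe, hby⟩ := hb
        exact H.pos (hy.mono hA) hi hv (H.Strat_erase_of_exists he hey hvs hb hby hbe) hv0

end KLSpace

namespace KLSpace

variable {L E : Type*} [SemilatticeSup L] [AddCommGroup E] [Module ℝ E]

/-- The part of `D` killed by `P e`. -/
def kerPart (X : KLSpace L E) (D : Submodule ℝ E) (e : L) : Submodule ℝ E :=
  D ⊓ LinearMap.ker (X.P e)

variable [DecidableEq L]

/-- An object in which `e` behaves like a coloop. -/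
structure Coloop (X : KLSpace L E) (D : Submodule ℝ E) (Φ : L → ℤ → Submodule ℝ E) (c : ℤ)
    (A : Finset L) (x e : L) : Prop extends X.Obj D Φ c A x where
  mem : e ∈ A
  not_le : ¬ e ≤ x
  mid : ∀ {y}, GenS A x y → ¬ e ≤ y → ∀ {i v}, 2 * i = c + X.rk y → v ∈ Φ y i →
    v ∈ X.Strat D A y → v = 0
  fix_zero : ∀ {y}, Gen (A.erase e) x y → e ≤ y → ∀ {v}, v ∈ X.fix D y → v = 0
  fix_sup_zero : ∀ {y}, Gen (A.erase e) x y → ¬ e ≤ y → ∀ {b}, b ∈ A.erase e → ¬ b ≤ y →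
    b ≤ y ⊔ e → ∀ {v}, v ∈ X.fix D (y ⊔ e) → v = 0

variable {X : KLSpace L E} {D : Submodule ℝ E} {Φ : L → ℤ → Submodule ℝ E} {c : ℤ}
  {A S : Finset L} {x y z : L} {i j k : ℤ} {u v w s : E} {e : L}

omit [DecidableEq L] in
theorem mem_kerPart : v ∈ X.kerPart D e ↔ v ∈ D ∧ X.P e v = 0 := by simp [kerPart]

omit [DecidableEq L] in
theorem perp_P (hv : X.P e v = 0) (u : E) : X.B v (X.P e u) = 0 := by simp [← X.adj, hv]

omit [DecidableEq L] in
theorem P_sup_eq (hv : v ∈ X.fix D y) : X.P (y ⊔ e) v = X.P e v :=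
  X.P_sup_of_fix (mem_fix.1 hv).2 e

namespace Coloop

variable (C : X.Coloop D Φ c A x e)
include C

theorem step_e (hy : Gen (A.erase e) x y) (hey : ¬ e ≤ y) : GenS A x (y ⊔ e) :=
  .step_of_gen (hy.mono (Finset.erase_subset e A)) C.mem hey

theorem P_mem_Phi (hy : GenS A x y) (hv : v ∈ Φ y i) : X.P e v ∈ Φ (y ⊔ e) (i + 1) := by
  rw [← P_sup_eq (C.le_fix hy _ hv)]
  exact C.proj_sup hy C.mem hv

theorem P_mem_Phi_self (hy : GenS A x y) (hv : v ∈ Φ y i) : X.P e v ∈ Φ y (i + 1) :=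
  C.compat hy (hy.step C.mem) le_sup_left _ (C.P_mem_Phi hy hv)

theorem sub_mem_fix (hy : GenS A x y) (hv : v ∈ X.fix D y) :
    v - X.P e v ∈ X.fix (X.kerPart D e) y := by
  have h := mem_fix.1 hv
  refine mem_fix.2 ⟨mem_kerPart.2 ⟨sub_mem h.1 ?_, by rw [map_sub, X.P_idem, sub_self]⟩, ?_⟩
  · rw [← P_sup_eq hv]
    exact C.stable (hy.step C.mem) h.1
  · rw [map_sub, X.P_comm, h.2]

theorem sub_mem_Phi (hy : GenS A x y) (hv : v ∈ Φ y i) :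
    v - X.P e v ∈ Φ y (i + 1) ⊓ X.kerPart D e :=
  ⟨sub_mem (C.mono hy (by omega) hv) (C.P_mem_Phi_self hy hv),
    (mem_fix.1 (C.sub_mem_fix hy (C.le_fix hy _ hv))).1⟩

theorem ndeg_fix_kerPart (hy : GenS A x y) : X.NDeg (X.fix (X.kerPart D e) y) := fun v hv h =>
  C.ndeg_fix hy v (fix_mono_left inf_le_left hv) fun u hu => by
    have := h _ (C.sub_mem_fix hy hu)
    rwa [map_sub, perp_P (mem_kerPart.1 (mem_fix.1 hv).1).2, sub_zero] at this

variable [FiniteDimensional ℝ E]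

theorem joinUp_inf_kerPart (hy : Gen (A.erase e) x y) (hS : S ⊆ A.erase e)
    (hv : v ∈ joinUp (fun z => Φ z k) S y) (hve : X.P e v = 0) :
    v ∈ joinUp (fun z => Φ z k ⊓ X.kerPart D e) S y := by
  have hA := Finset.erase_subset e A
  induction S using Finset.induction_on generalizing v with
  | empty => rwa [joinUp_empty] at hv ⊢
  | insert b S _ ih =>
    have hS' := (Finset.subset_insert b S).trans hS
    have hbA' := hS (Finset.mem_insert_self b S)
    have hbA := hA hbA'
    have hins := joinUp_subset (Q := fun z => Φ z k ⊓ X.kerPart D e) (y := y)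
      (Finset.subset_insert b S)
    by_cases hby : b ≤ y
    · rw [joinUp_insert_of_le hby] at hv ⊢
      exact ih hS' hv hve
    obtain ⟨f, hf, w, hw, rfl⟩ := exists_of_mem_joinUp_insert hv hby
    have hyb' := GenS.step_of_gen hy hbA' hby
    have hyb := hyb'.mono hA
    have hfD := C.le_fix hyb _ hf
    suffices h : ∃ q ∈ joinUp (fun z => Φ z k) S y, q ∈ Φ (y ⊔ b) k ∧ X.P e q = X.P e f by
      obtain ⟨q, hq, hqb, hqe⟩ := h
      have h1 : f - q ∈ Φ (y ⊔ b) k ⊓ X.kerPart D e := by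
        refine ⟨sub_mem hf hqb, mem_kerPart.2 ⟨sub_mem (mem_fix.1 hfD).1
          (mem_fix.1 (C.le_fix hyb _ hqb)).1, by rw [map_sub, hqe, sub_self]⟩⟩
      have h2 := ih hS' (add_mem hq hw) (by rw [map_add, hqe, ← map_add, hve])
      have := add_mem (mem_joinUp (Q := fun z => Φ z k ⊓ X.kerPart D e)
        (Finset.mem_insert_self b S) hby h1) (hins h2)
      rwa [← add_assoc, sub_add_cancel] at this
    by_cases hrep : ∃ b' ∈ S, ¬ b' ≤ y ∧ y ⊔ b' = y ⊔ b
    · obtain ⟨b', hb', hb'y, heq⟩ := hrep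
      exact ⟨f, mem_joinUp (Q := fun z => Φ z k) hb' hb'y (by rwa [heq]), hf, rfl⟩
    push Not at hrep
    by_cases hez : e ≤ y ⊔ b
    · exact ⟨0, zero_mem _, zero_mem _, by rw [C.fix_zero hyb'.gen hez hfD]⟩
    have hybe := C.step_e hyb'.gen hez
    by_cases hb : ∃ b' ∈ S, ¬ b' ≤ y ⊔ b ∧ y ⊔ b ⊔ b' = y ⊔ b ⊔ e
    · obtain ⟨b', hb', hb'y, heq⟩ := hb
      refine ⟨0, zero_mem _, zero_mem _, ?_⟩
      rw [map_zero, C.fix_sup_zero hyb'.gen hez (hS' hb') hb'y (heq ▸ le_sup_right)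
        (C.le_fix hybe _ (C.P_mem_Phi hyb hf))]
    push Not at hb
    have hwj : X.P e f ∈ joinUp (X.fix D) S (y ⊔ b ⊔ e) := by
      have h1 := C.P_joinUp_fix (hy.mono hA) hbA hby (hS'.trans hA) hrep
        (C.K_le_joinUp (hy.mono hA) (hS'.trans hA) hw)
      have h2 := C.P_joinUp_fix hyb.gen C.mem hez (hS'.trans hA) hb h1
      have h3 : X.P e w = -X.P e f := by
        rw [eq_neg_iff_add_eq_zero, ← map_add, add_comm, hve]
      rw [X.P_of_ge le_sup_left, X.P_sup, h3, map_neg, X.P_comm, (mem_fix.1 hfD).2] at h2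
      simpa using neg_mem h2
    have hpK := C.cell hybe (hS'.trans hA) (C.P_mem_Phi hyb hf) hwj
    have key : ∃ q ∈ joinUp (fun z => Φ z k) S (y ⊔ b), X.P e q = X.P e f := by
      refine joinUp_induction (p := fun p => ∃ q ∈ joinUp (fun z => Φ z k) S (y ⊔ b),
        X.P e q = p) hpK ?_ ?_ ?_
      · intro a ha hay p hp
        have hay' : ¬ a ≤ y ⊔ b := fun h => hay (h.trans le_sup_left)
        have hg := hyb'.step (hS' ha)
        have hp' : p ∈ Φ (y ⊔ b ⊔ a ⊔ e) (k + 1) := by rwa [sup_right_comm]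
        by_cases hea : e ≤ y ⊔ b ⊔ a
        · refine ⟨0, zero_mem _, ?_⟩
          rw [sup_eq_left.2 hea] at hp'
          rw [map_zero, C.fix_zero hg.gen hea (C.le_fix (hg.mono hA) _ hp')]
        · have hrk := C.good e C.mem _ hea
          obtain ⟨q, hq, hqp⟩ := C.proj_surj (hg.mono hA) ((hg.mono hA).step C.mem) le_sup_left hp'
            (i := k) (by omega)
          refine ⟨q, mem_joinUp (Q := fun z => Φ z k) ha hay' hq, ?_⟩
          rw [← hqp, P_sup_eq (C.le_fix (hg.mono hA) _ hq)]
      · exact ⟨0, zero_mem _, map_zero _⟩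
      · rintro v _ w _ ⟨q, hq, rfl⟩ ⟨r, hr, rfl⟩
        exact ⟨q + r, add_mem hq hr, map_add _ _ _⟩
    obtain ⟨q, hq, hqe⟩ := key
    refine ⟨q, ?_, C.K_le_Phi hyb (hS'.trans hA) hq, hqe⟩
    refine joinUp_le (fun a ha hay => ?_) hq
    have hay' : ¬ a ≤ y := fun h => hay (h.trans le_sup_left)
    exact (C.compat (.step_of_gen (hy.mono hA) (hA (hS' ha)) hay') (hyb.step (hA (hS' ha)))
      (sup_le_sup_right le_sup_left a) k).trans (le_joinUp (Q := fun z => Φ z k) ha hay')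

theorem K_inf_kerPart (hy : Gen (A.erase e) x y) (hey : ¬ e ≤ y)
    (hv : v ∈ K Φ A y k) (hve : X.P e v = 0) :
    v ∈ joinUp (fun z => Φ z k ⊓ X.kerPart D e) (A.erase e) y := by
  have hA := Finset.erase_subset e A
  refine C.joinUp_inf_kerPart hy subset_rfl ?_ hve
  obtain ⟨f, hf, q, hq, rfl⟩ := joinUp_eq_of_mem C.mem hv hey
  have hye := C.step_e hy hey
  have hff := C.le_fix hye _ hf
  by_cases hb : ∃ b ∈ A.erase e, ¬ b ≤ y ∧ y ⊔ b = y ⊔ e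
  · obtain ⟨b, hb, hby, heq⟩ := hb
    rwa [C.fix_sup_zero hy hey hb hby (heq ▸ le_sup_right) hff, zero_add]
  push Not at hb
  have hqj := C.K_le_joinUp (hy.mono hA) hA hq
  have h1 := C.P_joinUp_fix (hy.mono hA) C.mem hey hA hb hqj
  have h2 : f = -X.P (y ⊔ e) q := by
    rw [P_sup_eq (joinUp_fix_le_fix hqj), eq_neg_iff_add_eq_zero, ← hve, map_add, ← P_sup_eq
      (fix_le_of_le le_sup_left hff), (mem_fix.1 hff).2]
  have h3 := C.cell hye hA hf (h2 ▸ neg_mem h1)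
  refine add_mem (joinUp_le (fun a ha hay => ?_) h3) hq
  have hya : ¬ a ≤ y := fun h => hay (h.trans le_sup_left)
  exact (C.compat (.step_of_gen (hy.mono hA) (hA ha) hya) (hye.step (hA ha))
      (sup_le_sup_right le_sup_left a) k).trans (le_joinUp (Q := fun z => Φ z k) ha hya)

/-- A section killed by `P e` can be corrected above `y ⊔ e` so as to have low degree. -/
theorem exists_add_mem_U (hy : Gen (A.erase e) x y) (hey : ¬ e ≤ y)
    (hj : j + k = c - 1 + X.rk y)
    (hw : w ∈ joinUp (X.fix D) A y)
    (hp : ∀ f ∈ joinUp (fun z => Φ z k ⊓ X.kerPart D e) (A.erase e) y, X.B w f = 0) :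
    ∃ v ∈ X.fix D (y ⊔ e), w + v ∈ X.U D Φ A y j := by
  have hA := Finset.erase_subset e A
  have hye := C.step_e hy hey
  let T : K Φ A y k →ₗ[ℝ] E := (X.P e).comp (K Φ A y k).subtype
  let g : K Φ A y k →ₗ[ℝ] ℝ := (X.B w).comp (K Φ A y k).subtype
  have hker : LinearMap.ker T ≤ LinearMap.ker g := fun κ hκ =>
    hp _ (C.K_inf_kerPart hy hey κ.2 hκ)
  obtain ⟨h, hh⟩ : ∃ h : E →ₗ[ℝ] ℝ, h.comp T = g := by
    have : g ∈ LinearMap.range T.dualMap := by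
      rw [LinearMap.range_dualMap_eq_dualAnnihilator_ker, Submodule.mem_dualAnnihilator]
      exact fun κ hκ => hker hκ
    exact this
  obtain ⟨t, ht, htw⟩ := (C.ndeg_fix hye).represent h
  refine ⟨-t, neg_mem ht, C.mem_U_of_perp (hy.mono hA) (i := k) (by omega)
    (add_mem hw (neg_mem (mem_joinUp C.mem hey ht))) fun κ hκ => ?_⟩
  have h1 : h (X.P e κ) = X.B w κ := LinearMap.congr_fun hh ⟨κ, hκ⟩
  have hκf := joinUp_fix_le_fix (C.K_le_joinUp (hy.mono hA) subset_rfl hκ)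
  have h2 : X.P e κ ∈ X.fix D (y ⊔ e) := by
    rw [← P_sup_eq hκf]
    exact C.P_mem_fix hye (mem_fix.1 hκf).1
  rw [map_add, LinearMap.add_apply, ← h1, ← htw _ h2, ← X.adj,
    ← P_sup_eq (fix_le_of_le le_sup_left ht), (mem_fix.1 ht).2]
  simp

theorem exists_eq_sub [Finite L] (hy : GenS (A.erase e) x y) (hv : v ∈ Φ y j ⊓ X.kerPart D e) :
    ∃ g ∈ Φ y (j - 1), v = g - X.P e g := by
  have hA := Finset.erase_subset e A
  induction y using WellFoundedGT.induction generalizing v j with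
  | ind y ih =>
  have hyA := hy.mono hA
  by_cases hey : e ≤ y
  · refine ⟨0, zero_mem _, ?_⟩
    rw [C.fix_zero hy.gen hey (C.le_fix hyA _ hv.1)]; simp
  have low : ∀ {j v}, 2 * j ≤ c + X.rk y → v ∈ Φ y j ⊓ X.kerPart D e →
      ∃ g ∈ Φ y (j - 1), v = g - X.P e g := by
    clear hv v j
    intro j w hj hw
    obtain ⟨r, hr, q, hq, rfl⟩ := C.decomp hyA.gen (C.le_fix hyA _ hw.1)
    have hqU := C.mem_U_of_add hyA hw.1 hr hq
    have hre : X.P e r = 0 := by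
      rw [← P_sup_eq (Strat_le_fix hr), (mem_Strat.1 hr).2 e C.mem hey]
    have hqe : X.P e q = 0 := by
      simpa [hre] using (mem_kerPart.1 hw.2).2
    obtain ⟨v, hv, hqv⟩ := C.exists_add_mem_U hy.gen hey (j := j - 1) (k := c - 1 + X.rk y - j + 1)
      (by omega) hq fun f hf => by
        refine joinUp_induction hf ?_ ?_ ?_
        · intro b hb hby f hf
          obtain ⟨g, hg, rfl⟩ := ih _ (left_lt_sup.2 hby) (hy.step hb) hf
          rw [map_sub, perp_P hqe, sub_zero, ← (mem_fix.1 (C.le_fix (hyA.step (hA hb)) _ hg)).2,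
            ← X.adj]
          have := C.good b (hA hb) y hby
          exact C.dual_zero (hyA.step (hA hb)) (by omega) ((mem_U.1 hqU).2 b (hA hb) hby) hg
        · simp
        · intro v _ w _ hv hw
          rw [map_add, hv, hw, add_zero]
    obtain ⟨s, hs, hg⟩ := C.lift hyA hqv
    have hse : X.P e s = 0 := by
      rw [← P_sup_eq (Strat_le_fix hs), (mem_Strat.1 hs).2 e C.mem hey]
    have hve : X.P e v = v := by
      rw [← P_sup_eq (fix_le_of_le le_sup_left hv), (mem_fix.1 hv).2]
    have hPg : X.P e (s + (q + v)) = v := by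
      rw [map_add, map_add, hse, hqe, hve, zero_add, zero_add]
    have hsub := C.sub_mem_Phi hyA hg
    rw [hPg, sub_add_cancel] at hsub
    have hsr : s - r ∈ Φ y j := by
      have := sub_mem hsub.1 hw.1
      convert this using 1; abel
    have h0 : s - r = 0 := by
      rcases hj.lt_or_eq with h | h
      · exact C.van hyA h hsr (sub_mem hs hr)
      · exact C.mid hyA hey h hsr (sub_mem hs hr)
    refine ⟨_, hg, ?_⟩
    rw [hPg, sub_eq_zero.1 h0]; abel
  by_cases hj : 2 * j ≤ c + X.rk y
  · exact low hj hv
  let T : E →ₗ[ℝ] E := LinearMap.id - X.P e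
  have : v ∈ (Φ y (j - 1)).map T := by
    refine (C.ndeg_fix_kerPart hyA).mem_of_perp
      (mem_fix.2 ⟨hv.2, (mem_fix.1 (C.le_fix hyA _ hv.1)).2⟩) (fun t ht hts => ?_) ?_
    · have hte := (mem_kerPart.1 (mem_fix.1 ht).1).2
      have h1 : t ∈ Φ y (c - 1 + X.rk y - j + 1) := by
        refine C.dual_mem hyA (i := j - 1) (by omega) (fix_mono_left inf_le_left ht) fun g hg => ?_
        have := hts _ (Submodule.mem_map_of_mem hg)
        simpa [T, perp_P hte] using this
      obtain ⟨g, hg, rfl⟩ := low (by omega) ⟨h1, (mem_fix.1 ht).1⟩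
      rw [map_sub, perp_P (mem_kerPart.1 hv.2).2, sub_zero]
      exact C.dual_zero hyA (by omega) hv.1 hg
    · rintro _ ⟨g, hg, rfl⟩
      exact C.sub_mem_fix hyA (C.le_fix hyA _ hg)
  obtain ⟨g, hg, rfl⟩ := this
  exact ⟨g, hg, rfl⟩

end Coloop
end KLSpace

namespace KLSpace

variable {L E : Type*} [SemilatticeSup L] [AddCommGroup E] [Module ℝ E] [DecidableEq L]
variable {X : KLSpace L E} {D : Submodule ℝ E} {Φ : L → ℤ → Submodule ℝ E} {c : ℤ}
  {A S : Finset L} {x y z : L} {i j k : ℤ} {u v w s : E} {e : L}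

namespace Coloop

variable [FiniteDimensional ℝ E] [Finite L] (C : X.Coloop D Φ c A x e)
include C

omit [FiniteDimensional ℝ E] [Finite L] in
theorem Strat_kerPart_le (hy : GenS (A.erase e) x y) :
    X.Strat (X.kerPart D e) (A.erase e) y ≤ X.Strat D A y := fun v hv => by
  have hf : v ∈ X.fix D y := fix_mono_left inf_le_left (Strat_le_fix hv)
  by_cases hey : e ≤ y
  · rw [C.fix_zero hy.gen hey hf]
    exact zero_mem _
  · rw [mem_Strat] at hv
    refine mem_Strat.2 ⟨mem_fix.1 hf, fun a ha hay => ?_⟩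
    by_cases hae : a = e
    · rw [hae, P_sup_eq hf, (mem_kerPart.1 hv.1.1).2]
    · exact hv.2 a (Finset.mem_erase.2 ⟨hae, ha⟩) hay

theorem pos_kerPart (hy : GenS (A.erase e) x y) (hk : 2 * k = c + 1 + X.rk y)
    (hv : v ∈ Φ y k ⊓ X.kerPart D e) (hvs : v ∈ X.Strat (X.kerPart D e) (A.erase e) y)
    (hv0 : v ≠ 0) : 0 < sgn (c + 1 + k) * X.B v v := by
  have hA := Finset.erase_subset e A
  have hyA := hy.mono hA
  have hvS := C.Strat_kerPart_le hy hvs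
  have hey : ¬ e ≤ y := fun h => hv0 (C.fix_zero hy.gen h (Strat_le_fix hvS))
  have hye := C.step_e hy.gen hey
  have hrk := C.good e C.mem y hey
  obtain ⟨g, hg, rfl⟩ := C.exists_eq_sub hy hv
  have hgf := C.le_fix hyA _ hg
  have hp := C.P_mem_Phi hyA hg
  rw [sub_add_cancel] at hp
  obtain ⟨h, hh, j, hj, hjs, hhj⟩ := C.lower hye hp fun a ha hay => by
    have hae : a ∈ A.erase e := Finset.mem_erase.2 ⟨fun h => hay (h ▸ le_sup_right), ha⟩
    have hay' : ¬ a ≤ y := fun h => hay (h.trans le_sup_left)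
    have h1 := (mem_Strat.1 hvs).2 a hae hay'
    rw [map_sub, sub_eq_zero] at h1
    have h2 := C.proj_sup hyA ha hg
    rw [sub_add_cancel] at h2
    have h3 : X.P (y ⊔ e ⊔ a) (X.P e g) = X.P (y ⊔ a) g := by
      rw [sup_right_comm, X.P_sup, X.P_idem, ← h1]
    rw [h3]
    refine C.fix_mem (hyA.step ha) (hye.step ha) (sup_le_sup_right le_sup_left a) h2 ?_
    rw [← h3, X.P_idem]
  have hgg := C.dual_zero hyA (by omega) hg hg
  have hBp : X.B (X.P e g) (X.P e g) = X.B j j := by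
    have h1 := C.dual_zero hye (by omega) hh hh
    have h2 := C.dual_zero hye (by omega) hh hj
    rw [hhj]
    simp only [map_add, LinearMap.add_apply, X.symm j h, h1, h2]
    ring
  have hB : X.B (g - X.P e g) (g - X.P e g) = - X.B j j := by
    rw [map_sub, perp_P (by rw [map_sub, X.P_idem, sub_self]), map_sub, LinearMap.sub_apply, hgg,
      X.adj, ← hBp, X.adj, X.P_idem]
    ring
  have hsg : sgn (c + 1 + k) = - sgn (c + k) := by rw [← sgn_add_one]; congr 1; ring
  have hj0 : j ≠ 0 := fun h0 => hv0 <| by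
    rw [h0, add_zero] at hhj
    refine C.van hyA (i := k - 1) (by omega) (sub_mem hg ?_) hvS
    rw [hhj]
    exact C.compat hyA hye le_sup_left _ hh
  rw [hB, hsg, neg_mul_neg]
  exact C.pos hye (by omega) hj hjs hj0

theorem kerPart_obj :
    X.Obj (X.kerPart D e) (fun y i => Φ y i ⊓ X.kerPart D e) (c + 1) (A.erase e) x := by
  have hA := Finset.erase_subset e A
  have hle : X.kerPart D e ≤ D := inf_le_left
  refine ⟨fun a ha => C.good a (hA ha), ?_, ?_, ?_, ?_, ?_, ?_, ?_, ?_, ?_, ?_, ?_⟩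
  · intro y hy v hv
    rw [mem_kerPart] at hv ⊢
    exact ⟨C.stable (hy.mono hA) hv.1, by rw [X.P_comm, hv.2, map_zero]⟩
  · intro y hy i v hv
    exact mem_fix.2 ⟨hv.2, (mem_fix.1 (C.le_fix (hy.mono hA) _ hv.1)).2⟩
  · exact fun hy _ _ hij => inf_le_inf_right _ (C.mono (hy.mono hA) hij)
  · exact fun hy _ hi _ hv => C.bot (hy.mono hA) hi hv.1
  · exact fun hy hz hyz i => inf_le_inf_right _ (C.compat (hy.mono hA) (hz.mono hA) hyz i)
  · exact fun hy hz hyz _ _ hv h => ⟨C.fix_mem (hy.mono hA) (hz.mono hA) hyz hv.1 h, hv.2⟩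
  · intro y hy i j hij u v hu hv
    obtain ⟨g, hg, rfl⟩ := C.exists_eq_sub hy hv
    rw [map_sub, perp_P (mem_kerPart.1 hu.2).2, sub_zero]
    exact C.dual_zero (hy.mono hA) (by omega) hu.1 hg
  · intro y hy i j hij v hv h
    refine ⟨C.dual_mem (hy.mono hA) (i := i - 1) (by omega) (fix_mono_left hle hv) fun g hg => ?_,
      (mem_fix.1 hv).1⟩
    have := C.sub_mem_Phi (hy.mono hA) hg
    rw [sub_add_cancel] at this
    have := h _ this
    rwa [map_sub, perp_P (mem_kerPart.1 (mem_fix.1 hv).1).2, sub_zero] at this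
  · intro y hy S hS i v hv hvj
    exact C.joinUp_inf_kerPart hy.gen hS (C.cell (hy.mono hA) (hS.trans hA) hv.1
      (joinUp_mono (fun _ _ _ => fix_mono_left hle) hvj)) (mem_kerPart.1 hv.2).2
  · intro y hy i hi v hv hvs
    have hvS := C.Strat_kerPart_le hy hvs
    by_cases hey : e ≤ y
    · exact C.fix_zero hy.gen hey (Strat_le_fix hvS)
    rcases (by omega : 2 * i < c + X.rk y ∨ 2 * i = c + X.rk y) with h | h
    · exact C.van (hy.mono hA) h hv.1 hvS
    · exact C.mid (hy.mono hA) hey h hv.1 hvS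
  · exact fun hy _ hk _ hv hvs => C.pos_kerPart hy hk hv hvs

theorem HR_of_kerPart (hR : X.HR (X.kerPart D e) (fun y i => Φ y i ⊓ X.kerPart D e) (c + 1)
    (A.erase e) x) : X.HR D Φ c A x := by
  have hA := Finset.erase_subset e A
  have H := C.kerPart_obj
  have hex := C.not_le
  have hxe := C.step_e .base hex
  have hrk := C.good e C.mem x hex
  intro i u hi hu hp
  obtain ⟨huj, hua⟩ := mem_U.1 hu
  have huf := joinUp_fix_le_fix huj
  have hpu := hua e C.mem hex
  rw [P_sup_eq huf] at hpu
  have hsg : sgn (c + (i + 1)) = sgn (c - 1 + i) := by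
    rw [← sgn_add_two_mul (c - 1 + i) 1]; congr 1; ring
  obtain ⟨p, hpdef⟩ : ∃ p, p = u - X.P e u := ⟨_, rfl⟩
  have hpe : X.P e p = 0 := by rw [hpdef, map_sub, X.P_idem, sub_self]
  have hpj : p ∈ joinUp (X.fix (X.kerPart D e)) (A.erase e) x := by
    obtain ⟨f, hf, q, hq, rfl⟩ := joinUp_eq_of_mem C.mem huj hex
    have hfe : X.P e f = f := by
      rw [← P_sup_eq (fix_le_of_le le_sup_left hf), (mem_fix.1 hf).2]
    have : p = q - X.P e q := by rw [hpdef, map_add, hfe]; abel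
    rw [this]
    refine joinUp_induction (p := fun q => q - X.P e q ∈ _) hq ?_ ?_ ?_
    · intro a ha hay v hv
      exact mem_joinUp ha hay (C.sub_mem_fix (.step_of_gen .base (hA ha) hay) hv)
    · simp
    · intro v _ w _ hv hw
      have := add_mem hv hw
      rw [map_add]
      convert this using 1; abel
  have hpU : p ∈ X.U (X.kerPart D e) (fun y i => Φ y i ⊓ X.kerPart D e) (A.erase e) x (i + 1) := by
    refine mem_U.2 ⟨hpj, fun a ha hay => ?_⟩
    have := C.sub_mem_Phi (.step_of_gen .base (hA ha) hay) (hua a (hA ha) hay)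
    rwa [X.P_comm, ← map_sub, ← hpdef] at this
  have hpperp : ∀ w ∈ X.U (X.kerPart D e) (fun y i => Φ y i ⊓ X.kerPart D e) (A.erase e) x i,
      X.B p w = 0 := by
    intro w hw
    obtain ⟨hwj', hwa⟩ := mem_U.1 hw
    have hwe : X.P e w = 0 := (mem_kerPart.1 (mem_fix.1 (joinUp_fix_le_fix hwj')).1).2
    have hwj : w ∈ joinUp (X.fix D) A x := joinUp_subset hA
      (joinUp_mono (fun _ _ _ => fix_mono_left inf_le_left) hwj')
    obtain ⟨v, hv, hwv⟩ := C.exists_add_mem_U .base hex (j := i - 1) (k := c - 1 + X.rk x - i + 1)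
      (by omega) hwj fun f hf => by
        refine joinUp_induction hf ?_ ?_ ?_
        · intro b hb hby f hf
          have hxb := GenS.step_of_gen .base hb hby
          obtain ⟨g, hg, rfl⟩ := C.exists_eq_sub hxb hf
          rw [map_sub, perp_P hwe, sub_zero, ← (mem_fix.1 (C.le_fix (hxb.mono hA) _ hg)).2,
            ← X.adj]
          have := C.good b (hA hb) x hby
          exact C.dual_zero (hxb.mono hA) (by omega) (hwa b hb hby).1 hg
        · simp
        · intro v _ w _ hv hw
          rw [map_add, hv, hw, add_zero]
    have hve : X.P e v = v := by
      rw [← P_sup_eq (fix_le_of_le le_sup_left hv), (mem_fix.1 hv).2]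
    have hvP := (mem_U.1 hwv).2 e C.mem hex
    rw [P_sup_eq (joinUp_fix_le_fix (mem_U.1 hwv).1), map_add, hwe, zero_add, hve] at hvP
    have h1 := hp _ hwv
    have h2 := C.dual_zero hxe (by omega) hpu hvP
    have h3 : X.B p v = 0 := by rw [← hve, perp_P hpe]
    have h4 : X.B (X.P e u) w = 0 := by rw [X.symm, perp_P hwe]
    have h5 : u = p + X.P e u := by rw [hpdef]; abel
    rw [h5, map_add (X.B), LinearMap.add_apply, map_add, map_add, h2, h3, h4] at h1
    linarith
  have final : p ∈ K (fun y i => Φ y i ⊓ X.kerPart D e) (A.erase e) x (i + 1) →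
      ∃ κ ∈ K Φ A x i, ∃ j ∈ Φ (x ⊔ e) (i + 1), j ∈ X.Strat D A (x ⊔ e) ∧ u = κ + j := by
    intro hpK
    obtain ⟨κ, hκ, hpκ⟩ : ∃ κ ∈ K Φ A x i, p = κ - X.P e κ := by
      refine joinUp_induction (p := fun p => ∃ κ ∈ K Φ A x i, p = κ - X.P e κ) hpK ?_ ?_ ?_
      · intro a ha hay v hv
        obtain ⟨g, hg, rfl⟩ := C.exists_eq_sub (.step_of_gen .base ha hay) hv
        rw [add_sub_cancel_right] at hg
        exact ⟨g, mem_joinUp (Q := fun z => Φ z i) (hA ha) hay hg, rfl⟩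
      · exact ⟨0, zero_mem _, by simp⟩
      · rintro v _ w _ ⟨q, hq, rfl⟩ ⟨r, hr, rfl⟩
        exact ⟨q + r, add_mem hq hr, by rw [map_add]; abel⟩
    have hκU := C.K_le_U .base hκ
    have hvU := sub_mem hu hκU
    have hve : X.P e (u - κ) = u - κ := by
      have : u - κ = X.P e u - X.P e κ := by
        rw [hpdef] at hpκ
        rw [sub_eq_sub_iff_add_eq_add] at hpκ ⊢
        rw [add_comm (X.P e u), ← hpκ, add_comm]
      rw [this, map_sub, X.P_idem, X.P_idem]
    have hv1 : u - κ ∈ Φ (x ⊔ e) (i + 1) := by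
      have := (mem_U.1 hvU).2 e C.mem hex
      rwa [P_sup_eq (joinUp_fix_le_fix (mem_U.1 hvU).1), hve] at this
    obtain ⟨h, hh, j, hj, hjs, hhj⟩ := C.lower hxe hv1 fun a ha hay => by
      have hay' : ¬ a ≤ x := fun h => hay (h.trans le_sup_left)
      have h2 := (mem_U.1 hvU).2 a ha hay'
      have h3 : X.P (x ⊔ e ⊔ a) (u - κ) = X.P (x ⊔ a) (u - κ) := by
        rw [sup_right_comm, X.P_sup, hve]
      rw [h3]
      refine C.fix_mem (.step_of_gen .base ha hay') (hxe.step ha) (sup_le_sup_right le_sup_left a)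
        h2 ?_
      rw [← h3, X.P_idem]
    rw [add_sub_cancel_right] at hh
    refine ⟨κ + h, add_mem hκ (mem_joinUp (Q := fun z => Φ z i) C.mem hex hh), j, hj, hjs, ?_⟩
    rw [add_assoc, ← hhj]; abel
  have hfin : p ∈ K (fun y i => Φ y i ⊓ X.kerPart D e) (A.erase e) x (i + 1) →
      0 ≤ sgn (c - 1 + i) * X.B u u ∧ (X.B u u = 0 → u ∈ K Φ A x i) := by
    intro hpK
    obtain ⟨κ, hκ, j, hj, hjs, rfl⟩ := final hpK
    by_cases hj0 : j = 0
    · rw [hj0, add_zero] at hu ⊢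
      rw [C.K_perp_U .base (by omega) hκ hu]
      simpa using hκ
    have hi2 : 2 * (i + 1) = c + X.rk (x ⊔ e) := by
      by_contra h
      exact hj0 (C.van hxe (by omega) hj hjs)
    have hpos := C.pos hxe hi2 hj hjs hj0
    have hB : X.B (κ + j) (κ + j) = X.B j j := by
      have hjU : j ∈ X.U D Φ A x i := by simpa using sub_mem hu (C.K_le_U .base hκ)
      have h1 := C.K_perp_U .base (by omega) hκ hjU
      have h2 := C.K_perp_U .base (by omega) hκ hu
      rw [map_add (X.B _), X.symm _ κ, X.symm κ, h2, X.symm, map_add, X.symm j κ, X.symm κ,  h1]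
      ring
    rw [hB, ← hsg]
    exact ⟨hpos.le, fun h => by rw [h, mul_zero] at hpos; exact absurd hpos (lt_irrefl _)⟩
  rcases hi.lt_or_eq with hlt | heq
  · have hBu : X.B u u = X.B p p := by
      have h1 := C.dual_zero hxe (by omega) hpu hpu
      have h5 : u = p + X.P e u := by rw [hpdef]; abel
      have h6 : X.B (X.P e u) p = 0 := by rw [X.symm, perp_P hpe]
      have h7 : X.B (p + X.P e u) (p + X.P e u) = X.B p p := by
        simp only [map_add, LinearMap.add_apply, perp_P hpe, h6, h1]
        ring
      rwa [← h5] at h7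
    obtain ⟨h1, h2⟩ := hR (i + 1) p (by omega) hpU (by simpa using hpperp)
    have hsg' : sgn (c + 1 - 1 + (i + 1)) = sgn (c - 1 + i) := by
      rw [← hsg]; congr 1; ring
    rw [hsg', ← hBu] at h1
    exact ⟨h1, fun h0 => (hfin (h2 (hBu ▸ h0))).2 h0⟩
  · exact hfin (H.mem_K_of_perp .base (by omega) hpj hpperp)

end Coloop
end KLSpace

namespace KLSpace

variable {L E : Type*} [SemilatticeSup L] [AddCommGroup E] [Module ℝ E]
variable {X : KLSpace L E} {D : Submodule ℝ E} {Φ : L → ℤ → Submodule ℝ E} {c : ℤ}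
  {A A' S : Finset L} {x y z : L} {i j k : ℤ} {u v w s : E} {e : L}

theorem Obj.fix_eq_zero [FiniteDimensional ℝ E] [Finite L] (H : X.Obj D Φ c A x)
    (hz : GenS A x z)
    (hJ : ∀ w, GenS A x w → z ≤ w → ∀ {i v}, 2 * i = c + X.rk w → v ∈ Φ w i →
      v ∈ X.Strat D A w → v = 0) (hv : v ∈ X.fix D z) : v = 0 := by
  induction z using (wellFounded_gt (α := L)).induction generalizing v with
  | _ z ih =>
    have hj : ∀ u ∈ joinUp (X.fix D) A z, u = 0 := fun u hu =>
      joinUp_induction hu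
        (fun a ha hay v hv => ih _ (left_lt_sup.2 hay) (hz.step ha)
          (fun w hw hzw => hJ w hw (le_sup_left.trans hzw)) hv)
        rfl (fun v _ w _ hv hw => by rw [hv, hw, add_zero])
    obtain ⟨v₀, hv₀, v₁, hv₁, rfl⟩ := H.decomp hz.gen hv
    rw [hj v₁ hv₁, add_zero]
    obtain ⟨g, hg, j, hj1, hj2, rfl⟩ := H.strat_span hz (m := (c - 1 + X.rk z) / 2)
      (k := c - 1 + X.rk z - (c - 1 + X.rk z) / 2) (by omega) (by omega) (by omega) hv₀
    obtain ⟨hgs, u, hu, hgu⟩ := mem_Gr.1 hg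
    rw [hj u hu, add_zero] at hgu
    have hj0 : j = 0 := by
      rcases (by omega : 2 * (c - 1 + X.rk z - (c - 1 + X.rk z) / 2) < c + X.rk z ∨
        2 * (c - 1 + X.rk z - (c - 1 + X.rk z) / 2) = c + X.rk z) with h | h
      · exact H.van hz h hj1 hj2
      · exact hJ z hz le_rfl h hj1 hj2
    rw [H.van hz (by omega) hgu hgs, hj0, add_zero]

/-- The element `y` arises from a flat of the deletion of `e` by adjoining `e` as a coloop. -/
def IsCoext [DecidableEq L] (A : Finset L) (e x y : L) : Prop :=
  ∃ w, Gen (A.erase e) x w ∧ ¬ e ≤ w ∧ y = w ⊔ e ∧ ∀ b ∈ A.erase e, b ≤ y → b ≤ w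

theorem Gen.le_of_forall (h : Gen A x y) {w : L} (hxw : x ≤ w)
    (hb : ∀ b ∈ A, b ≤ y → b ≤ w) : y ≤ w := by
  induction h with
  | base => exact hxw
  | step _ ha ih =>
    exact sup_le (ih fun b hb' h => hb b hb' (h.trans le_sup_left)) (hb _ ha le_sup_right)

/-- The Hodge–Riemann relations extend from the elements above `x` to `x`. -/
theorem Obj.hr [FiniteDimensional ℝ E] [Fintype L] [DecidableEq L] (H : X.Obj D Φ c A x) :
    X.HR D Φ c A x := by
  classical
  induction hn : (A.filter fun a => ¬ a ≤ x).card using Nat.strong_induction_on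
    generalizing A x D Φ c with
  | _ n ih =>
  have ih' : ∀ {D' Φ' c' A' y}, A' ⊆ A → x ≤ y → (∃ a ∈ A, ¬ a ≤ x ∧ (a ∉ A' ∨ a ≤ y)) →
      X.Obj D' Φ' c' A' y → X.HR D' Φ' c' A' y := by
    intro D' Φ' c' A' y hA hxy ⟨a, ha, hax, h⟩ H'
    refine ih _ ?_ H' rfl
    rw [← hn]
    refine Finset.card_lt_card ⟨fun b hb => ?_, fun hs => ?_⟩
    · rw [Finset.mem_filter] at hb ⊢
      exact ⟨hA hb.1, fun h => hb.2 (h.trans hxy)⟩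
    · have := Finset.mem_filter.1 (hs (Finset.mem_filter.2 ⟨ha, hax⟩))
      exact h.elim (fun h => h this.1) this.2
  clear ih hn
  by_cases hex : ∃ e ∈ A, ¬ e ≤ x
  swap
  · push Not at hex
    intro i u _ hu _
    have : u = 0 := joinUp_induction (mem_U.1 hu).1 (fun a ha hax => absurd (hex a ha) hax) rfl
      (fun v _ w _ hv hw => by rw [hv, hw, add_zero])
    rw [this]
    simp
  obtain ⟨e, he, hex⟩ := hex
  have hA := Finset.erase_subset e A
  have ihe : ∀ {D' Φ' c'}, X.Obj D' Φ' c' (A.erase e) x → X.HR D' Φ' c' (A.erase e) x :=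
    ih' hA le_rfl ⟨e, he, hex, .inl (Finset.notMem_erase e A)⟩
  by_cases hbe : ∃ b ∈ A.erase e, ¬ b ≤ x ∧ b ≤ x ⊔ e
  · obtain ⟨b, hb, hbx, hbe⟩ := hbe
    exact H.HR_of_redundant he hex hb hbx hbe ihe
  have hb : ∀ b ∈ A.erase e, b ≤ x ⊔ e → b ≤ x := fun b hb h =>
    by_contra fun h' => hbe ⟨b, hb, h', h⟩
  obtain ⟨F, hF⟩ := H.exists_split fun y => decide (IsCoext A e x y)
  refine hF.toIsSplit.HR H fun k => ?_
  have HF := hF.toIsSplit.obj H k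
  have hS : ∀ y, X.Strat (F k) A y ≤ X.Strat D A y := fun _ => Strat_mono_left (hF.le k)
  cases k with
  | false =>
    have hs : ∀ {y}, GenS A x y → X.HR (F false) (fun y i => Φ y i ⊓ F false) c A y := fun hy => by
      obtain ⟨a, ha, hax, hay⟩ := hy.1.exists_step hy.2
      exact ih' subset_rfl hy.lt.le ⟨a, ha, hax, .inr hay⟩ (HF.restrict hy.gen)
    refine HF.HR_of_deletion he .base hex hb (hs (.step_of_gen .base he hex)) ?_
    refine ihe (HF.deletion he ?_ hs fun hy => ?_)
    · intro y hy hey hby j v hj hv hvs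
      refine hF.mid (hy.step he) (Finset.mem_univ _) (k := false) ?_ hj hv.1 (hS _ hvs) hv.2
      have : IsCoext A e x (y ⊔ e) := ⟨y, hy.gen.of_not_le hey, hey, rfl, hby⟩
      simp [this]
    · exact ih' hA hy.lt.le ⟨e, he, hex, .inl (Finset.notMem_erase e A)⟩
  | true =>
    have hmid : ∀ {y}, GenS A x y → ¬ IsCoext A e x y → ∀ {i v}, 2 * i = c + X.rk y →
        v ∈ Φ y i ⊓ F true → v ∈ X.Strat (F true) A y → v = 0 := by
      intro y hy hct i v hi hv hvs
      exact hF.mid hy (Finset.mem_univ _) (k := true) (by simp [hct]) hi hv.1 (hS _ hvs) hv.2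
    have hle : ∀ {y w w'}, Gen (A.erase e) x y → y ≤ w → Gen (A.erase e) x w' →
        (∀ b ∈ A.erase e, b ≤ w → b ≤ w') → y ≤ w' := fun hy hyw hw' h =>
      hy.le_of_forall hw'.le fun b hb hby => h b hb (hby.trans hyw)
    have C : X.Coloop (F true) (fun y i => Φ y i ⊓ F true) c A x e := by
      refine ⟨HF, he, hex, ?_, ?_, ?_⟩
      · exact fun hy hey => hmid hy fun ⟨w, _, _, h, _⟩ => hey (h ▸ le_sup_right)
      · intro y hy hey v hv
        refine HF.fix_eq_zero (z := y) ⟨hy.mono hA, fun h => hex (h ▸ hey)⟩ (fun w hw hyw => ?_) hv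
        exact hmid hw fun ⟨w', hw', hew, _, h⟩ => hew (hey.trans (hle hy hyw hw' h))
      · intro y hy hey b hb hby hbe v hv
        have hbA := hA hb
        refine HF.fix_eq_zero (z := y ⊔ e) (.step_of_gen (hy.mono hA) he hey)
          (fun w hw hyw => ?_) hv
        refine hmid hw fun ⟨w', hw', hew, _, h⟩ => hew ?_
        have h1 := HF.sup_eq_sup he hbA hey hby hbe
        have h2 : e ≤ y ⊔ b := h1 ▸ le_sup_right
        exact h2.trans (sup_le (hle hy (le_sup_left.trans hyw) hw' h) (h b hb (hbe.trans hyw)))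
    exact C.HR_of_kerPart (ihe C.kerPart_obj)

end KLSpace

namespace KLSpace

variable {L E : Type*} [SemilatticeSup L] [AddCommGroup E] [Module ℝ E]
variable {X : KLSpace L E} {Φ : L → ℤ → Submodule ℝ E} {c : ℤ}
  {A A' S T : Finset L} {x y z : L} {i j k : ℤ} {u v w s : E} {e : L}

/-- Filtrations over the upper set `T` that satisfy the axioms of an object and are minimal,
in the sense that only the stratum at `z` has a middle part. -/
structure Built (X : KLSpace L E) (Φ : L → ℤ → Submodule ℝ E) (A : Finset L) (z : L)
    (T : Finset L) : Prop where
  good : ∀ a ∈ A, ∀ y, ¬ a ≤ y → X.rk (y ⊔ a) = X.rk y + 1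
  upper : ∀ {y w}, y ≤ w → y ∈ T → w ∈ T
  le_fix : ∀ {y}, y ∈ T → ∀ i, Φ y i ≤ X.fix ⊤ y
  mono : ∀ {y}, y ∈ T → ∀ {i j}, i ≤ j → Φ y i ≤ Φ y j
  bot : ∀ {y}, y ∈ T → ∀ {i}, i < X.rk y → ∀ {v}, v ∈ Φ y i → v = 0
  compat : ∀ {y w}, y ∈ T → y ≤ w → ∀ i, Φ w i ≤ Φ y i
  fix_mem : ∀ {y w}, y ∈ T → y ≤ w → ∀ {i v}, v ∈ Φ y i → X.P w v = v → v ∈ Φ w i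
  dual_zero : ∀ {y}, y ∈ T → ∀ {i j}, i + j ≤ X.rk z - 1 + X.rk y → ∀ {u v}, u ∈ Φ y i →
    v ∈ Φ y j → X.B u v = 0
  dual_mem : ∀ {y}, y ∈ T → ∀ {i j}, i + j = X.rk z - 1 + X.rk y → ∀ {v}, v ∈ X.fix ⊤ y →
    (∀ u ∈ Φ y i, X.B v u = 0) → v ∈ Φ y j
  cell : ∀ {y}, y ∈ T → ∀ {S}, S ⊆ A → ∀ {i v}, v ∈ Φ y i → v ∈ joinUp (X.fix ⊤) S y →
    v ∈ K Φ S y i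
  mid : ∀ {y}, y ∈ T → y ≠ z → ∀ {i}, 2 * i ≤ X.rk z + X.rk y → ∀ {v}, v ∈ Φ y i →
    v ∈ X.Strat ⊤ A y → v = 0
  mem : z ∈ T
  pos : ∀ {v}, v ∈ X.fix ⊤ z → v ≠ 0 → 0 < X.B v v
  finrank : Module.finrank ℝ (X.fix ⊤ z) = 1
  fix_bot : ∀ {y}, y ∈ T → ¬ y ≤ z → ∀ {v}, v ∈ X.fix ⊤ y → v = 0

theorem Built.obj (I : X.Built Φ A z T) (h : ∀ y, x < y → y ∈ T) :
    X.Obj ⊤ Φ (X.rk z) A x where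
  good := I.good
  stable _ _ _ := Submodule.mem_top
  le_fix hy := I.le_fix (h _ hy.lt)
  mono hy := I.mono (h _ hy.lt)
  bot hy := I.bot (h _ hy.lt)
  compat hy _ := I.compat (h _ hy.lt)
  fix_mem hy _ := I.fix_mem (h _ hy.lt)
  dual_zero hy := I.dual_zero (h _ hy.lt)
  dual_mem hy := I.dual_mem (h _ hy.lt)
  cell hy := I.cell (h _ hy.lt)
  van {y} hy i hi v hv hvs := by
    by_cases hyz : y = z
    · subst hyz
      exact I.bot (h _ hy.lt) (by omega) hv
    · exact I.mid (h _ hy.lt) hyz hi.le hv hvs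
  pos {y} hy i hi v hv hvs hv0 := by
    by_cases hyz : y = z
    · subst hyz
      have := sgn_add_two_mul 0 i
      rw [zero_add, show sgn 0 = 1 from zpow_zero _] at this
      have hi' : X.rk y + i = 2 * i := by omega
      rw [hi', this, one_mul]
      exact I.pos (Strat_le_fix hvs) hv0
    · exact absurd (I.mid (h _ hy.lt) hyz hi.le hv hvs) hv0

theorem U_mono (H : X.Obj ⊤ Φ c A x) (hij : i ≤ j) : X.U ⊤ Φ A x i ≤ X.U ⊤ Φ A x j :=
  fun v hv => mem_U.2 ⟨(mem_U.1 hv).1, fun a ha hax =>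
    H.mono (.step_of_gen .base ha hax) (by omega) ((mem_U.1 hv).2 a ha hax)⟩

section ext

open scoped Classical in
/-- The space `X` enlarged by a subspace `C`, with its form negated, placed at `x`. -/
noncomputable def ext (X : KLSpace L E) (x : L) (C : Submodule ℝ E) : KLSpace L (E × C) where
  rk := X.rk
  rk_strictMono := X.rk_strictMono
  B := LinearMap.mk₂ ℝ (fun u v => X.B u.1 v.1 - X.B u.2 v.2)
    (fun u v w => by simp; ring) (fun a u v => by simp; ring)
    (fun u v w => by simp; ring) (fun a u v => by simp; ring)
  symm u v := by simp [X.symm u.1, X.symm (u.2 : E)]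
  P y := (X.P y).prodMap (if y ≤ x then LinearMap.id else 0)
  P_sup y z v := by
    by_cases hy : y ≤ x <;> by_cases hz : z ≤ x <;> simp [hy, hz, X.P_sup]
  adj y u v := by
    by_cases hy : y ≤ x <;> simp [hy, X.adj]

variable {C : Submodule ℝ E}

theorem ext_B (u v : E × C) : (X.ext x C).B u v = X.B u.1 v.1 - X.B u.2 v.2 := rfl

theorem ext_P_of_le (h : y ≤ x) (v : E × C) : (X.ext x C).P y v = (X.P y v.1, v.2) := by
  simp [ext, h]

theorem ext_P_of_not_le (h : ¬ y ≤ x) (v : E × C) : (X.ext x C).P y v = (X.P y v.1, 0) := by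
  simp [ext, h]

theorem ext_P_inl (y : L) (v : E) :
    (X.ext x C).P y (LinearMap.inl ℝ E C v) = LinearMap.inl ℝ E C (X.P y v) := by
  by_cases h : y ≤ x
  · rw [ext_P_of_le h]; rfl
  · rw [ext_P_of_not_le h]; rfl

theorem ext_B_inl (u v : E) :
    (X.ext x C).B (LinearMap.inl ℝ E C u) (LinearMap.inl ℝ E C v) = X.B u v := by
  simp [ext_B]

theorem mem_ext_fix_of_le (h : y ≤ x) {v : E × C} :
    v ∈ (X.ext x C).fix ⊤ y ↔ v.1 ∈ X.fix ⊤ y := by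
  simp [mem_fix, ext_P_of_le h, Prod.ext_iff]

theorem ext_fix (h : ¬ y ≤ x) :
    (X.ext x C).fix ⊤ y = (X.fix ⊤ y).map (LinearMap.inl ℝ E C) := by
  ext ⟨u, v⟩
  simp [mem_fix, ext_P_of_not_le h, Prod.ext_iff, eq_comm]

theorem inl_mem_map {N : Submodule ℝ E} :
    LinearMap.inl ℝ E C v ∈ N.map (LinearMap.inl ℝ E C) ↔ v ∈ N :=
  LinearMap.inl_injective.mem_set_image

theorem joinUp_map {E' : Type*} [AddCommGroup E'] [Module ℝ E'] {Q : L → Submodule ℝ E}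
    (f : E →ₗ[ℝ] E') :
    joinUp (fun y => (Q y).map f) S y = (joinUp Q S y).map f := by
  simp [joinUp, Submodule.map_iSup]

theorem ext_joinUp_fix (h : ∀ w, y < w → ¬ w ≤ x) :
    joinUp ((X.ext x C).fix ⊤) S y = (joinUp (X.fix ⊤) S y).map (LinearMap.inl ℝ E C) := by
  rw [← joinUp_map]
  have h' : ∀ a, ¬ a ≤ y → ¬ y ⊔ a ≤ x := fun a hay => h _ (left_lt_sup.2 hay)
  exact le_antisymm (joinUp_mono fun a _ hay => (ext_fix (h' a hay)).le)
    (joinUp_mono fun a _ hay => (ext_fix (h' a hay)).ge)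

theorem Built.ext (I : X.Built Φ A z T) (hx : x ∉ T) (C : Submodule ℝ E) :
    (X.ext x C).Built (fun y i => (Φ y i).map (LinearMap.inl ℝ E C)) A z T := by
  have hT : ∀ {y}, y ∈ T → ¬ y ≤ x := fun hy h => hx (I.upper h hy)
  have hT' : ∀ {y}, y ∈ T → ∀ w, y < w → ¬ w ≤ x := fun hy w hyw h => hT hy (hyw.le.trans h)
  have hinj : Function.Injective (LinearMap.inl ℝ E C) := LinearMap.inl_injective
  refine ⟨I.good, I.upper, ?_, ?_, ?_, ?_, ?_, ?_, ?_, ?_, ?_, I.mem, ?_, ?_, ?_⟩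
  · intro y hy i
    rw [ext_fix (hT hy)]
    exact Submodule.map_mono (I.le_fix hy i)
  · exact fun hy _ _ hij => Submodule.map_mono (I.mono hy hij)
  · rintro y hy i hi _ ⟨v, hv, rfl⟩
    rw [I.bot hy hi hv, map_zero]
  · exact fun hy hyw i => Submodule.map_mono (I.compat hy hyw i)
  · rintro y w hy hyw i _ ⟨v, hv, rfl⟩ h
    rw [ext_P_inl] at h
    exact Submodule.mem_map_of_mem (I.fix_mem hy hyw hv (hinj h))
  · rintro y hy i j hij _ _ ⟨u, hu, rfl⟩ ⟨v, hv, rfl⟩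
    rw [ext_B_inl]
    exact I.dual_zero hy hij hu hv
  · intro y hy i j hij v hv h
    rw [ext_fix (hT hy)] at hv
    obtain ⟨v, hv, rfl⟩ := hv
    refine Submodule.mem_map_of_mem (I.dual_mem hy hij hv fun u hu => ?_)
    rw [← ext_B_inl (x := x) (C := C)]
    exact h _ (Submodule.mem_map_of_mem hu)
  · rintro y hy S hS i _ ⟨v, hv, rfl⟩ h
    rw [ext_joinUp_fix (hT' hy), inl_mem_map] at h
    rw [K, joinUp_map]
    exact Submodule.mem_map_of_mem (I.cell hy hS hv h)
  · rintro y hy hyz i hi _ ⟨v, hv, rfl⟩ h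
    rw [I.mid hy hyz hi hv, map_zero]
    refine mem_Strat.2 ⟨⟨trivial, (mem_fix.1 (I.le_fix hy _ hv)).2⟩, fun a ha hay => ?_⟩
    have := (mem_Strat.1 h).2 a ha hay
    rw [ext_P_inl] at this
    exact hinj (this.trans (map_zero _).symm)
  · intro v hv hv0
    rw [ext_fix (hT I.mem)] at hv
    obtain ⟨v, hv, rfl⟩ := hv
    rw [ext_B_inl]
    exact I.pos hv fun h => hv0 (by rw [h, map_zero])
  · rw [ext_fix (hT I.mem), ← (Submodule.equivMapOfInjective _ hinj _).finrank_eq, I.finrank]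
  · intro y hy hyz v hv
    rw [ext_fix (hT hy)] at hv
    obtain ⟨v, hv, rfl⟩ := hv
    rw [I.fix_bot hy hyz hv, map_zero]

end ext

/-- Adjoining to a family over `T` a filtration at an element `x` lying just below `T`. -/
theorem Built.adjoin [DecidableEq L] (I : X.Built Φ A z T) (hx : x ∉ T)
    (hT : ∀ y, x < y → y ∈ T) (hxz : x < z) {Ψ : ℤ → Submodule ℝ E}
    (le_fix : ∀ i, Ψ i ≤ X.fix ⊤ x) (mono : ∀ {i j}, i ≤ j → Ψ i ≤ Ψ j)
    (bot : ∀ {i}, i < X.rk x → ∀ {v}, v ∈ Ψ i → v = 0)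
    (compat : ∀ {w}, x < w → ∀ i, Φ w i ≤ Ψ i)
    (fix_mem : ∀ {w}, x < w → ∀ {i v}, v ∈ Ψ i → X.P w v = v → v ∈ Φ w i)
    (dual_zero : ∀ {i j}, i + j ≤ X.rk z - 1 + X.rk x → ∀ {u v}, u ∈ Ψ i → v ∈ Ψ j → X.B u v = 0)
    (dual_mem : ∀ {i j}, i + j = X.rk z - 1 + X.rk x → ∀ {v}, v ∈ X.fix ⊤ x →
      (∀ u ∈ Ψ i, X.B v u = 0) → v ∈ Ψ j)
    (cell : ∀ {S}, S ⊆ A → ∀ {i v}, v ∈ Ψ i → v ∈ joinUp (X.fix ⊤) S x → v ∈ K Φ S x i)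
    (mid : ∀ {i}, 2 * i ≤ X.rk z + X.rk x → ∀ {v}, v ∈ Ψ i → v ∈ X.Strat ⊤ A x → v = 0) :
    X.Built (Function.update Φ x Ψ) A z (insert x T) := by
  have hup : ∀ {y}, y ≠ x → Function.update Φ x Ψ y = Φ y := fun h => Function.update_of_ne h _ _
  have hxx : Function.update Φ x Ψ x = Ψ := Function.update_self _ _ _
  have hne : ∀ {y}, y ∈ T → y ≠ x := fun hy h => hx (h ▸ hy)
  have hK : ∀ {S y i}, (∀ w, y < w → w ∈ T) → K (Function.update Φ x Ψ) S y i = K Φ S y i := by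
    intro S y i h
    have : ∀ a, ¬ a ≤ y → Function.update Φ x Ψ (y ⊔ a) = Φ (y ⊔ a) := fun a hay =>
      hup (hne (h _ (left_lt_sup.2 hay)))
    exact le_antisymm (joinUp_mono fun a _ hay => by rw [this a hay])
      (joinUp_mono fun a _ hay => by rw [this a hay])
  have key : ∀ {p : L → (ℤ → Submodule ℝ E) → Prop}, p x Ψ → (∀ y ∈ T, p y (Φ y)) →
      ∀ {y}, y ∈ insert x T → p y (Function.update Φ x Ψ y) := by
    intro p h1 h2 y hy
    rcases Finset.mem_insert.1 hy with rfl | hy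
    · rwa [hxx]
    · rw [hup (hne hy)]
      exact h2 y hy
  refine ⟨I.good, ?_, ?_, ?_, ?_, ?_, ?_, ?_, ?_, ?_, ?_, ?_, I.pos, I.finrank, ?_⟩
  · intro y w hyw hy
    rcases Finset.mem_insert.1 hy with rfl | hy
    · rcases hyw.eq_or_lt with rfl | h
      · exact hy
      · exact Finset.mem_insert_of_mem (hT _ h)
    · exact Finset.mem_insert_of_mem (I.upper hyw hy)
  · exact key (p := fun y Q => ∀ i, Q i ≤ X.fix ⊤ y) le_fix fun y hy => I.le_fix hy
  · exact key (p := fun y Q => ∀ {i j}, i ≤ j → Q i ≤ Q j) mono fun y hy => I.mono hy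
  · exact key (p := fun y Q => ∀ {i}, i < X.rk y → ∀ {v}, v ∈ Q i → v = 0) bot
      fun y hy => I.bot hy
  · intro y w hy hyw i
    rcases hyw.eq_or_lt with rfl | h
    · exact le_rfl
    refine key (p := fun y Q => y < w → ∀ i, Function.update Φ x Ψ w i ≤ Q i) ?_ ?_ hy h i
    · intro h i
      rw [hup h.ne']
      exact compat h i
    · intro y hy h i
      rw [hup (hne (I.upper h.le hy))]
      exact I.compat hy h.le i
  · intro y w hy hyw i v hv
    rcases hyw.eq_or_lt with rfl | h
    · exact fun _ => hv
    refine key (p := fun y Q => y < w → v ∈ Q i → X.P w v = v → v ∈ Function.update Φ x Ψ w i)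
      ?_ ?_ hy h hv
    · intro h hv
      rw [hup h.ne']
      exact fix_mem h hv
    · intro y hy h hv
      rw [hup (hne (I.upper h.le hy))]
      exact I.fix_mem hy h.le hv
  · exact key (p := fun y Q => ∀ {i j}, i + j ≤ X.rk z - 1 + X.rk y → ∀ {u v}, u ∈ Q i →
      v ∈ Q j → X.B u v = 0) dual_zero fun y hy => I.dual_zero hy
  · exact key (p := fun y Q => ∀ {i j}, i + j = X.rk z - 1 + X.rk y → ∀ {v}, v ∈ X.fix ⊤ y →
      (∀ u ∈ Q i, X.B v u = 0) → v ∈ Q j) dual_mem fun y hy => I.dual_mem hy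
  · refine key (p := fun y Q => ∀ {S}, S ⊆ A → ∀ {i v}, v ∈ Q i → v ∈ joinUp (X.fix ⊤) S y →
      v ∈ K (Function.update Φ x Ψ) S y i) ?_ fun y hy => ?_
    · intro S hS i
      rw [hK hT]
      exact cell hS
    · intro S hS i
      rw [hK fun w hw => I.upper hw.le hy]
      exact I.cell hy hS
  · exact key (p := fun y Q => y ≠ z → ∀ {i}, 2 * i ≤ X.rk z + X.rk y → ∀ {v}, v ∈ Q i →
      v ∈ X.Strat ⊤ A y → v = 0) (fun _ => mid) fun y hy => I.mid hy
  · exact Finset.mem_insert_of_mem I.mem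
  · intro y hy hyz
    rcases Finset.mem_insert.1 hy with rfl | hy
    · exact absurd hxz.le hyz
    · exact I.fix_bot hy hyz

end KLSpace

namespace KLSpace

variable {L E : Type*} [SemilatticeSup L] [AddCommGroup E] [Module ℝ E]
variable {X : KLSpace L E} {Φ : L → ℤ → Submodule ℝ E} {c : ℤ}
  {A A' S T : Finset L} {x y z : L} {i j k m : ℤ} {u v w s : E} {e : L}

section extension

variable (H : X.Obj ⊤ Φ c A x) (hR : X.HR ⊤ Φ c A x)
include H

theorem exists_compl_K [FiniteDimensional ℝ E] :
    ∃ C ≤ X.U ⊤ Φ A x m, (∀ u ∈ X.U ⊤ Φ A x m, ∃ k ∈ K Φ A x m, ∃ v ∈ C, u = k + v) ∧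
      ∀ v ∈ C, v ∈ K Φ A x m → v = 0 := by
  obtain ⟨C, hC⟩ := (K Φ A x m).exists_isCompl
  refine ⟨C ⊓ X.U ⊤ Φ A x m, inf_le_right, fun u hu => ?_, fun v hv hk =>
    Submodule.disjoint_def.1 hC.disjoint v hk hv.1⟩
  obtain ⟨k, hk, v, hv, rfl⟩ := Submodule.mem_sup.1 (hC.codisjoint.eq_top ▸ Submodule.mem_top :
    u ∈ K Φ A x m ⊔ C)
  refine ⟨k, hk, v, ⟨hv, ?_⟩, rfl⟩
  simpa using sub_mem hu (H.K_le_U .base hk)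

include hR

theorem mem_K_of_mem_U [FiniteDimensional ℝ E] (hm : 2 * m ≤ c - 1 + X.rk x) (hi : i ≤ m)
    (hu : u ∈ X.U ⊤ Φ A x i) (hk : u ∈ K Φ A x m) : u ∈ K Φ A x i := by
  have h : ∀ w ∈ X.U ⊤ Φ A x m, X.B u w = 0 := fun w hw => by
    rw [X.symm]
    exact H.K_perp_U .base (by omega) hk hw
  exact (hR i u (by omega) hu fun w hw => h w (U_mono H (by omega) hw)).2 (h u (U_mono H hi hu))

theorem ndeg_compl_K (hm : 2 * m ≤ c - 1 + X.rk x) {C : Submodule ℝ E}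
    (hC : C ≤ X.U ⊤ Φ A x m)
    (hdec : ∀ u ∈ X.U ⊤ Φ A x m, ∃ k ∈ K Φ A x m, ∃ v ∈ C, u = k + v)
    (hdis : ∀ v ∈ C, v ∈ K Φ A x m → v = 0) : X.NDeg C := fun v hv h => by
  have h : ∀ w ∈ X.U ⊤ Φ A x m, X.B v w = 0 := fun w hw => by
    obtain ⟨k, hk, f, hf, rfl⟩ := hdec w hw
    rw [map_add, h f hf, H.K_perp_U .base (by omega) hk (hC hv), add_zero]
  exact hdis v hv ((hR m v hm (hC hv) fun w hw => h w (U_mono H (by omega) hw)).2 (h v (hC hv)))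

end extension

theorem Built.exists_insert [FiniteDimensional ℝ E] [Fintype L] [DecidableEq L]
    (I : X.Built Φ A z T) (hx : x ∉ T) (hT : ∀ y, x < y → y ∈ T) (hxz : x < z)
    (hgen : ∀ x y, x ≤ y → Gen A x y)
    (hfull : X.fix ⊤ x ≤ joinUp (X.fix ⊤) A x) :
    ∃ (C : Submodule ℝ E) (Φ' : L → ℤ → Submodule ℝ (E × C)),
      (X.ext x C).Built Φ' A z (insert x T) := by
  have H := I.obj hT
  have hR := H.hr
  have hnd : X.NDeg (X.fix ⊤ x) := by
    rw [le_antisymm hfull joinUp_fix_le_fix]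
    exact H.ndeg_joinUp .base subset_rfl
  have hrk := X.rk_strictMono hxz
  have hΦK : ∀ {w}, x < w → ∀ i, Φ w i ≤ K Φ A x i := fun {w} hw i => by
    obtain ⟨a, ha, hax, haw⟩ := (hgen _ _ hw.le).exists_step hw.ne
    exact (I.compat (hT _ (left_lt_sup.2 hax)) (sup_le hw.le haw) i).trans
      (le_joinUp (Q := fun z => Φ z i) ha hax)
  obtain ⟨n, hn⟩ : ∃ n, n = X.rk z - 1 + X.rk x := ⟨_, rfl⟩
  obtain ⟨m, hm1, hm2⟩ : ∃ m, 2 * m ≤ n ∧ n ≤ 2 * m + 1 := ⟨n / 2, by omega, by omega⟩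
  obtain ⟨C, hC, hdec, hdis⟩ := exists_compl_K H (m := m)
  have hCnd := ndeg_compl_K H hR (by omega) hC hdec hdis
  have hKU := fun {i} => H.K_le_U .base (i := i)
  have hUJ : ∀ i, X.U ⊤ Φ A x i ≤ X.fix ⊤ x := fun i v hv => joinUp_fix_le_fix (mem_U.1 hv).1
  have hUm := fun {i j} => U_mono H (i := i) (j := j)
  let Γ : ℤ → Submodule ℝ (E × C) := fun i =>
    (X.U ⊤ Φ A x i).comap (LinearMap.fst ℝ E C) ⊓
      (K Φ A x m).comap (LinearMap.fst ℝ E C - C.subtype ∘ₗ LinearMap.snd ℝ E C)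
  have hΓ : ∀ {i} {v : E × C}, v ∈ Γ i ↔ v.1 ∈ X.U ⊤ Φ A x i ∧ v.1 - v.2 ∈ K Φ A x m :=
    Iff.rfl
  obtain ⟨Ψ, hΨ1, hΨ2⟩ : ∃ Ψ : ℤ → Submodule ℝ (E × C), (∀ {i}, i ≤ m → Ψ i = Γ i) ∧
      ∀ {i}, m < i → ∀ {v : E × C}, v ∈ Ψ i ↔
        v.1 ∈ X.fix ⊤ x ∧ ∀ w ∈ Γ (n - i), (X.ext x C).B v w = 0 := by
    refine ⟨fun i => if i ≤ m then Γ i else (X.fix ⊤ x).comap (LinearMap.fst ℝ E C) ⊓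
      (X.ext x C).B.orthogonal (Γ (n - i)), fun hi => if_pos hi, fun hi v => ?_⟩
    simp only [if_neg (not_le.2 hi), Submodule.mem_inf, Submodule.mem_comap,
      LinearMap.fst_apply, LinearMap.BilinForm.mem_orthogonal_iff]
    refine and_congr_right fun _ => forall₂_congr fun w _ => ?_
    rw [(X.ext x C).symm]
  have hΓmono : ∀ {i j}, i ≤ j → Γ i ≤ Γ j := fun hij v hv => ⟨hUm hij hv.1, hv.2⟩
  have hiso : ∀ {v w}, v ∈ Γ m → w ∈ Γ m → (X.ext x C).B v w = 0 := by
    intro v w hv hw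
    rw [hΓ] at hv hw
    have h1 := H.K_perp_U .base (by omega) hw.2 hv.1
    have h2 := H.K_perp_U .base (by omega) hv.2 (hC w.2.2)
    rw [ext_B]
    rw [map_sub] at h1
    rw [map_sub, X.symm, X.symm w.2] at h2
    linarith
  have hΓex : ∀ {i}, i ≤ m → ∀ {u}, u ∈ X.U ⊤ Φ A x i → ∃ v : C, (u, v) ∈ Γ i := by
    intro i hi u hu
    obtain ⟨k, hk, v, hv, rfl⟩ := hdec u (hUm hi hu)
    exact ⟨⟨v, hv⟩, hu, by simpa using hk⟩
  have hΓC : ∀ v : C, ((v : E), v) ∈ Γ m := fun v => ⟨hC v.2, by simp⟩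
  have hCz : ∀ v : C, (∀ w ∈ Γ m, (X.ext x C).B (0, v) w = 0) → v = 0 := fun v h => by
    refine Subtype.ext (hCnd v v.2 fun w hw => ?_)
    have := h _ (hΓC ⟨w, hw⟩)
    simpa [ext_B] using this
  have hndJ : (X.ext x C).NDeg ((X.ext x C).fix ⊤ x) := by
    rintro ⟨u, v⟩ hu h
    rw [mem_ext_fix_of_le le_rfl] at hu
    have h1 : u = 0 := hnd u hu fun w hw => by
      have := h (w, 0) ((mem_ext_fix_of_le le_rfl).2 hw)
      simpa [ext_B] using this
    have h2 : v = 0 := Subtype.ext <| hCnd v v.2 fun w hw => by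
      have := h (0, ⟨w, hw⟩) ((mem_ext_fix_of_le le_rfl).2 (zero_mem _))
      simpa [ext_B] using this
    rw [h1, h2]; rfl
  have hΓJ : ∀ i, Γ i ≤ (X.ext x C).fix ⊤ x := fun i v hv =>
    (mem_ext_fix_of_le le_rfl).2 (hUJ i hv.1)
  have hK : ∀ {i u}, (u, (0 : C)) ∈ Ψ i → u ∈ K Φ A x i := by
    intro i u hu
    rcases le_or_gt i m with hi | hi
    · rw [hΨ1 hi, hΓ] at hu
      exact mem_K_of_mem_U H hR (by omega) hi hu.1 (by simpa using hu.2)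
    · rw [hΨ2 hi] at hu
      refine H.mem_K_of_perp .base (i := n - i) (by omega) (hfull hu.1) fun w hw => ?_
      obtain ⟨v, hv⟩ := hΓex (by omega) hw
      simpa [ext_B] using hu.2 _ hv
  have hiso' : ∀ {i j}, i + j ≤ n → j ≤ i → ∀ {u v}, u ∈ Ψ i → v ∈ Ψ j →
      (X.ext x C).B u v = 0 := by
    intro i j hij hji u v hu hv
    rw [hΨ1 (by omega)] at hv
    rcases le_or_gt i m with hi | hi
    · rw [hΨ1 hi] at hu
      exact hiso (hΓmono hi hu) (hΓmono (by omega) hv)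
    · exact ((hΨ2 hi).1 hu).2 v (hΓmono (by omega) hv)
  have hzx : ∀ {w}, x < w → ¬ w ≤ x := fun h => h.not_ge
  have hzero : ∀ {i v}, v ∈ Ψ i → v ∈ (X.ext x C).Strat ⊤ A x → v.1 = 0 := by
    intro i v hv hvs
    have h1 : v.1 ∈ X.fix ⊤ x := (mem_ext_fix_of_le le_rfl).1 (Strat_le_fix hvs)
    refine H.joinUp_fix_zero .base subset_rfl (hfull h1) fun a ha hax => ?_
    have := (mem_Strat.1 hvs).2 a ha hax
    rw [ext_P_of_not_le (hzx (left_lt_sup.2 hax))] at this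
    exact congrArg Prod.fst this
  refine ⟨C, _, (I.ext hx C).adjoin hx hT hxz (Ψ := Ψ) ?_ ?_ ?_ ?_ ?_ ?_ ?_ ?_ ?_⟩
  · intro i v hv
    rcases le_or_gt i m with hi | hi
    · rw [hΨ1 hi] at hv
      exact hΓJ i hv
    · exact (mem_ext_fix_of_le le_rfl).2 ((hΨ2 hi).1 hv).1
  · intro i j hij v hv
    rcases le_or_gt i m with hi | hi <;> rcases le_or_gt j m with hj | hj
    · rw [hΨ1 hi] at hv
      rw [hΨ1 hj]
      exact hΓmono hij hv
    · rw [hΨ1 hi] at hv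
      exact (hΨ2 hj).2 ⟨hUJ i hv.1, fun w hw => hiso (hΓmono hi hv) (hΓmono (by omega) hw)⟩
    · omega
    · rw [hΨ2 hi] at hv
      exact (hΨ2 hj).2 ⟨hv.1, fun w hw => hv.2 w (hΓmono (by omega) hw)⟩
  · intro i hi v hv
    have hi : i < X.rk x := hi
    rw [hΨ1 (by omega)] at hv
    have h1 : v.1 = 0 := by
      refine H.joinUp_fix_zero .base subset_rfl (mem_U.1 hv.1).1 fun a ha hax => ?_
      refine H.bot (.step_of_gen .base ha hax) (i := i + 1) ?_ ((mem_U.1 hv.1).2 a ha hax)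
      rw [H.good a ha x hax]
      omega
    have h2 := (hΓ.1 hv).2
    rw [h1, zero_sub, Submodule.neg_mem_iff] at h2
    exact Prod.ext h1 (Subtype.ext (hdis _ v.2.2 h2))
  · rintro w hw i _ ⟨v, hv, rfl⟩
    have hvK := hΦK hw i hv
    rcases le_or_gt i m with hi | hi
    · rw [hΨ1 hi]
      exact ⟨hKU hvK, by simpa using H.K_mono .base subset_rfl hi hvK⟩
    · refine (hΨ2 hi).2 ⟨hUJ i (hKU hvK), fun u hu => ?_⟩
      have := H.K_perp_U .base (by omega) hvK hu.1
      rw [X.symm] at this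
      simpa [ext_B] using this
  · rintro w hw i ⟨u, v⟩ hv h
    rw [ext_P_of_not_le (hzx hw), Prod.mk.injEq] at h
    obtain ⟨h1, rfl⟩ := h
    exact Submodule.mem_map_of_mem
      (H.K_inf_fix .base ⟨hgen _ _ hw.le, hw.ne⟩ (hK hv) h1)
  · intro i j hij u v hu hv
    have hij : i + j ≤ n := hn ▸ hij
    rcases le_total j i with h | h
    · exact hiso' hij h hu hv
    · rw [(X.ext x C).symm]
      exact hiso' (by omega) h hv hu
  · intro i j hij v hv h
    have hij : i + j = n := hn ▸ hij
    have hv1 := (mem_ext_fix_of_le le_rfl).1 hv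
    rcases le_or_gt j m with hj | hj
    · rw [hΨ1 hj]
      rcases le_or_gt i m with hi | hi
      · rw [hΨ1 hi] at h
        have him : i = m := by omega
        have hjm : j = m := by omega
        subst him
        subst hjm
        have hvU : v.1 ∈ X.U ⊤ Φ A x j := by
          refine H.mem_U_of_perp .base (i := j) (by omega) (hfull hv1) fun k hk => ?_
          have := h (k, 0) ⟨hKU hk, by simpa using hk⟩
          simpa [ext_B] using this
        obtain ⟨w, hw⟩ := hΓex le_rfl hvU
        have : v.2 - w = 0 := hCz _ fun g hg => by
          have h1 := h g hg
          have h2 := hiso hw hg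
          simp only [ext_B] at h1 h2
          simp [ext_B]
          linarith
        rw [sub_eq_zero] at this
        subst this
        exact hw
      · refine hndJ.mem_of_perp hv (fun t ht hs => h t ((hΨ2 hi).2 ⟨?_, fun w hw => ?_⟩)) (hΓJ j)
        · exact (mem_ext_fix_of_le le_rfl).1 ht
        · exact hs w (by rwa [show n - i = j by omega] at hw)
    · rw [hΨ1 (by omega)] at h
      exact (hΨ2 hj).2 ⟨hv1, fun w hw => h w (by rwa [show n - j = i by omega] at hw)⟩
  · intro S hS i v hv h
    rw [ext_joinUp_fix fun _ => hzx] at h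
    obtain ⟨u, hu, rfl⟩ := h
    rw [K, joinUp_map]
    exact Submodule.mem_map_of_mem (H.cell_open .base subset_rfl hS (hK hv) hu)
  · intro i hi v hv hvs
    have hi : 2 * i ≤ X.rk z + X.rk x := hi
    have h1 := hzero hv hvs
    refine Prod.ext h1 ?_
    rcases le_or_gt i m with hi' | hi'
    · rw [hΨ1 hi', hΓ, h1, zero_sub, Submodule.neg_mem_iff] at hv
      exact Subtype.ext (hdis _ v.2.2 hv.2)
    · refine hCz _ fun w hw => ?_
      rw [← h1]
      exact ((hΨ2 hi').1 hv).2 w (by rwa [show n - i = m by omega])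

end KLSpace

namespace KLSpace

variable {L E : Type*} [SemilatticeSup L] [AddCommGroup E] [Module ℝ E]
variable {X : KLSpace L E} {Φ : L → ℤ → Submodule ℝ E}
  {A T : Finset L} {x y z : L} {i j : ℤ} {u v w s : E}

open scoped Classical in
/-- The one-dimensional space on which `P y` is the identity exactly when `y ≤ z`. -/
noncomputable def line (rk : L → ℤ) (hrk : StrictMono rk) (z : L) : KLSpace L ℝ where
  rk := rk
  rk_strictMono := hrk
  B := LinearMap.mul ℝ ℝ
  symm u v := mul_comm u v
  P y := if y ≤ z then LinearMap.id else 0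
  P_sup x y v := by
    by_cases hx : x ≤ z <;> by_cases hy : y ≤ z <;> simp [hx, hy]
  adj y u v := by
    by_cases hy : y ≤ z <;> simp [hy]

section line

variable {rk : L → ℤ} {hrk : StrictMono rk}

theorem line_P_of_le (h : y ≤ z) (v : ℝ) : (line rk hrk z).P y v = v := by simp [line, h]

theorem line_P_of_not_le (h : ¬ y ≤ z) (v : ℝ) : (line rk hrk z).P y v = 0 := by simp [line, h]

open scoped Classical in
theorem line_built (hgood : ∀ a ∈ A, ∀ y, ¬ a ≤ y → rk (y ⊔ a) = rk y + 1)
    (hT : ∀ y, y ∈ T ↔ ¬ y < z) :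
    (line rk hrk z).Built (fun y i => if y = z ∧ rk z ≤ i then ⊤ else ⊥) A z T := by
  have hz : z ∈ T := (hT z).2 (lt_irrefl z)
  have hfix : ∀ {y}, ¬ y ≤ z → ∀ {v}, v ∈ (line rk hrk z).fix ⊤ y → v = 0 := by
    intro y hy v hv
    rw [← (mem_fix.1 hv).2, line_P_of_not_le hy]
  have hle : ∀ {y}, y ∈ T → y ≤ z → y = z := fun hy h =>
    h.eq_of_not_lt ((hT _).1 hy)
  have hmem : ∀ {y i v}, v ∈ (if y = z ∧ rk z ≤ i then ⊤ else ⊥ : Submodule ℝ ℝ) ↔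
      (y = z ∧ rk z ≤ i) ∨ v = 0 := by
    intro y i v
    by_cases h : y = z ∧ rk z ≤ i <;> simp [h]
  have hup : ∀ {y w}, y ≤ w → y ∈ T → w ∈ T := fun {y w} hyw hy =>
    (hT w).2 fun h => (hT y).1 hy (hyw.trans_lt h)
  refine ⟨hgood, hup, ?_, ?_, ?_, ?_, ?_, ?_, ?_, ?_, ?_, hz, ?_, ?_, fun _ h _ hv => hfix h hv⟩
  · intro y hy i v hv
    rcases hmem.1 hv with ⟨rfl, _⟩ | rfl
    · exact mem_fix.2 ⟨trivial, line_P_of_le le_rfl v⟩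
    · exact zero_mem _
  · intro y hy i j hij v hv
    rcases hmem.1 hv with ⟨h, h'⟩ | h
    · exact hmem.2 (.inl ⟨h, h'.trans hij⟩)
    · exact hmem.2 (.inr h)
  · intro y hy i hi v hv
    rcases hmem.1 hv with ⟨rfl, h⟩ | h
    · exact absurd hi h.not_gt
    · exact h
  · intro y w hy hyw i v hv
    rcases hmem.1 hv with ⟨rfl, h⟩ | h
    · exact hmem.2 (.inl ⟨hle hy hyw, h⟩)
    · exact hmem.2 (.inr h)
  · intro y w hy hyw i v hv hwv
    rcases hmem.1 hv with ⟨rfl, h⟩ | h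
    · by_cases hwy : w = y
      · exact hmem.2 (.inl ⟨hwy, h⟩)
      · have : ¬ w ≤ y := fun h => hwy (le_antisymm h hyw)
        rw [line_P_of_not_le this] at hwv
        exact hmem.2 (.inr hwv.symm)
    · exact hmem.2 (.inr h)
  · intro y hy i j hij u v hu hv
    have hij : i + j ≤ rk z - 1 + rk y := hij
    rcases hmem.1 hu with ⟨rfl, h⟩ | rfl
    · rcases hmem.1 hv with ⟨_, h'⟩ | rfl
      · omega
      · simp
    · simp
  · intro y hy i j hij v hv h
    have hij : i + j = rk z - 1 + rk y := hij
    refine hmem.2 ?_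
    by_cases hyz : y = z
    · subst hyz
      by_cases hi : rk y ≤ i
      · have : v * 1 = 0 := h 1 (hmem.2 (.inl ⟨rfl, hi⟩))
        exact .inr (by simpa using this)
      · exact .inl ⟨rfl, by omega⟩
    · exact .inr (hfix (fun h => hyz (hle hy h)) hv)
  · intro y hy S hS i v hv hj
    have : v = 0 := by
      rcases hmem.1 hv with ⟨rfl, h⟩ | h
      · exact joinUp_induction hj (fun a _ hay v hv => hfix (left_lt_sup.2 hay).not_ge hv) rfl
          (fun v _ w _ hv hw => by rw [hv, hw, add_zero])
      · exact h
    rw [this]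
    exact zero_mem _
  · intro y hy hyz i _ v hv _
    rcases hmem.1 hv with ⟨h, _⟩ | h
    · exact absurd h hyz
    · exact h
  · intro v _ hv0
    exact mul_self_pos.2 hv0
  · have : (line rk hrk z).fix ⊤ z = ⊤ :=
      eq_top_iff.2 fun v _ => mem_fix.2 ⟨trivial, line_P_of_le le_rfl v⟩
    rw [this, finrank_top, Module.finrank_self]

end line

/-- Families of filtrations with only the stratum at `z` in the middle degree exist. -/
theorem exists_built [Fintype L] (rk : L → ℤ) (hrk : StrictMono rk)
    (hgood : ∀ a ∈ A, ∀ y, ¬ a ≤ y → rk (y ⊔ a) = rk y + 1)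
    (hgen : ∀ x y, x ≤ y → Gen A x y) (z : L) :
    ∃ (E : Type) (_ : AddCommGroup E) (_ : Module ℝ E) (_ : FiniteDimensional ℝ E)
      (X : KLSpace L E) (Φ : L → ℤ → Submodule ℝ E), X.rk = rk ∧ X.Built Φ A z Finset.univ := by
  classical
  let p : Finset L → Prop := fun T => (∀ y, ¬ y < z → y ∈ T) ∧
    ∃ (E : Type) (_ : AddCommGroup E) (_ : Module ℝ E) (_ : FiniteDimensional ℝ E)
      (X : KLSpace L E) (Φ : L → ℤ → Submodule ℝ E), X.rk = rk ∧ X.Built Φ A z T ∧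
      ∀ y ∉ T, X.fix ⊤ y ≤ joinUp (X.fix ⊤) A y
  suffices h : p Finset.univ by
    obtain ⟨_, E, h1, h2, h3, X, Φ, h4, h5, _⟩ := h
    exact ⟨E, h1, h2, h3, X, Φ, h4, h5⟩
  refine upset_induction (p := p) (Finset.univ.filter fun y => ¬ y < z) ?_ ?_ ?_
  · intro y w hyw hy
    simp only [Finset.coe_filter, Finset.mem_univ, true_and, Set.mem_ofPred_eq] at hy ⊢
    exact fun h => hy (hyw.trans_lt h)
  · refine ⟨by simp, ℝ, inferInstance, inferInstance, inferInstance, line rk hrk z, _, rfl,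
      line_built hgood (by simp), fun y hy v hv => ?_⟩
    have hyz : y < z := by simpa using hy
    obtain ⟨a, ha, hay, haz⟩ := (hgen _ _ hyz.le).exists_step hyz.ne
    exact mem_joinUp ha hay (mem_fix.2 ⟨trivial, line_P_of_le (sup_le hyz.le haz) v⟩)
  · rintro T x _ hxT hT ⟨hz, E, _, _, _, X, Φ, hX, I, hfull⟩
    have hxz : x < z := by_contra fun h => hxT (hz x h)
    obtain ⟨C, Φ', I'⟩ := I.exists_insert hxT hT hxz hgen (hfull x hxT)
    refine ⟨fun y hy => Finset.mem_insert_of_mem (hz y hy), E × C, inferInstance, inferInstance,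
      inferInstance, X.ext x C, Φ', hX, I', ?_⟩
    rintro y hy ⟨u, c⟩ hv
    rw [Finset.mem_insert, not_or] at hy
    have key : ∀ {u}, u ∈ X.fix ⊤ y → (u, (0 : C)) ∈ joinUp ((X.ext x C).fix ⊤) A y := by
      intro u hu
      have := Submodule.mem_map_of_mem (f := LinearMap.inl ℝ E C) (hfull y hy.2 hu)
      rw [← joinUp_map] at this
      refine joinUp_mono (fun a _ _ => ?_) this
      rintro _ ⟨u, hu, rfl⟩
      exact mem_fix.2 ⟨trivial, by rw [ext_P_inl, (mem_fix.1 hu).2]⟩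
    by_cases hyx : y ≤ x
    · have hu := key ((mem_ext_fix_of_le hyx).1 hv)
      obtain ⟨a, ha, hay, hax⟩ := (hgen _ _ hyx).exists_step hy.1
      have hc : ((0 : E), c) ∈ joinUp ((X.ext x C).fix ⊤) A y :=
        mem_joinUp ha hay ((mem_ext_fix_of_le (sup_le hyx hax)).2 (zero_mem _))
      have := add_mem hu hc
      simpa using this
    · rw [ext_fix hyx] at hv
      obtain ⟨v, hv, h⟩ := hv
      rw [← h]
      exact key hv

end KLSpace

namespace KLSpace

variable {L E : Type*} [SemilatticeSup L] [AddCommGroup E] [Module ℝ E]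
variable {X : KLSpace L E} {Φ : L → ℤ → Submodule ℝ E}
  {A T : Finset L} {x y z : L} {i j : ℤ} {u v w s : E}

/-- The dimension of the image of `Φ y i` modulo the sections supported above `y`. -/
noncomputable def grDim (X : KLSpace L E) (Φ : L → ℤ → Submodule ℝ E) (A : Finset L) (y : L)
    (i : ℤ) : ℤ :=
  Module.finrank ℝ (Φ y i ⊔ joinUp (X.fix ⊤) A y : Submodule ℝ E) -
    Module.finrank ℝ (joinUp (X.fix ⊤) A y)

namespace Built

variable [Fintype L] (I : X.Built Φ A z Finset.univ)
include I

theorem ndeg_fix : X.NDeg (X.fix ⊤ y) := fun v hv h =>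
  I.bot (Finset.mem_univ y) (i := X.rk y - 1) (by omega)
    (I.dual_mem (Finset.mem_univ y) (i := X.rk z) (by omega) hv
      fun u hu => h u (I.le_fix (Finset.mem_univ y) _ hu))

theorem eq_bot (h : i < X.rk y) : Φ y i = ⊥ :=
  (Submodule.eq_bot_iff _).2 fun _ hv => I.bot (Finset.mem_univ y) h hv

theorem fix_eq_bot (h : ¬ y ≤ z) : X.fix ⊤ y = ⊥ :=
  (Submodule.eq_bot_iff _).2 fun _ hv => I.fix_bot (Finset.mem_univ y) h hv

theorem joinUp_eq_bot : joinUp (X.fix ⊤) A z = ⊥ :=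
  le_bot_iff.1 <| joinUp_le fun _ _ haz => (I.fix_eq_bot (left_lt_sup.2 haz).not_ge).le

theorem grDim_of_lt (h : i < X.rk y) : X.grDim Φ A y i = 0 := by
  rw [grDim, I.eq_bot h, bot_sup_eq, sub_self]

theorem grDim_of_not_le (h : ¬ y ≤ z) : X.grDim Φ A y i = 0 := by
  have hb : Φ y i = ⊥ := le_bot_iff.1 ((I.le_fix (Finset.mem_univ y) i).trans (I.fix_eq_bot h).le)
  rw [grDim, hb, bot_sup_eq, sub_self]

variable [FiniteDimensional ℝ E]

theorem grDim_mono (h : i ≤ j) : X.grDim Φ A y i ≤ X.grDim Φ A y j := by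
  have := Submodule.finrank_mono
    (sup_le_sup_right (I.mono (Finset.mem_univ y) h) (joinUp (X.fix ⊤) A y))
  simp only [grDim]
  omega

theorem finrank_add (h : i + j = X.rk z - 1 + X.rk y) :
    (Module.finrank ℝ (Φ y i) : ℤ) + Module.finrank ℝ (Φ y j) =
      Module.finrank ℝ (X.fix ⊤ y) := by
  have hy := Finset.mem_univ y
  let f : X.fix ⊤ y →ₗ[ℝ] Module.Dual ℝ (X.fix ⊤ y) :=
    ((X.B.domRestrict₁₂ (X.fix ⊤ y) (X.fix ⊤ y)))
  have hf : Function.Injective f := by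
    rw [← LinearMap.ker_eq_bot, LinearMap.ker_eq_bot']
    intro v hv
    exact Subtype.ext (I.ndeg_fix v.1 v.2 fun w hw => LinearMap.congr_fun hv ⟨w, hw⟩)
  let Ψ := fun k => (Φ y k).comap (X.fix ⊤ y).subtype
  have hΨ : ∀ k, Module.finrank ℝ (Ψ k) = Module.finrank ℝ (Φ y k) := fun k =>
    (Submodule.comapSubtypeEquivOfLe (I.le_fix hy k)).finrank_eq
  have hann : (Ψ j) = ((Ψ i).dualAnnihilator).comap f := by
    ext v
    simp only [Ψ, Submodule.mem_comap, Submodule.mem_dualAnnihilator, Submodule.subtype_apply]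
    constructor
    · intro hv w hw
      exact I.dual_zero hy (i := j) (j := i) (by omega) hv hw
    · intro hv
      exact I.dual_mem hy h v.2 fun u hu => hv ⟨u, I.le_fix hy _ hu⟩ hu
  have hfe : Function.Bijective f :=
    ⟨hf, (LinearMap.injective_iff_surjective_of_finrank_eq_finrank
      Subspace.dual_finrank_eq.symm).1 hf⟩
  have e := (LinearEquiv.ofBijective f hfe).finrank_map_eq (Ψ j)
  have hm : (Ψ j).map (LinearEquiv.ofBijective f hfe : _ →ₗ[ℝ] _) = (Ψ i).dualAnnihilator := by
    rw [hann]
    exact Submodule.map_comap_eq_of_surjective hfe.2 _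
  rw [hm] at e
  have := Subspace.finrank_add_finrank_dualAnnihilator_eq (Ψ i)
  rw [← hΨ i, ← hΨ j]
  omega

theorem sup_eq_fix (hyz : y ≠ z) (h : X.rk z + X.rk y - 2 ≤ 2 * i) :
    Φ y i ⊔ joinUp (X.fix ⊤) A y = X.fix ⊤ y := by
  have hy := Finset.mem_univ y
  refine le_antisymm (sup_le (I.le_fix hy i) joinUp_fix_le_fix) fun v hv => ?_
  refine I.ndeg_fix.mem_of_perp hv (fun t ht hts => ?_) (sup_le (I.le_fix hy i) joinUp_fix_le_fix)
  have ht' : t = 0 := by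
    refine I.mid hy hyz (i := X.rk z - 1 + X.rk y - i) (by omega) (I.dual_mem hy (i := i)
      (by omega) ht fun u hu => hts u (Submodule.mem_sup_left hu)) ?_
    refine mem_Strat.2 ⟨mem_fix.1 ht, fun a ha hay => ?_⟩
    refine I.ndeg_fix (y := y ⊔ a) _ (mem_fix.2 ⟨trivial, X.P_idem _ _⟩) fun w hw => ?_
    rw [X.adj, (mem_fix.1 hw).2]
    exact hts w (Submodule.mem_sup_right (mem_joinUp ha hay hw))
  rw [ht', map_zero]

theorem grDim_const (hyz : y ≠ z) (hi : X.rk z + X.rk y - 2 ≤ 2 * i)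
    (hj : X.rk z + X.rk y - 2 ≤ 2 * j) : X.grDim Φ A y i = X.grDim Φ A y j := by
  rw [grDim, grDim, I.sup_eq_fix hyz hi, I.sup_eq_fix hyz hj]

theorem grDim_self (h : X.rk z ≤ i) : X.grDim Φ A z i = 1 := by
  have h1 := I.finrank_add (y := z) (i := i) (j := X.rk z - 1 + X.rk z - i) (by omega)
  have h2 : Φ z (X.rk z - 1 + X.rk z - i) = ⊥ := I.eq_bot (by omega)
  rw [h2, finrank_bot, I.finrank] at h1
  rw [grDim, I.joinUp_eq_bot, sup_bot_eq, finrank_bot]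
  omega

open scoped Classical in
theorem finrank_iSup (hgen : ∀ x y, x ≤ y → Gen A x y) (x : L) (i : ℤ) :
    (Module.finrank ℝ (Φ x i) : ℤ) =
      ∑ y ∈ Finset.univ.filter (x ≤ ·), X.grDim Φ A y i := by
  let S : Finset L → Submodule ℝ E := fun T => ⨆ y ∈ T.filter (x ≤ ·), Φ y i
  have hS : S Finset.univ = Φ x i := by
    refine le_antisymm (iSup₂_le fun y hy => ?_) (le_iSup₂_of_le x (by simp) le_rfl)
    exact I.compat (Finset.mem_univ x) (by simpa using hy) i
  rw [← hS]
  refine upset_induction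
    (p := fun T => (Module.finrank ℝ (S T) : ℤ) = ∑ y ∈ T.filter (x ≤ ·), X.grDim Φ A y i)
    ∅ (by simp [isUpperSet_empty]) (by simp [S]) fun T y hT hyT habove ih => ?_
  by_cases hxy : x ≤ y
  swap
  · have : (insert y T).filter (x ≤ ·) = T.filter (x ≤ ·) := by
      rw [Finset.filter_insert, if_neg hxy]
    have hST : S (insert y T) = S T := congrArg (fun F : Finset L => ⨆ w ∈ F, Φ w i) this
    rwa [hST, this]
  have hfil : (insert y T).filter (x ≤ ·) = insert y (T.filter (x ≤ ·)) := by
    rw [Finset.filter_insert, if_pos hxy]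
  have hST : S (insert y T) = Φ y i ⊔ S T := by
    simp only [S, hfil]
    exact Finset.iSup_insert _ _ _
  have hinf : Φ y i ⊓ S T = Φ y i ⊓ joinUp (X.fix ⊤) A y := by
    have hy := Finset.mem_univ y
    apply le_antisymm
    · rintro v ⟨hv, hvS⟩
      refine ⟨hv, ?_⟩
      have hle : S T ≤ (joinUp (X.fix ⊤) A y).comap (X.P y) := by
        refine iSup₂_le fun w hw u hu => ?_
        have hwT := (Finset.mem_filter.1 hw).1
        have hwy : ¬ w ≤ y := fun h => hyT (hT h hwT)
        obtain ⟨a, ha, hay, haw⟩ :=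
          (hgen y (y ⊔ w) le_sup_left).exists_step (left_lt_sup.2 hwy).ne
        refine mem_joinUp ha hay (fix_le_of_le (sup_le le_sup_left haw) ?_)
        refine mem_fix.2 ⟨trivial, ?_⟩
        have huw : X.P w u = u := (mem_fix.1 (I.le_fix (Finset.mem_univ w) _ hu)).2
        have : X.P y u = X.P (y ⊔ w) u := by rw [X.P_sup, huw]
        rw [this, X.P_idem]
      have := hle hvS
      rwa [Submodule.mem_comap, (mem_fix.1 (I.le_fix hy i hv)).2] at this
    · rintro v ⟨hv, hvJ⟩
      refine ⟨hv, ?_⟩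
      have hK := I.cell hy (Finset.Subset.refl A) hv hvJ
      refine joinUp_le (fun a _ hay => ?_) hK
      exact le_iSup₂_of_le (y ⊔ a) (Finset.mem_filter.2
        ⟨habove _ (left_lt_sup.2 hay), hxy.trans le_sup_left⟩) le_rfl
  rw [hST, hfil, Finset.sum_insert (by simp [hyT]), ← ih, grDim]
  have h1 := Submodule.finrank_sup_add_finrank_inf_eq (Φ y i) (S T)
  have h2 := Submodule.finrank_sup_add_finrank_inf_eq (Φ y i) (joinUp (X.fix ⊤) A y)
  rw [hinf] at h1
  omega

end Built

end KLSpace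

namespace KLSpace

section geometric

variable {L : Type*} [Lattice L] [BoundedOrder L]

theorem sup_covBy_of_isAtom (hUpperSemimodular : ∀ a b : L, a ⊓ b ⋖ b → a ⋖ a ⊔ b) {a y : L}
    (ha : IsAtom a) (hay : ¬ a ≤ y) : y ⋖ y ⊔ a := by
  refine hUpperSemimodular y a ?_
  have : y ⊓ a = ⊥ := (ha.le_iff.1 inf_le_right).resolve_right fun h => hay (inf_eq_right.1 h)
  rw [this]
  exact ha.bot_covBy

theorem gen_of_atomistic (hAtomistic : ∀ x : L, ∃ s : Finset L, (∀ a ∈ s, IsAtom a) ∧ x = s.sup id)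
    {A : Finset L} (hA : ∀ a, IsAtom a → a ∈ A) {x y : L} (h : x ≤ y) : Gen A x y := by
  classical
  obtain ⟨s, hs, rfl⟩ := hAtomistic y
  have key : Gen A x (x ⊔ s.sup id) := by
    clear h
    induction s using Finset.induction_on with
    | empty => simpa using Gen.base
    | insert a s _ ih =>
      have := (ih fun b hb => hs b (Finset.mem_insert_of_mem hb)).step
        (hA a (hs a (Finset.mem_insert_self _ _)))
      rwa [sup_assoc, sup_comm (s.sup id), ← id_eq a, ← Finset.sup_insert] at this
  rwa [sup_eq_right.2 h] at key

open Polynomial in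
/-- For every `z` there is a family of polynomials with nonnegative coefficients and the
degree bound and symmetry characterizing Kazhdan–Lusztig polynomials. -/
theorem exists_palindromic [Fintype L] [LocallyFiniteOrder L]
    (hAtomistic : ∀ x : L, ∃ s : Finset L, (∀ a ∈ s, IsAtom a) ∧ x = s.sup id)
    (hUpperSemimodular : ∀ a b : L, a ⊓ b ⋖ b → a ⋖ a ⊔ b)
    {rk : L → ℕ} (hmono : StrictMono rk) (hrk_cov : ∀ x y : L, x ⋖ y → rk y = rk x + 1) (z : L) :
    ∃ Q : L → ℤ[X], Q z = 1 ∧ (∀ y n, 0 ≤ (Q y).coeff n) ∧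
      (∀ y < z, ∀ n, rk z - rk y ≤ 2 * n → (Q y).coeff n = 0) ∧
      ∀ x ≤ z, reflect (rk z - rk x) (∑ y ∈ Finset.Icc x z, X ^ (rk y - rk x) * Q y) =
        ∑ y ∈ Finset.Icc x z, X ^ (rk y - rk x) * Q y := by
  classical
  obtain ⟨E, _, _, _, Y, Φ, hY, I⟩ := exists_built (A := Finset.univ.filter IsAtom)
    (fun y => (rk y : ℤ)) (fun a b h => Nat.cast_lt.2 (hmono h))
    (fun a ha y hay => by
      exact_mod_cast hrk_cov _ _
        (sup_covBy_of_isAtom hUpperSemimodular (Finset.mem_filter.1 ha).2 hay))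
    (fun x y h => gen_of_atomistic hAtomistic (by simp) h) z
  set A : Finset L := Finset.univ.filter IsAtom
  have hgen : ∀ x y, x ≤ y → Gen A x y := fun x y h => gen_of_atomistic hAtomistic (by simp [A]) h
  have hrk : ∀ y, Y.rk y = rk y := fun y => congrFun hY y
  let d : L → ℤ → ℤ := fun y i => Y.grDim Φ A y i - Y.grDim Φ A y (i - 1)
  have d_nonneg : ∀ y i, 0 ≤ d y i := fun y i => sub_nonneg.2 (I.grDim_mono (by omega))
  have d_lt : ∀ y (i : ℤ), i < rk y → d y i = 0 := fun y i h => by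
    simp only [d]
    rw [I.grDim_of_lt (by rw [hrk]; omega), I.grDim_of_lt (by rw [hrk]; omega), sub_zero]
  have d_high : ∀ y, y ≠ z → ∀ i, (rk z + rk y : ℤ) ≤ 2 * i → d y i = 0 := fun y hy i h => by
    simp only [d]
    rw [I.grDim_const hy (i := i) (j := i - 1) (by rw [hrk, hrk]; omega)
      (by rw [hrk, hrk]; omega), sub_self]
  have d_self : ∀ i : ℤ, d z i = if i = rk z then 1 else 0 := fun i => by
    rcases lt_trichotomy i (rk z) with h | h | h
    · rw [d_lt z i h, if_neg h.ne]
    · rw [if_pos h]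
      simp only [d]
      rw [I.grDim_self (by rw [hrk]; omega), I.grDim_of_lt (by rw [hrk]; omega), sub_zero]
    · rw [if_neg h.ne']
      simp only [d]
      rw [I.grDim_self (by rw [hrk]; omega), I.grDim_self (by rw [hrk]; omega), sub_self]
  let Q : L → ℤ[X] := fun y => ∑ j ∈ Finset.range (rk z + 1), C (d y (rk y + j)) * X ^ j
  have coeff_Q : ∀ y ≤ z, ∀ n, (Q y).coeff n = d y (rk y + n) := fun y hy n => by
    simp only [Q, finsetSum_coeff, coeff_C_mul_X_pow, Finset.sum_ite_eq, Finset.mem_range]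
    split_ifs with h
    · rfl
    · symm
      by_cases hyz : y = z
      · rw [hyz, d_self, if_neg (by omega)]
      · exact d_high y hyz _ (by have := hmono.monotone hy; omega)
  have coeff_sum : ∀ x ≤ z, ∀ n : ℕ, (∑ y ∈ Finset.Icc x z, X ^ (rk y - rk x) * Q y).coeff n =
      (Module.finrank ℝ (Φ x (rk x + n)) : ℤ) - Module.finrank ℝ (Φ x (rk x + n - 1)) := by
    intro x _ n
    rw [I.finrank_iSup hgen, I.finrank_iSup hgen, ← Finset.sum_sub_distrib, finsetSum_coeff]
    refine Finset.sum_subset_zero_on_sdiff (fun y hy => by simp_all) (fun y hy => ?_)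
      fun y hy => ?_
    · have : ¬ y ≤ z := fun h => (Finset.mem_sdiff.1 hy).2
        (Finset.mem_Icc.2 ⟨by simpa using (Finset.mem_sdiff.1 hy).1, h⟩)
      rw [I.grDim_of_not_le this, I.grDim_of_not_le this, sub_zero]
    · obtain ⟨hxy, hyz⟩ := Finset.mem_Icc.1 hy
      have := hmono.monotone hxy
      rw [coeff_X_pow_mul']
      split_ifs with h
      · have e : (rk y : ℤ) + ((n - (rk y - rk x) : ℕ) : ℤ) = rk x + n := by omega
        rw [coeff_Q y hyz, e]
      · exact (d_lt y _ (by omega)).symm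
  refine ⟨Q, ?_, fun y n => ?_, fun y hy n hn => ?_, fun x hx => ?_⟩
  · ext n
    rw [coeff_Q z le_rfl, d_self, coeff_one]
    congr 1
    simp
  · simp only [Q, finsetSum_coeff, coeff_C_mul_X_pow]
    exact Finset.sum_nonneg fun j _ => by split_ifs <;> simp [d_nonneg]
  · rw [coeff_Q y hy.le]
    exact d_high y hy.ne _ (by have := hmono hy; omega)
  · ext n
    rw [coeff_reflect]
    rcases le_or_gt n (rk z - rk x) with h | h
    · rw [revAt_le h, coeff_sum x hx, coeff_sum x hx]
      have := hmono.monotone hx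
      have h1 := I.finrank_add (y := x) (i := rk x + n) (j := rk z - n - 1)
        (by rw [hrk, hrk]; omega)
      have h2 := I.finrank_add (y := x) (i := rk x + n - 1) (j := rk z - n)
        (by rw [hrk, hrk]; omega)
      have e : (rk x : ℤ) + ((rk z - rk x - n : ℕ) : ℤ) = rk z - n := by omega
      rw [e]
      omega
    · rw [revAt_eq_self_of_lt h]

end geometric

section moebius

variable {L : Type*} [PartialOrder L] [LocallyFiniteOrder L] {μ : L → L → ℤ}

open scoped Classical in
theorem sum_moebius_left (hμ_refl : ∀ x : L, μ x x = 1)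
    (hμ_sum : ∀ x y : L, x < y → ∑ w ∈ Finset.Icc x y, μ x w = 0) (x y : L) :
    ∑ w ∈ Finset.Icc x y, μ w y = if x = y then 1 else 0 := by
  have hmu : ∀ n (x y : L), (Finset.Icc x y).card = n → x ≤ y →
      μ x y = IncidenceAlgebra.mu ℤ x y := by
    intro n
    induction n using Nat.strong_induction_on with
    | _ n ih =>
    intro x y hn hxy
    rcases hxy.eq_or_lt with rfl | hlt
    · rw [hμ_refl, IncidenceAlgebra.mu_self]
    · have h1 := hμ_sum x y hlt
      have h2 := IncidenceAlgebra.sum_Icc_mu_right (𝕜 := ℤ) x y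
      rw [if_neg hlt.ne] at h2
      rw [← Finset.Ico_insert_right hxy, Finset.sum_insert Finset.right_notMem_Ico] at h1 h2
      have : ∑ w ∈ Finset.Ico x y, μ x w = ∑ w ∈ Finset.Ico x y, IncidenceAlgebra.mu ℤ x w := by
        refine Finset.sum_congr rfl fun w hw => ?_
        obtain ⟨hxw, hwy⟩ := Finset.mem_Ico.1 hw
        refine ih _ ?_ x w rfl hxw
        rw [← hn]
        refine Finset.card_lt_card (Finset.ssubset_iff_subset_ne.2
          ⟨Finset.Icc_subset_Icc_right hwy.le, fun h => ?_⟩)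
        exact hwy.not_ge (Finset.mem_Icc.1 (h ▸ Finset.right_mem_Icc.2 hxy)).2
      omega
  have := IncidenceAlgebra.sum_Icc_mu_left (𝕜 := ℤ) x y
  rw [← this]
  exact Finset.sum_congr rfl fun w hw => hmu _ w y rfl (Finset.mem_Icc.1 hw).2

end moebius

end KLSpace

namespace KLSpace

open Polynomial in
theorem reflect_X_pow_mul {f : ℤ[X]} {m n : ℕ} (h : f.natDegree ≤ n) :
    reflect (m + n) (X ^ m * f) = reflect n f := by
  rw [reflect_mul _ _ (natDegree_X_pow_le m) h, ← one_mul (X ^ m : ℤ[X]), ← C_1,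
    reflect_C_mul_X_pow, revAt_le le_rfl, Nat.sub_self, pow_zero, C_1, one_mul, one_mul]

open Polynomial in
/-- The degree-shifted sum of the Kazhdan–Lusztig polynomials of upper intervals is
palindromic. -/
theorem reflect_sum_KL {L : Type*} [PartialOrder L] [LocallyFiniteOrder L]
    {rk : L → ℕ} (hmono : StrictMono rk) {μ : L → L → ℤ} (hμ_refl : ∀ x : L, μ x x = 1)
    (hμ_sum : ∀ x y : L, x < y → ∑ w ∈ Finset.Icc x y, μ x w = 0)
    {KL : L → L → ℤ[X]} {z : L} (hdeg : ∀ x ≤ z, (KL x z).natDegree ≤ rk z - rk x)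
    (hrec : ∀ x ≤ z, reflect (rk z - rk x) (KL x z) = ∑ y ∈ Finset.Icc x z,
      (∑ w ∈ Finset.Icc x y, C (μ x w) * X ^ (rk y - rk w)) * KL y z)
    (x : L) :
    reflect (rk z - rk x) (∑ y ∈ Finset.Icc x z, X ^ (rk y - rk x) * KL y z) =
      ∑ y ∈ Finset.Icc x z, X ^ (rk y - rk x) * KL y z := by
  classical
  have hlin : ∀ (s : Finset L) (f : L → ℤ[X]) (N : ℕ),
      reflect N (∑ y ∈ s, f y) = ∑ y ∈ s, reflect N (f y) := by
    intro s f N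
    ext n
    simp [coeff_reflect]
  have h1 : ∀ y ∈ Finset.Icc x z, reflect (rk z - rk x) (X ^ (rk y - rk x) * KL y z) =
      ∑ v ∈ Finset.Icc y z,
        (∑ w ∈ Finset.Icc y v, C (μ y w) * X ^ (rk v - rk w)) * KL v z := by
    intro y hy
    obtain ⟨hxy, hyz⟩ := Finset.mem_Icc.1 hy
    have e1 := hmono.monotone hxy
    have e2 := hmono.monotone hyz
    rw [← hrec y hyz, show rk z - rk x = (rk y - rk x) + (rk z - rk y) by omega,
      reflect_X_pow_mul (hdeg y hyz)]
  rw [hlin, Finset.sum_congr rfl h1,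
    Finset.sum_comm' (t' := Finset.Icc x z) (s' := fun v => Finset.Icc x v)]
  · refine Finset.sum_congr rfl fun v hv => ?_
    rw [← Finset.sum_mul]
    congr 1
    rw [Finset.sum_comm' (t' := Finset.Icc x v) (s' := fun w => Finset.Icc x w)]
    · have h2 : ∀ w ∈ Finset.Icc x v,
          ∑ y ∈ Finset.Icc x w, (C (μ y w) * X ^ (rk v - rk w) : ℤ[X]) =
            if x = w then X ^ (rk v - rk w) else 0 := by
        intro w _
        rw [← Finset.sum_mul, ← map_sum, sum_moebius_left hμ_refl hμ_sum]
        split_ifs <;> simp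
      rw [Finset.sum_congr rfl h2, Finset.sum_ite_eq,
        if_pos (Finset.left_mem_Icc.2 (Finset.mem_Icc.1 hv).1)]
    · intro y w
      simp only [Finset.mem_Icc]
      exact ⟨fun h => ⟨⟨h.1.1, h.2.1⟩, h.1.1.trans h.2.1, h.2.2⟩,
        fun h => ⟨⟨h.1.1, h.1.2.trans h.2.2⟩, h.1.2, h.2.2⟩⟩
  · intro y v
    simp only [Finset.mem_Icc]
    exact ⟨fun h => ⟨⟨h.1.1, h.2.1⟩, h.1.1.trans h.2.1, h.2.2⟩,
      fun h => ⟨⟨h.1.1, h.1.2.trans h.2.2⟩, h.1.2, h.2.2⟩⟩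

open Polynomial in
/-- The degree bound and the palindromicity of the shifted sums determine the family. -/
theorem eq_of_reflect_sum {L : Type*} [PartialOrder L] [Finite L] [LocallyFiniteOrder L]
    {rk : L → ℕ} (hmono : StrictMono rk) {z : L} {F G : L → ℤ[X]} (hz : F z = G z)
    (hF : ∀ y < z, ∀ n, rk z - rk y ≤ 2 * n → (F y).coeff n = 0)
    (hG : ∀ y < z, ∀ n, rk z - rk y ≤ 2 * n → (G y).coeff n = 0)
    (hFr : ∀ x ≤ z, reflect (rk z - rk x) (∑ y ∈ Finset.Icc x z, X ^ (rk y - rk x) * F y) =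
      ∑ y ∈ Finset.Icc x z, X ^ (rk y - rk x) * F y)
    (hGr : ∀ x ≤ z, reflect (rk z - rk x) (∑ y ∈ Finset.Icc x z, X ^ (rk y - rk x) * G y) =
      ∑ y ∈ Finset.Icc x z, X ^ (rk y - rk x) * G y) {x : L} (hx : x ≤ z) : F x = G x := by
  classical
  induction x using (wellFounded_gt (α := L)).induction with
  | _ x ih =>
  rcases hx.eq_or_lt with rfl | hlt
  · exact hz
  have h1 := hFr x hx
  have h2 := hGr x hx
  rw [← Finset.Ioc_insert_left hx, Finset.sum_insert Finset.left_notMem_Ioc, Nat.sub_self,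
    pow_zero, one_mul, reflect_add] at h1 h2
  have h3 : ∑ y ∈ Finset.Ioc x z, X ^ (rk y - rk x) * F y =
      ∑ y ∈ Finset.Ioc x z, X ^ (rk y - rk x) * G y :=
    Finset.sum_congr rfl fun y hy => by
      rw [ih y (Finset.mem_Ioc.1 hy).1 (Finset.mem_Ioc.1 hy).2]
  rw [h3] at h1
  have hr := hmono hlt
  ext n
  by_cases hn : rk z - rk x ≤ 2 * n
  · rw [hF x hlt n hn, hG x hlt n hn]
  · have e1 := congrArg (fun p : ℤ[X] => p.coeff n) h1
    have e2 := congrArg (fun p : ℤ[X] => p.coeff n) h2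
    simp only [coeff_add, coeff_reflect] at e1 e2
    rw [revAt_le (by omega)] at e1 e2
    rw [hF x hlt (rk z - rk x - n) (by omega)] at e1
    rw [hG x hlt (rk z - rk x - n) (by omega)] at e2
    omega

end KLSpace

/-- Let `L` be a finite geometric lattice with rank function `rk` and
Möbius function `μ`, and let `(P_{xy})_{x ≤ y}` be a family of polynomials in `ℤ[t]`
satisfying: (i) `P_{xx} = 1`; (ii) `deg P_{xy} < rk[x,y]/2` for `x < y`; and
(iii) for all `x < z`,
`t^{rk[x,z]} P_{xz}(1/t) = ∑_{x ≤ y ≤ z} χ_{xy}(t) P_{yz}(t)`, where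
`χ_{xy}(t) = ∑_{x ≤ w ≤ y} μ(x,w) t^{rk[w,y]}` is the characteristic polynomial.
(These are the Kazhdan–Lusztig polynomials of the intervals of `L`.)
Then every coefficient of every `P_{xy}` (for `x ≤ y`) is nonnegative. -/
theorem kazhdan_lusztig_polynomials_of_geometric_lattice_nonneg
    {L : Type*} [Lattice L] [BoundedOrder L] [Fintype L] [LocallyFiniteOrder L]
    (hAtomistic : ∀ x : L, ∃ s : Finset L, (∀ a ∈ s, IsAtom a) ∧ x = s.sup id)
    (hUpperSemimodular : ∀ a b : L, a ⊓ b ⋖ b → a ⋖ a ⊔ b)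
    (rk : L → ℕ) (hrk_bot : rk ⊥ = 0)
    (hrk_cov : ∀ x y : L, x ⋖ y → rk y = rk x + 1)
    (μ : L → L → ℤ)
    (hμ_refl : ∀ x : L, μ x x = 1)
    (hμ_sum : ∀ x y : L, x < y → ∑ w ∈ Finset.Icc x y, μ x w = 0)
    (KL : L → L → Polynomial ℤ)
    (hKL_refl : ∀ x : L, KL x x = 1)
    (hKL_deg : ∀ x y : L, x < y →
      2 * (KL x y).degree < ((rk y - rk x : ℕ) : WithBot ℕ))
    (hKL_rec : ∀ x z : L, x < z →
      Polynomial.reflect (rk z - rk x) (KL x z)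
        = ∑ y ∈ Finset.Icc x z,
            (∑ w ∈ Finset.Icc x y, Polynomial.C (μ x w) * Polynomial.X ^ (rk y - rk w)) *
              KL y z) :
    ∀ x y : L, x ≤ y → ∀ n : ℕ, 0 ≤ (KL x y).coeff n := by
  intro x z hxz n
  have hmono : StrictMono rk :=
    (strictMono_iff_forall_covBy rk).2 fun x y h => by rw [hrk_cov x y h]; omega
  obtain ⟨Q, hQz, hQ0, hQd, hQr⟩ :=
    KLSpace.exists_palindromic hAtomistic hUpperSemimodular hmono hrk_cov z
  have hcoeff : ∀ y < z, ∀ n, rk z - rk y ≤ 2 * n → (KL y z).coeff n = 0 := by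
    intro y hy n hn
    refine Polynomial.coeff_eq_zero_of_degree_lt ?_
    have h := hKL_deg y z hy
    by_contra! hle
    have h0 : KL y z ≠ 0 := by
      rintro h0
      rw [h0, Polynomial.degree_zero, le_bot_iff] at hle
      exact WithBot.coe_ne_bot hle
    rw [Polynomial.degree_eq_natDegree h0] at h hle
    have h' : 2 * (KL y z).natDegree < rk z - rk y := by exact_mod_cast h
    have hle' : n ≤ (KL y z).natDegree := by exact_mod_cast hle
    omega
  have hnat : ∀ y ≤ z, (KL y z).natDegree ≤ rk z - rk y := by
    intro y hy
    rcases hy.eq_or_lt with rfl | hlt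
    · simp [hKL_refl]
    · exact Polynomial.natDegree_le_iff_coeff_eq_zero.2 fun n hn => hcoeff y hlt n (by omega)
  have hrec : ∀ y ≤ z, Polynomial.reflect (rk z - rk y) (KL y z) = ∑ v ∈ Finset.Icc y z,
      (∑ w ∈ Finset.Icc y v, Polynomial.C (μ y w) * Polynomial.X ^ (rk v - rk w)) * KL v z := by
    intro y hy
    rcases hy.eq_or_lt with rfl | hlt
    · simp [hKL_refl, hμ_refl]
    · exact hKL_rec y z hlt
  rw [KLSpace.eq_of_reflect_sum (F := fun y => KL y z) hmono ((hKL_refl z).trans hQz.symm) hcoeff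
    hQd (fun x _ => KLSpace.reflect_sum_KL hmono hμ_refl hμ_sum hnat hrec x) hQr hxz]
  exact hQ0 x n
end

section
/- Let L be a finite geometric lattice, and let (g_{xy})_{x≤y∈L} be a family of polynomials in ℤ[t] satisfying: (i) g_{xx}(t) = 1 for all x ∈ L; (ii) deg g_{xy} < rk[x,y]/2 for all x < y; and (iii) for all x < z, t^{rk[x,z]}·g_{xz}(1/t) = Σ_{x≤y≤z} g_{xy}(t)·χ_{yz}(t) in ℤ[t]. (These are the left Kazhdan–Lusztig–Stanley polynomials of the kernel χ.) Then every coefficient of every polynomial g_{xy} is nonnegative. -/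
/-- A left inverse of the zeta function of a finite order is also a right inverse. -/
theorem sum_Icc_mobius_left {L : Type*} [PartialOrder L] [Fintype L] [LocallyFiniteOrder L]
    (μ : L → L → ℤ) (hμ_refl : ∀ x : L, μ x x = 1)
    (hμ_sum : ∀ x y : L, x < y → ∑ w ∈ Finset.Icc x y, μ x w = 0) {x z : L} (hxz : x < z) :
    ∑ y ∈ Finset.Icc x z, μ y z = 0 := by
  classical
  let M : Matrix L L ℤ := fun a b => if a ≤ b then μ a b else 0
  let Z : Matrix L L ℤ := fun a b => if a ≤ b then 1 else 0
  have hIcc (a b : L) : Finset.Icc a b = Finset.univ.filter fun w => a ≤ w ∧ w ≤ b := by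
    ext; simp
  have hMZ : M * Z = 1 := by
    ext a b
    have hsum : (M * Z) a b = ∑ w ∈ Finset.Icc a b, μ a w := by
      rw [hIcc, Finset.sum_filter, Matrix.mul_apply]
      refine Finset.sum_congr rfl fun w _ => ?_
      by_cases h₁ : a ≤ w <;> by_cases h₂ : w ≤ b <;> simp [M, Z, h₁, h₂]
    rw [hsum, Matrix.one_apply]
    split_ifs with hab
    · subst hab
      simp [hμ_refl]
    · by_cases hle : a ≤ b
      · exact hμ_sum a b (lt_of_le_of_ne hle hab)
      · simp [Finset.Icc_eq_empty hle]
  have hZM : (Z * M) x z = 0 := by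
    rw [mul_eq_one_comm.mp hMZ, Matrix.one_apply_ne hxz.ne]
  rw [← hZM, hIcc, Finset.sum_filter, Matrix.mul_apply]
  refine Finset.sum_congr rfl fun w _ => ?_
  by_cases h₁ : x ≤ w <;> by_cases h₂ : w ≤ z <;> simp [M, Z, h₁, h₂]

/-- The characteristic polynomials of the upper intervals of `[x, z]` sum to `t ^ rk[x, z]`. -/
theorem sum_Icc_charpoly {L : Type*} [PartialOrder L] [Fintype L] [LocallyFiniteOrder L]
    (rk : L → ℕ) (μ : L → L → ℤ) (hμ_refl : ∀ x : L, μ x x = 1)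
    (hμ_sum : ∀ x y : L, x < y → ∑ w ∈ Finset.Icc x y, μ x w = 0) {x z : L} (hxz : x ≤ z) :
    ∑ y ∈ Finset.Icc x z, ∑ w ∈ Finset.Icc y z,
        Polynomial.C (μ y w) * Polynomial.X ^ (rk z - rk w)
      = (Polynomial.X ^ (rk z - rk x) : Polynomial ℤ) := by
  rw [Finset.sum_comm' (t' := Finset.Icc x z) (s' := fun w => Finset.Icc x w)]
  · rw [Finset.sum_eq_single_of_mem x (Finset.left_mem_Icc.mpr hxz)]
    · simp [hμ_refl]
    · intro w hw hne
      rw [← Finset.sum_mul, ← map_sum, sum_Icc_mobius_left μ hμ_refl hμ_sum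
        (lt_of_le_of_ne (Finset.mem_Icc.mp hw).1 hne.symm)]
      simp
  · intro y w
    simp only [Finset.mem_Icc]
    constructor
    · rintro ⟨⟨h₁, -⟩, h₂, h₃⟩
      exact ⟨⟨h₁, h₂⟩, h₁.trans h₂, h₃⟩
    · rintro ⟨⟨h₁, h₂⟩, -, h₃⟩
      exact ⟨⟨h₁, h₂.trans h₃⟩, h₂, h₃⟩

/-- A polynomial of degree less than `r / 2` whose `r`-reversal is `p - 1 + t ^ r` equals `1`. -/
theorem Polynomial.eq_one_of_reflect_eq {p : Polynomial ℤ} {r : ℕ} (hr : 0 < r)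
    (hdeg : 2 * p.degree < (r : WithBot ℕ))
    (hp : p.reflect r = p - 1 + Polynomial.X ^ r) : p = 1 := by
  have hzero (n : ℕ) (hn : r ≤ 2 * n) : p.coeff n = 0 := by
    by_contra hne
    have hp0 : p ≠ 0 := by
      rintro rfl
      simp at hne
    have hle := Polynomial.le_natDegree_of_ne_zero hne
    rw [Polynomial.degree_eq_natDegree hp0] at hdeg
    have hlt : 2 * p.natDegree < r := by exact_mod_cast hdeg
    omega
  ext n
  rw [Polynomial.coeff_one]
  by_cases hn : r ≤ 2 * n
  · rw [hzero n hn, if_neg (by omega)]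
  · have hcoeff := congrArg (fun q => q.coeff (r - n)) hp
    simp only [Polynomial.coeff_reflect, Polynomial.revAt_le (Nat.sub_le r n),
      Nat.sub_sub_self (show n ≤ r by omega), Polynomial.coeff_add, Polynomial.coeff_sub,
      Polynomial.coeff_one, Polynomial.coeff_X_pow, hzero (r - n) (by omega)] at hcoeff
    rw [hcoeff, if_neg (by omega)]
    by_cases h0 : n = 0
    · simp [h0]
    · rw [if_neg (by omega), if_neg h0]
      simp


/-- Let `L` be a finite geometric lattice with rank function `rk` and
Möbius function `μ`, and let `(g_{xy})_{x ≤ y}` be a family of polynomials in `ℤ[t]`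
satisfying: (i) `g_{xx} = 1`; (ii) `deg g_{xy} < rk[x,y]/2` for `x < y`; and
(iii) for all `x < z`,
`t^{rk[x,z]} g_{xz}(1/t) = ∑_{x ≤ y ≤ z} g_{xy}(t) χ_{yz}(t)`, where
`χ_{yz}(t) = ∑_{y ≤ w ≤ z} μ(y,w) t^{rk[w,z]}` is the characteristic polynomial.
(These are the left Kazhdan–Lusztig–Stanley polynomials of the kernel `χ`.)
Then every coefficient of every `g_{xy}` (for `x ≤ y`) is nonnegative. -/
theorem left_KLS_polynomials_of_geometric_lattice_nonneg
    {L : Type*} [Lattice L] [BoundedOrder L] [Fintype L] [LocallyFiniteOrder L]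
    (hAtomistic : ∀ x : L, ∃ s : Finset L, (∀ a ∈ s, IsAtom a) ∧ x = s.sup id)
    (hUpperSemimodular : ∀ a b : L, a ⊓ b ⋖ b → a ⋖ a ⊔ b)
    (rk : L → ℕ) (hrk_bot : rk ⊥ = 0)
    (hrk_cov : ∀ x y : L, x ⋖ y → rk y = rk x + 1)
    (μ : L → L → ℤ)
    (hμ_refl : ∀ x : L, μ x x = 1)
    (hμ_sum : ∀ x y : L, x < y → ∑ w ∈ Finset.Icc x y, μ x w = 0)
    (g : L → L → Polynomial ℤ)
    (hg_refl : ∀ x : L, g x x = 1)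
    (hg_deg : ∀ x y : L, x < y →
      2 * (g x y).degree < ((rk y - rk x : ℕ) : WithBot ℕ))
    (hg_rec : ∀ x z : L, x < z →
      Polynomial.reflect (rk z - rk x) (g x z)
        = ∑ y ∈ Finset.Icc x z,
            g x y *
              (∑ w ∈ Finset.Icc y z, Polynomial.C (μ y w) * Polynomial.X ^ (rk z - rk w))) :
    ∀ x y : L, x ≤ y → ∀ n : ℕ, 0 ≤ (g x y).coeff n := by
  have hrk : StrictMono rk := (strictMono_iff_forall_covBy rk).2 fun x y h => by
    rw [hrk_cov x y h]
    exact Nat.lt_succ_self _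
  have hone (x z : L) (hxz : x ≤ z) : g x z = 1 := by
    induction z using WellFoundedLT.induction with
    | _ z ih =>
      rcases hxz.eq_or_lt with rfl | hlt
      · exact hg_refl x
      refine Polynomial.eq_one_of_reflect_eq (Nat.sub_pos_of_lt (hrk hlt)) (hg_deg x z hlt) ?_
      rw [hg_rec x z hlt, ← sum_Icc_charpoly rk μ hμ_refl hμ_sum hxz,
        ← Finset.sum_Ico_add_eq_sum_Icc hxz, ← Finset.sum_Ico_add_eq_sum_Icc hxz,
        Finset.sum_congr rfl fun y hy => by
          rw [ih y (Finset.mem_Ico.mp hy).2 (Finset.mem_Ico.mp hy).1, one_mul]]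
      simp only [Finset.Icc_self, Finset.sum_singleton, hμ_refl, Nat.sub_self, pow_zero, map_one,
        mul_one]
      ring
  intro x y hxy n
  rw [hone x y hxy, Polynomial.coeff_one]
  split_ifs <;> simp
end
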